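/- arXiv:1208.2155 — 3 statements merged into one kernel-verified Lean document; each statement's English description precedes it below -/
import Mathlib

section
/- Let m ≥ 2 be an even integer, let τ_γ > 0 for γ = 0,1,…,m−1, τ_m = 1, and let 0 ≤ β < 2m. Then for every α with 0 ≤ α ≤ (1 − β/(2m))·(4π)^m·m!, there is a constant C (depending only on m, β, α and the τ_γ) such that every smooth function u : ℝ^{2m} → ℝ whose gradients ∇^γ u (0 ≤ γ ≤ m) are all square integrable and which satisfies ‖u‖_{Ẽ} ≤ 1 obeys ∫_{ℝ^{2m}} (e^{α u²} − 1)/|x|^β dx ≤ C. (Singular Adams-type inequality on ℝ^{2m}, Theorem 1.1.) -/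
open MeasureTheory Real Filter Topology

noncomputable section

abbrev Euc (n : ℕ) := EuclideanSpace ℝ (Fin n)

/-- The Laplacian of `u : ℝⁿ → ℝ`, computed as the sum of second partial derivatives. -/
noncomputable def lap (n : ℕ) (u : Euc n → ℝ) : Euc n → ℝ :=
  fun x => ∑ i : Fin n,
    fderiv ℝ (fun y => fderiv ℝ u y (EuclideanSpace.single i 1)) x (EuclideanSpace.single i 1)

/-- Iterated Laplacian `Δ^k u`. -/
noncomputable def lapIter (n : ℕ) : ℕ → (Euc n → ℝ) → (Euc n → ℝ)
  | 0 => id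
  | k+1 => fun u => lap n (lapIter n k u)

/-- `|∇^γ u|²`, where `∇^γ u = Δ^{γ/2} u` for even `γ` and `∇^γ u = ∇(Δ^{(γ-1)/2} u)` for odd. -/
noncomputable def gradNormSq (n γ : ℕ) (u : Euc n → ℝ) : Euc n → ℝ :=
  fun x => if γ % 2 = 0 then (lapIter n (γ/2) u x)^2
    else ∑ i : Fin n, (fderiv ℝ (lapIter n (γ/2) u) x (EuclideanSpace.single i 1))^2

lemma adm_ibp {n : ℕ} (χ F : Euc n → ℝ) (hχ : ContDiff ℝ 1 χ) (hs : HasCompactSupport χ)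
    (hF : ContDiff ℝ 1 F) (v : Euc n) :
    Integrable (fun x => χ x * fderiv ℝ F x v) ∧ 
    ∫ x, χ x * fderiv ℝ F x v = - ∫ x, fderiv ℝ χ x v * F x := by
  have c1 : Continuous (fun x => fderiv ℝ F x v) :=
    (hF.continuous_fderiv (by norm_num)).clm_apply continuous_const
  have c2 : Continuous (fun x => fderiv ℝ χ x v) :=
    (hχ.continuous_fderiv (by norm_num)).clm_apply continuous_const
  have i1 : Integrable (fun x => χ x * fderiv ℝ F x v) :=
    (hχ.continuous.mul c1).integrable_of_hasCompactSupport (hs.mul_right)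
  refine ⟨i1, integral_mul_fderiv_eq_neg_fderiv_mul_of_integrable ?_ i1 ?_ ?_ ?_⟩
  · exact (c2.mul hF.continuous).integrable_of_hasCompactSupport
      ((hs.fderiv_apply (𝕜 := ℝ) v).mul_right)
  · exact (hχ.continuous.mul hF.continuous).integrable_of_hasCompactSupport (hs.mul_right)
  · exact fun x _ => hχ.differentiable (by norm_num) x
  · exact fun x _ => hF.differentiable (by norm_num) x

lemma adm_div_zero {n : ℕ} (F : Fin n → Euc n → ℝ) (hF : ∀ i, ContDiff ℝ 1 (F i))
    (hi : ∀ i, Integrable (F i))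
    (hd : Integrable (fun x => ∑ i, fderiv ℝ (F i) x (EuclideanSpace.single i 1))) :
    ∫ x, ∑ i, fderiv ℝ (F i) x (EuclideanSpace.single i 1) = 0 := by
  let χ : ContDiffBump (0 : Euc n) := ⟨1, 2, by norm_num, by norm_num⟩
  have hχ : ContDiff ℝ 1 (χ : Euc n → ℝ) := χ.contDiff
  have hχs : HasCompactSupport (χ : Euc n → ℝ) := χ.hasCompactSupport
  obtain ⟨D, hD⟩ := (hχs.fderiv (𝕜 := ℝ)).exists_bound_of_continuous
    (hχ.continuous_fderiv (by norm_num))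
  let R : ℕ → ℝ := fun N => ((N : ℝ) + 1)⁻¹
  have hR0 : ∀ N, 0 < R N := fun N => by positivity
  have hR1 : ∀ N, R N ≤ 1 := fun N => by
    apply inv_le_one_of_one_le₀; linarith [Nat.cast_nonneg (α := ℝ) N]
  have hRt : Tendsto R atTop (𝓝 0) := by
    simpa [R, one_div] using tendsto_one_div_add_atTop_nhds_zero_nat (𝕜 := ℝ)
  let X : ℕ → Euc n → ℝ := fun N x => χ (R N • x)
  have hX : ∀ N, ContDiff ℝ 1 (X N) := fun N => hχ.comp (contDiff_const_smul _)
  have hXs : ∀ N, HasCompactSupport (X N) := fun N => hχs.comp_smul (hR0 N).ne'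
  have hXf : ∀ N x v, fderiv ℝ (X N) x v = R N * fderiv ℝ χ (R N • x) v := by
    intro N x v
    have h1 : HasFDerivAt (X N) ((fderiv ℝ χ (R N • x)).comp (R N • ContinuousLinearMap.id ℝ (Euc n))) x := by
      have ha : HasFDerivAt (χ : Euc n → ℝ) (fderiv ℝ χ (R N • x)) (R N • x) :=
        (hχ.differentiable (by norm_num) _).hasFDerivAt
      have hb : HasFDerivAt (fun x : Euc n => R N • x) (R N • ContinuousLinearMap.id ℝ (Euc n)) x :=
        (R N • ContinuousLinearMap.id ℝ (Euc n)).hasFDerivAt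
      exact HasFDerivAt.comp (g := (χ : Euc n → ℝ)) x ha hb
    rw [h1.fderiv]; simp
  have key : ∀ N, ∫ x, X N x * ∑ i, fderiv ℝ (F i) x (EuclideanSpace.single i 1)
      = - ∑ i, ∫ x, fderiv ℝ (X N) x (EuclideanSpace.single i 1) * F i x := by
    intro N
    simp_rw [Finset.mul_sum]
    rw [integral_finsetSum]
    · rw [← Finset.sum_neg_distrib]
      exact Finset.sum_congr rfl fun i _ => (adm_ibp _ _ (hX N) (hXs N) (hF i) _).2
    · exact fun i _ => (adm_ibp _ _ (hX N) (hXs N) (hF i) _).1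
  have l1 : Tendsto (fun N => ∫ x, X N x * ∑ i, fderiv ℝ (F i) x (EuclideanSpace.single i 1)) atTop
      (𝓝 (∫ x, 1 * ∑ i, fderiv ℝ (F i) x (EuclideanSpace.single i 1))) := by
    apply tendsto_integral_of_dominated_convergence
      (fun x => ‖∑ i, fderiv ℝ (F i) x (EuclideanSpace.single i 1)‖)
    · exact fun N => (hX N).continuous.aestronglyMeasurable.mul hd.1
    · exact hd.norm
    · intro N
      refine Eventually.of_forall fun x => ?_
      rw [norm_mul]
      apply mul_le_of_le_one_left (norm_nonneg _)
      rw [Real.norm_of_nonneg χ.nonneg]; exact χ.le_one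
    · refine Eventually.of_forall fun x => ?_
      apply Tendsto.mul_const
      have : Tendsto (fun N => X N x) atTop (𝓝 (χ ((0:ℝ) • x))) :=
        (hχ.continuous.tendsto _).comp (hRt.smul_const x)
      have e : χ ((0:ℝ) • x) = 1 := by
        rw [zero_smul]; exact χ.one_of_mem_closedBall (by simp [χ])
      rwa [e] at this
  have l2 : Tendsto (fun N => - ∑ i, ∫ x, fderiv ℝ (X N) x (EuclideanSpace.single i 1) * F i x) atTop
      (𝓝 (-∑ i : Fin n, ∫ x : Euc n, (0:ℝ))) := by
    apply Tendsto.neg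
    apply tendsto_finsetSum
    intro i _
    apply tendsto_integral_of_dominated_convergence (fun x => D * ‖F i x‖)
    · intro N
      exact (((hX N).continuous_fderiv (by norm_num)).clm_apply continuous_const).aestronglyMeasurable.mul (hi i).1
    · exact (hi i).norm.const_mul _
    · intro N
      refine Eventually.of_forall fun x => ?_
      rw [norm_mul, hXf]
      apply mul_le_mul_of_nonneg_right _ (norm_nonneg _)
      rw [norm_mul, Real.norm_of_nonneg (hR0 N).le]
      refine (mul_le_of_le_one_left (norm_nonneg _) (hR1 N)).trans ?_
      refine (ContinuousLinearMap.le_opNorm _ _).trans ?_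
      simpa using hD _
    · refine Eventually.of_forall fun x => ?_
      have : Tendsto (fun N => R N * (D * ‖F i x‖)) atTop (𝓝 0) := by simpa using hRt.mul_const (D * ‖F i x‖)
      apply squeeze_zero_norm _ this
      intro N
      rw [norm_mul, hXf, norm_mul, Real.norm_of_nonneg (hR0 N).le, mul_assoc]
      apply mul_le_mul_of_nonneg_left _ (hR0 N).le
      apply mul_le_mul_of_nonneg_right _ (norm_nonneg _)
      refine (ContinuousLinearMap.le_opNorm _ _).trans ?_
      simpa using hD _
  simp_rw [key] at l1
  have := tendsto_nhds_unique l1 l2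
  simpa using this

lemma adm_gauss_int {n : ℕ} {c : ℝ} (hc : 0 < c) (x : Euc n) :
    Integrable (fun y : Euc n => exp (-c * ‖y - x‖^2)) := by
  have h : Integrable (fun y : Euc n => exp (-c * ‖y‖^2)) := by
    have := (GaussianFourier.integrable_cexp_neg_mul_sq_norm_add (V := Euc n) (b := (c:ℂ)) (by simpa) 0 0).norm
    refine this.congr (Eventually.of_forall fun y => ?_)
    simp only [Complex.norm_exp]
    congr 1
    simp [← Complex.ofReal_pow, ← Complex.ofReal_mul]
  exact h.comp_sub_right x

lemma adm_gauss_memLp {n : ℕ} {c : ℝ} (hc : 0 < c) (x : Euc n) :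
    MemLp (fun y : Euc n => exp (-c * ‖y - x‖^2)) 2 := by
  rw [memLp_two_iff_integrable_sq (by fun_prop)]
  refine (adm_gauss_int (c := 2*c) (by positivity) x).congr (Eventually.of_forall fun y => ?_)
  simp only []
  rw [← Real.exp_nat_mul]; congr 1; push_cast; ring

lemma adm_gp {n : ℕ} {c : ℝ} (hc : 0 < c) (a b : ℝ) (x : Euc n) :
    MemLp (fun y : Euc n => (a + b * ‖y - x‖^2) * exp (-c * ‖y - x‖^2)) 2 := by
  refine ((adm_gauss_memLp (c := c/2) (by positivity) x).const_mul (|a| + |b| * (2/c))).of_le (by fun_prop)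
    (Eventually.of_forall fun y => ?_)
  set s := ‖y - x‖^2 with hs
  have hs0 : 0 ≤ s := by positivity
  rw [norm_mul, norm_mul, Real.norm_of_nonneg (exp_pos _).le, Real.norm_of_nonneg (exp_pos _).le,
    Real.norm_of_nonneg (by positivity : 0 ≤ |a| + |b| * (2/c)), Real.norm_eq_abs]
  have e1 : exp (-c * s) = exp (-(c/2) * s) * exp (-(c/2) * s) := by rw [← Real.exp_add]; congr 1; ring
  rw [e1, ← mul_assoc]
  apply mul_le_mul_of_nonneg_right _ (exp_pos _).le
  have h1 : exp (-(c/2) * s) ≤ 1 := by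
    rw [Real.exp_le_one_iff]; nlinarith
  have h2 : s * exp (-(c/2) * s) ≤ 2/c := by
    have h3 : (c/2) * s ≤ exp ((c/2)*s) := by linarith [Real.add_one_le_exp ((c/2)*s)]
    have h4 : exp ((c/2)*s) * exp (-(c/2) * s) = 1 := by rw [← Real.exp_add]; simp
    have h5 : (c/2)*s * exp (-(c/2)*s) ≤ 1 := by
      rw [← h4]; exact mul_le_mul_of_nonneg_right h3 (exp_pos _).le
    rw [le_div_iff₀ hc]; linarith
  calc |a + b * s| * exp (-(c/2) * s) ≤ (|a| + |b| * s) * exp (-(c/2)*s) := by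
        apply mul_le_mul_of_nonneg_right _ (exp_pos _).le
        refine (abs_add_le _ _).trans ?_
        rw [abs_mul, abs_of_nonneg hs0]
    _ = |a| * exp (-(c/2)*s) + |b| * (s * exp (-(c/2)*s)) := by ring
    _ ≤ |a| * 1 + |b| * (2/c) := by gcongr
    _ = _ := by ring

/-- heat kernel -/
def hk (m : ℕ) (r : ℝ) (z : Euc (2*m)) : ℝ := ((4*π*r)^m)⁻¹ * exp (-(1/(4*r)) * ‖z‖^2)

lemma hk_nonneg (m : ℕ) {r : ℝ} (hr : 0 ≤ r) (z : Euc (2*m)) : 0 ≤ hk m r z := by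
  unfold hk; positivity

lemma hk_continuous (m : ℕ) (r : ℝ) (x : Euc (2*m)) : Continuous (fun y => hk m r (y - x)) := by
  unfold hk; fun_prop

lemma hk_contDiff (m : ℕ) (r : ℝ) (x : Euc (2*m)) : ContDiff ℝ 1 (fun y => hk m r (y - x)) := by
  unfold hk
  have : ContDiff ℝ 1 (fun y : Euc (2*m) => ‖y - x‖^2) := (contDiff_id.sub contDiff_const).norm_sq ℝ
  fun_prop

lemma hk_fderiv (m : ℕ) (r : ℝ) (x y : Euc (2*m)) (i : Fin (2*m)) :
    fderiv ℝ (fun y => hk m r (y - x)) y (EuclideanSpace.single i 1)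
      = hk m r (y - x) * (-((y - x) i)/(2*r)) := by
  have h0 : HasFDerivAt (fun y : Euc (2*m) => ‖y - x‖^2) (2 • (innerSL ℝ (y - x)).comp (ContinuousLinearMap.id ℝ (Euc (2*m)))) y := by
    exact ((hasFDerivAt_id y).sub_const x).norm_sq
  have h1 := ((h0.const_mul (-(1/(4*r)))).exp).const_mul (((4*π*r)^m)⁻¹)
  have : fderiv ℝ (fun y => hk m r (y - x)) y = _ := h1.fderiv
  rw [this]
  simp [hk, EuclideanSpace.inner_single_right]
  rcases eq_or_ne r 0 with rfl | hr
  · simp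
  · field_simp
    ring

lemma hk_fderiv2 (m : ℕ) (r : ℝ) (hr : r ≠ 0) (x y : Euc (2*m)) (i : Fin (2*m)) :
    fderiv ℝ (fun y => hk m r (y - x) * (-((y - x) i)/(2*r))) y (EuclideanSpace.single i 1)
      = hk m r (y - x) * (((y - x) i)^2/(4*r^2) - 1/(2*r)) := by
  have h1 : HasFDerivAt (fun y : Euc (2*m) => (y - x) i) (EuclideanSpace.proj i : Euc (2*m) →L[ℝ] ℝ) y := by
    have := (EuclideanSpace.proj i : Euc (2*m) →L[ℝ] ℝ).hasFDerivAt (x := y - x)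
    exact this.comp y ((hasFDerivAt_id y).sub_const x)
  have h2 : HasFDerivAt (fun y : Euc (2*m) => -((y - x) i)/(2*r)) (-(1/(2*r)) • (EuclideanSpace.proj i : Euc (2*m) →L[ℝ] ℝ)) y := by
    refine (h1.const_mul (-(1/(2*r)))).congr_of_eventuallyEq (Eventually.of_forall fun z => ?_)
    simp only []
    ring
  have h3 := (((hk_contDiff m r x).differentiable (by norm_num) y).hasFDerivAt).mul h2
  have e : fderiv ℝ (fun y => hk m r (y - x) * (-((y - x) i)/(2*r))) y = _ := h3.fderiv
  rw [e]
  simp only [add_apply, smul_apply, smul_eq_mul, hk_fderiv]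
  simp
  field_simp
  ring

lemma hk_memLp (m : ℕ) {r : ℝ} (hr : 0 < r) (a b : ℝ) (x : Euc (2*m)) :
    MemLp (fun y => hk m r (y - x) * (a + b * ‖y-x‖^2)) 2 := by
  have := (adm_gp (c := 1/(4*r)) (by positivity) a b x).const_mul (((4*π*r)^m)⁻¹)
  refine this.congr_norm ?_ (Eventually.of_forall fun y => ?_)
  · exact ((hk_continuous m r x).mul (by fun_prop)).aestronglyMeasurable
  · unfold hk; congr 1; ring

lemma hk_memLp' (m : ℕ) {r : ℝ} (hr : 0 < r) (x : Euc (2*m)) :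
    MemLp (fun y => hk m r (y - x)) 2 := by
  simpa using hk_memLp m hr 1 0 x

lemma hk_deriv (m : ℕ) {r : ℝ} (hr : 0 < r) (z : Euc (2*m)) :
    HasDerivAt (fun r => hk m r z) (hk m r z * (-(m/r) + 1/(4*r^2) * ‖z‖^2)) r := by
  have h1 : HasDerivAt (fun r : ℝ => ((4*π*r)^m)⁻¹) (-(m/r) * ((4*π*r)^m)⁻¹) r := by
    have h := (((hasDerivAt_id r).const_mul (4*π)).pow m).inv (by show (4*π*r)^m ≠ 0; positivity)
    convert! h using 1
    simp
    rcases m with _ | m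
    · simp
    · simp [pow_succ]
      field_simp
  have h2 : HasDerivAt (fun r : ℝ => exp (-(1/(4*r)) * ‖z‖^2)) (exp (-(1/(4*r)) * ‖z‖^2) * (1/(4*r^2) * ‖z‖^2)) r := by
    apply HasDerivAt.exp
    apply HasDerivAt.mul_const
    have h := (((hasDerivAt_id r).const_mul 4).inv (by simp; positivity)).neg
    convert! h using 1
    · ext; simp
    · simp; field_simp
  convert! h1.mul h2 using 1
  unfold hk; ring

lemma adm_prod_int {n : ℕ} {f g : Euc n → ℝ} (hf : MemLp f 2) (hg : MemLp g 2) :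
    Integrable (fun x => f x * g x) := hf.integrable_mul hg

lemma hk_memLp_coord (m : ℕ) {r : ℝ} (hr : 0 < r) (x : Euc (2*m)) (i : Fin (2*m)) :
    MemLp (fun y => hk m r (y - x) * (-((y - x) i)/(2*r))) 2 := by
  refine (hk_memLp m hr (1/(2*r)) (1/(2*r)) x).of_le ?_ (Eventually.of_forall fun y => ?_)
  · exact ((hk_continuous m r x).mul (by fun_prop)).aestronglyMeasurable
  · rw [norm_mul, norm_mul]
    apply mul_le_mul_of_nonneg_left _ (norm_nonneg _)
    rw [norm_div, norm_neg, Real.norm_of_nonneg (by positivity : 0 ≤ 1/(2*r) + 1/(2*r) * ‖y - x‖^2), Real.norm_of_nonneg (by positivity : 0 ≤ 2*r)]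
    have h1 : ‖(y-x) i‖ ≤ ‖y - x‖ := PiLp.norm_apply_le _ _
    have h2 : ‖(y-x) i‖ ≤ 1 + ‖y-x‖^2 := by nlinarith [sq_nonneg (‖y-x‖ - 1), norm_nonneg (y-x)]
    calc ‖(y-x) i‖ / (2*r) ≤ (1 + ‖y-x‖^2) / (2*r) := by gcongr
      _ = _ := by ring

lemma adm_green (m : ℕ) (v : Euc (2*m) → ℝ) (hv : ContDiff ℝ (⊤ : ℕ∞) v) (h0 : MemLp v 2)
    (h1 : ∀ i, MemLp (fun y => fderiv ℝ v y (EuclideanSpace.single i 1)) 2)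
    (h2 : MemLp (lap (2*m) v) 2) {r : ℝ} (hr : 0 < r) (x : Euc (2*m)) :
    ∫ y, hk m r (y - x) * (-(m/r) + 1/(4*r^2) * ‖y-x‖^2) * v y = ∫ y, hk m r (y-x) * lap (2*m) v y := by
  have hv1 : ∀ i, ContDiff ℝ 1 (fun y => fderiv ℝ v y (EuclideanSpace.single i (1:ℝ))) := by
    intro i
    have : ContDiff ℝ 1 (fderiv ℝ v) := hv.fderiv_right (m := 1) (by norm_cast)
    exact this.clm_apply contDiff_const
  have hv0 : ContDiff ℝ 1 v := hv.of_le (by exact_mod_cast le_top)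
  let Q : Fin (2*m) → Euc (2*m) → ℝ := fun i y => hk m r (y - x) * (-((y - x) i)/(2*r))
  have hQ : ∀ i, ContDiff ℝ 1 (Q i) := by
    intro i
    apply (hk_contDiff m r x).mul
    have : ContDiff ℝ 1 (fun y : Euc (2*m) => (y - x) i) :=
      ((EuclideanSpace.proj i : Euc (2*m) →L[ℝ] ℝ).contDiff).comp (contDiff_id.sub contDiff_const)
    exact (this.neg).div_const _
  let F : Fin (2*m) → Euc (2*m) → ℝ := fun i y =>
    hk m r (y - x) * fderiv ℝ v y (EuclideanSpace.single i 1) - Q i y * v y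
  have hF : ∀ i, ContDiff ℝ 1 (F i) := fun i =>
    ((hk_contDiff m r x).mul (hv1 i)).sub ((hQ i).mul hv0)
  have hFd : ∀ i y, fderiv ℝ (F i) y (EuclideanSpace.single i 1) =
      hk m r (y-x) * fderiv ℝ (fun y => fderiv ℝ v y (EuclideanSpace.single i 1)) y (EuclideanSpace.single i 1)
      - hk m r (y - x) * (((y - x) i)^2/(4*r^2) - 1/(2*r)) * v y := by
    intro i y
    have a1 := ((hk_contDiff m r x).differentiable (by norm_num) y).hasFDerivAt
    have a2 := ((hv1 i).differentiable (by norm_num) y).hasFDerivAt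
    have a3 := ((hQ i).differentiable (by norm_num) y).hasFDerivAt
    have a4 := (hv0.differentiable (by norm_num) y).hasFDerivAt
    have e : fderiv ℝ (F i) y = _ := ((a1.mul a2).sub (a3.mul a4)).fderiv
    rw [e]
    simp only [add_apply, sub_apply, smul_apply, smul_eq_mul, hk_fderiv]
    rw [hk_fderiv2 m r hr.ne' x y i]
    simp only [Q]
    ring
  have hsum : ∀ y, ∑ i, fderiv ℝ (F i) y (EuclideanSpace.single i 1) =
      hk m r (y-x) * lap (2*m) v y - hk m r (y - x) * (-(m/r) + 1/(4*r^2) * ‖y-x‖^2) * v y := by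
    intro y
    simp_rw [hFd]
    rw [Finset.sum_sub_distrib, ← Finset.mul_sum, ← Finset.sum_mul, ← Finset.mul_sum]
    congr 3
    rw [Finset.sum_sub_distrib, EuclideanSpace.real_norm_sq_eq, ← Finset.sum_div]
    simp
    field_simp
    ring
  have I1 := adm_prod_int (hk_memLp' m hr x) h2
  have I2 := adm_prod_int (hk_memLp m hr (-(m/r)) (1/(4*r^2)) x) h0
  have := adm_div_zero F hF
    (fun i => (adm_prod_int (hk_memLp' m hr x) (h1 i)).sub (adm_prod_int (hk_memLp_coord m hr x i) h0))
    (by simp_rw [hsum]; exact I1.sub I2)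
  simp_rw [hsum] at this
  rw [integral_sub I1 I2] at this
  linarith

lemma adm_heat_deriv (m : ℕ) (v : Euc (2*m) → ℝ) (h0 : MemLp v 2) {r : ℝ} (hr : 0 < r) (x : Euc (2*m)) :
    HasDerivAt (fun r => ∫ y, hk m r (y - x) * v y)
      (∫ y, hk m r (y - x) * (-(m/r) + 1/(4*r^2) * ‖y-x‖^2) * v y) r := by
  let bd : Euc (2*m) → ℝ := fun y =>
    ((4*π*(r/2))^m)⁻¹ * (((m/(r/2)) + 1/(4*(r/2)^2) * ‖y-x‖^2) * exp (-(1/(4*(2*r))) * ‖y-x‖^2)) * ‖v y‖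
  refine (hasDerivAt_integral_of_dominated_loc_of_deriv_le (s := Set.Ioo (r/2) (2*r)) (bound := bd)
    (F := fun r y => hk m r (y - x) * v y)
    (F' := fun r y => hk m r (y - x) * (-(m/r) + 1/(4*r^2) * ‖y-x‖^2) * v y)
    (Ioo_mem_nhds (by linarith) (by linarith)) ?_ ?_ ?_ ?_ ?_ ?_).2
  · exact Eventually.of_forall fun s => (hk_continuous m s x).aestronglyMeasurable.mul h0.1
  · exact adm_prod_int (hk_memLp' m hr x) h0
  · exact (adm_prod_int (hk_memLp m hr (-(m/r)) (1/(4*r^2)) x) h0).1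
  · refine Eventually.of_forall fun y s hs => ?_
    have hs0 : 0 < s := by linarith [hs.1]
    rw [norm_mul]
    apply mul_le_mul_of_nonneg_right _ (norm_nonneg _)
    rw [norm_mul, Real.norm_of_nonneg (hk_nonneg m hs0.le _)]
    have b1 : ‖-((m:ℝ)/s) + 1/(4*s^2) * ‖y-x‖^2‖ ≤ (m/(r/2)) + 1/(4*(r/2)^2) * ‖y-x‖^2 := by
      refine (norm_add_le _ _).trans ?_
      rw [norm_neg, Real.norm_of_nonneg (by positivity), Real.norm_of_nonneg (by positivity)]
      have := hs.1.le
      gcongr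
    have b2 : hk m s (y-x) ≤ ((4*π*(r/2))^m)⁻¹ * exp (-(1/(4*(2*r))) * ‖y-x‖^2) := by
      unfold hk
      have := hs.1.le
      have := hs.2.le
      gcongr
    calc hk m s (y-x) * ‖-((m:ℝ)/s) + 1/(4*s^2) * ‖y-x‖^2‖ ≤
        (((4*π*(r/2))^m)⁻¹ * exp (-(1/(4*(2*r))) * ‖y-x‖^2)) * ((m/(r/2)) + 1/(4*(r/2)^2) * ‖y-x‖^2) := by
          apply mul_le_mul b2 b1 (norm_nonneg _); positivity
      _ = _ := by ring
  · exact adm_prod_int ((adm_gp (c := 1/(4*(2*r))) (by positivity) _ _ x).const_mul _) h0.norm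
  · refine Eventually.of_forall fun y s hs => ?_
    have hs0 : 0 < s := by linarith [hs.1]
    exact (hk_deriv m hs0 (y-x)).mul_const _

lemma hk_integral (m : ℕ) {r : ℝ} (hr : 0 < r) : ∫ z, hk m r z = 1 := by
  unfold hk
  rw [integral_const_mul, GaussianFourier.integral_rexp_neg_mul_sq_norm (by positivity)]
  simp
  rw [← inv_pow, ← mul_pow]
  convert! one_pow m
  field_simp

lemma adm_heat_lim (m : ℕ) (v : Euc (2*m) → ℝ) (hv : Continuous v) (h0 : MemLp v 2) (x : Euc (2*m)) :
    Tendsto (fun c : ℝ => ∫ y, hk m (1/(c^2+4)) (y - x) * v y) atTop (𝓝 (v x)) := by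
  let f : Euc (2*m) → ℝ := fun y => exp (-1 * ‖y - x‖^2) * v y
  have hf : Integrable f := adm_prod_int (adm_gauss_memLp (by norm_num) x) h0
  have hfc : Continuous f := by fun_prop
  have A := tendsto_integral_comp_smul_smul_of_integrable' (μ := (volume : Measure (Euc (2*m))))
    (φ := hk m 1) (hk_nonneg m (by norm_num)) (hk_integral m (by norm_num)) (by
      have A : Tendsto (fun (w : Euc (2*m)) ↦ ‖w‖ ^ 2) (Bornology.cobounded _) atTop :=
        (tendsto_pow_atTop two_ne_zero).comp tendsto_norm_cobounded_atTop
      have B := tendsto_rpow_mul_exp_neg_mul_atTop_nhds_zero m (1/4) (by norm_num)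
        |>.comp A |>.const_mul (((4*π)^m)⁻¹)
      rw [mul_zero] at B
      refine B.congr fun w => ?_
      simp [hk, pow_mul]
      ring) hf (x₀ := x) hfc.continuousAt
  have B : Tendsto (fun c : ℝ => (1 + 4 / c^2)^m) atTop (𝓝 ((1 + 0)^m)) := by
    apply Tendsto.pow
    apply Tendsto.const_add
    exact Tendsto.const_div_atTop (tendsto_pow_atTop two_ne_zero) _
  have C := B.mul A
  have e : (1 + 0 : ℝ)^m * f x = v x := by simp [f]
  rw [e] at C
  refine C.congr' ?_
  filter_upwards [eventually_gt_atTop 0] with c hc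
  rw [← integral_const_mul]
  congr 1 with y
  simp only [f, hk, smul_eq_mul, finrank_euclideanSpace, Fintype.card_fin, norm_smul, norm_sub_rev x y]
  have e1 : exp (-(1 / (4 * 1)) * (‖c‖ * ‖y - x‖) ^ 2) * exp (-1 * ‖y - x‖^2)
      = exp (-(1 / (4 * (1 / (c ^ 2 + 4)))) * ‖y - x‖ ^ 2) := by
    rw [← Real.exp_add]; congr 1
    rw [mul_pow, Real.norm_eq_abs, sq_abs]; field_simp; ring
  rw [← e1]
  have e2 : (1 + 4 / c^2)^m * (c^(2*m) * ((4*π*1)^m)⁻¹) = ((4*π*(1/(c^2+4)))^m)⁻¹ := by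
    rw [pow_mul, ← inv_pow, ← inv_pow, ← mul_pow, ← mul_pow]; congr 1
    field_simp
  rw [← e2]; ring

lemma adm_taylor (K : ℕ) (f : ℕ → ℝ → ℝ) (r : ℝ)
    (hf : ∀ j < K+1, HasDerivAt (f j) (f (j+1) r) r) :
    HasDerivAt (fun r => ∑ i ∈ Finset.range (K+1), (-r)^i / (i.factorial : ℝ) * f i r)
      ((-r)^K / (K.factorial : ℝ) * f (K+1) r) r := by
  induction K with
  | zero => simpa using hf 0 (by norm_num)
  | succ K ih =>
    have h1 := ih (fun j hj => hf j (by omega))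
    have h2 : HasDerivAt (fun r : ℝ => (-r)^(K+1) / ((K+1).factorial : ℝ)) (-((-r)^K / (K.factorial : ℝ))) r := by
      have h := ((hasDerivAt_neg r).pow (K+1)).div_const ((K+1).factorial : ℝ)
      convert! h using 1
      simp [Nat.factorial_succ]
      field_simp
    have h3 := h1.add (h2.mul (hf (K+1) (by omega)))
    have e : (fun r => ∑ i ∈ Finset.range (K+1+1), (-r)^i / (i.factorial : ℝ) * f i r) =
      (fun r => ∑ i ∈ Finset.range (K+1), (-r)^i / (i.factorial : ℝ) * f i r) +
        ((fun r : ℝ => (-r)^(K+1) / ((K+1).factorial : ℝ)) * f (K+1)) := by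
      ext r; simp [Finset.sum_range_succ]
    rw [e]
    convert! h3 using 1
    ring

lemma lapIter_contDiff (n : ℕ) (u : Euc n → ℝ) (hu : ContDiff ℝ (⊤ : ℕ∞) u) (j : ℕ) :
    ContDiff ℝ (⊤ : ℕ∞) (lapIter n j u) := by
  induction j with
  | zero => exact hu
  | succ j ih =>
    show ContDiff ℝ (⊤ : ℕ∞) (lap n (lapIter n j u))
    unfold lap
    apply ContDiff.sum
    intro i _
    have h1 : ContDiff ℝ (⊤ : ℕ∞) (fderiv ℝ (lapIter n j u)) := ih.fderiv_right (by norm_cast)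
    have h2 : ContDiff ℝ (⊤ : ℕ∞) (fun y => fderiv ℝ (lapIter n j u) y (EuclideanSpace.single i (1:ℝ))) :=
      h1.clm_apply contDiff_const
    have h3 := h2.fderiv_right (m := (⊤ : ℕ∞)) (by norm_cast)
    exact h3.clm_apply contDiff_const

def heatf (m : ℕ) (u : Euc (2*m) → ℝ) (x : Euc (2*m)) (j : ℕ) (r : ℝ) : ℝ :=
  ∫ y, hk m r (y - x) * lapIter (2*m) j u y

lemma adm_repr (m K : ℕ) (u : Euc (2*m) → ℝ) (hu : ContDiff ℝ (⊤ : ℕ∞) u)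
    (hL : ∀ j ≤ K+1, MemLp (lapIter (2*m) j u) 2)
    (hG : ∀ j < K+1, ∀ i, MemLp (fun y => fderiv ℝ (lapIter (2*m) j u) y (EuclideanSpace.single i 1)) 2)
    (x : Euc (2*m)) :
    ‖u x‖ₑ ≤ ENNReal.ofReal (∑ j ∈ Finset.range (K+1), |heatf m u x j 1|) +
      ∫⁻ r in Set.Ioc (0:ℝ) 1, ENNReal.ofReal (r^K / (K.factorial : ℝ)) *
        ∫⁻ y, ENNReal.ofReal (hk m r (y - x)) * ‖lapIter (2*m) (K+1) u y‖ₑ := by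
  set f := heatf m u x with hfdef
  have hc : ∀ j ≤ K+1, ∀ r > 0, ContinuousAt (f j) r := fun j hj r hr =>
    (adm_heat_deriv m _ (hL j hj) hr x).continuousAt
  have hd : ∀ j < K+1, ∀ r > 0, HasDerivAt (f j) (f (j+1) r) r := by
    intro j hj r hr
    have h1 := adm_heat_deriv m _ (hL j hj.le) hr x
    rw [adm_green m _ (lapIter_contDiff _ u hu j) (hL j hj.le) (hG j hj) (hL (j+1) hj) hr x] at h1
    exact h1
  set H : ℝ → ℝ := fun r => ∑ i ∈ Finset.range (K+1), (-r)^i / (i.factorial : ℝ) * f i r with hH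
  have hHd : ∀ r > 0, HasDerivAt H ((-r)^K / (K.factorial : ℝ) * f (K+1) r) r := fun r hr =>
    adm_taylor K f r (fun j hj => hd j hj r hr)
  set RHS := ∫⁻ r in Set.Ioc (0:ℝ) 1, ENNReal.ofReal (r^K / (K.factorial : ℝ)) *
        ∫⁻ y, ENNReal.ofReal (hk m r (y - x)) * ‖lapIter (2*m) (K+1) u y‖ₑ with hR
  have step : ∀ ε > 0, ε ≤ 1 → ‖H 1 - H ε‖ₑ ≤ RHS := by
    intro ε hε hε1
    have e1 : ∫ r in ε..1, ((-r)^K / (K.factorial : ℝ) * f (K+1) r) = H 1 - H ε := by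
      apply intervalIntegral.integral_eq_sub_of_hasDerivAt
      · intro r hr
        rw [Set.uIcc_of_le hε1] at hr
        exact hHd r (by linarith [hr.1])
      · apply ContinuousOn.intervalIntegrable
        intro r hr
        rw [Set.uIcc_of_le hε1] at hr
        apply ContinuousAt.continuousWithinAt
        apply ContinuousAt.mul (by fun_prop)
        exact hc _ le_rfl r (by linarith [hr.1])
    rw [← e1, intervalIntegral.integral_of_le hε1]
    refine (enorm_integral_le_lintegral_enorm _).trans ?_
    rw [hR]
    refine (lintegral_mono_set (Set.Ioc_subset_Ioc_left hε.le)).trans ?_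
    apply setLIntegral_mono' measurableSet_Ioc
    intro r hr
    rw [enorm_mul]
    gcongr
    · rw [Real.enorm_eq_ofReal_abs, abs_div, abs_pow, abs_neg, abs_of_pos hr.1, Nat.abs_cast]
    · refine (enorm_integral_le_lintegral_enorm _).trans_eq ?_
      congr 1 with y
      rw [enorm_mul, Real.enorm_of_nonneg (hk_nonneg m hr.1.le _)]
  have lim : Tendsto (fun c : ℝ => H (1/(c^2+4))) atTop (𝓝 (u x)) := by
    have hr0 : Tendsto (fun c : ℝ => 1/(c^2+4)) atTop (𝓝 0) := by
      apply Tendsto.const_div_atTop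
      exact tendsto_atTop_add_const_right _ _ (tendsto_pow_atTop two_ne_zero)
    have : Tendsto (fun c : ℝ => H (1/(c^2+4))) atTop
        (𝓝 (∑ i ∈ Finset.range (K+1), (-0)^i / (i.factorial : ℝ) * lapIter (2*m) i u x)) := by
      apply tendsto_finsetSum
      intro i hi
      apply Tendsto.mul
      · exact ((hr0.neg).pow i).div_const _
      · exact adm_heat_lim m _ (lapIter_contDiff _ u hu i).continuous
          (hL i (by simp at hi; omega)) x
    convert! this using 2
    rw [Finset.sum_range_succ']
    simp [lapIter]
  have main : ‖H 1 - u x‖ₑ ≤ RHS := by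
    refine le_of_tendsto ((tendsto_const_nhds (x := H 1)).sub lim).enorm ?_
    refine Eventually.of_forall fun c => step _ (by positivity) ?_
    rw [div_le_one (by positivity)]
    nlinarith [sq_nonneg c]
  have hH1 : ‖H 1‖ₑ ≤ ENNReal.ofReal (∑ j ∈ Finset.range (K+1), |f j 1|) := by
    rw [Real.enorm_eq_ofReal_abs]
    apply ENNReal.ofReal_le_ofReal
    refine (Finset.abs_sum_le_sum_abs _ _).trans (Finset.sum_le_sum fun i _ => ?_)
    rw [abs_mul, abs_div, abs_pow]
    simp only [abs_neg, abs_one, one_pow, Nat.abs_cast]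
    apply mul_le_of_le_one_left (abs_nonneg _)
    rw [div_le_one (by positivity)]
    exact_mod_cast Nat.one_le_iff_ne_zero.2 (Nat.factorial_ne_zero i)
  calc ‖u x‖ₑ = ‖H 1 - (H 1 - u x)‖ₑ := by congr 1; ring
    _ ≤ ‖H 1‖ₑ + ‖H 1 - u x‖ₑ := enorm_sub_le
    _ ≤ _ := add_le_add hH1 main

def pk (m : ℕ) (r : ℝ) (z : Euc (2*m)) : ENNReal := ENNReal.ofReal (hk m r z)

lemma pk_meas (m : ℕ) : Measurable (fun q : ℝ × Euc (2*m) => pk m q.1 q.2) := by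
  unfold pk hk; fun_prop

lemma pk_meas_r (m : ℕ) (r : ℝ) : Measurable (pk m r) := by
  unfold pk hk; fun_prop

lemma pk_comm (m : ℕ) (r : ℝ) (x y : Euc (2*m)) : pk m r (x - y) = pk m r (y - x) := by
  unfold pk hk; rw [norm_sub_rev]

lemma pk_sub_meas (m : ℕ) (t : ℝ) (y : Euc (2*m)) : Measurable (fun x => pk m t (y - x)) :=
  (pk_meas_r m t).comp (by fun_prop : Measurable fun x : Euc (2*m) => y - x)

lemma pk_sub_meas' (m : ℕ) (t : ℝ) (x : Euc (2*m)) : Measurable (fun y => pk m t (y - x)) :=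
  (pk_meas_r m t).comp (by fun_prop : Measurable fun y : Euc (2*m) => y - x)

lemma pk_int (m : ℕ) {r : ℝ} (hr : 0 < r) : ∫⁻ z, pk m r z = 1 := by
  unfold pk
  rw [← ofReal_integral_eq_lintegral_ofReal, hk_integral m hr]
  · simp
  · have := (adm_gauss_int (n := 2*m) (c := 1/(4*r)) (by positivity) 0).const_mul (((4*π*r)^m)⁻¹)
    refine this.congr (Eventually.of_forall fun z => ?_)
    simp [hk]
  · exact Eventually.of_forall fun z => hk_nonneg m hr.le z

lemma pk_int' (m : ℕ) {r : ℝ} (hr : 0 < r) (x : Euc (2*m)) : ∫⁻ y, pk m r (y - x) = 1 := by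
  rw [lintegral_sub_right_eq_self (pk m r) x, pk_int m hr]

lemma pk_conv (m : ℕ) {r s : ℝ} (hr : 0 < r) (hs : 0 < s) (x x' : Euc (2*m)) :
    ∫⁻ y, pk m r (y - x) * pk m s (y - x') ≤ ENNReal.ofReal (((4*π*(r+s))^m)⁻¹) := by
  set w : Euc (2*m) := (s/(r+s)) • x + (r/(r+s)) • x' with hw
  have hrs : 0 < r + s := by positivity
  have key : ∀ y, hk m r (y-x) * hk m s (y-x') ≤ ((4*π*(r+s))^m)⁻¹ * hk m (r*s/(r+s)) (y - w) := by
    intro y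
    unfold hk
    have e0 : ((4*π*r)^m)⁻¹ * ((4*π*s)^m)⁻¹ = ((4*π*(r+s))^m)⁻¹ * ((4*π*(r*s/(r+s)))^m)⁻¹ := by
      rw [← inv_pow, ← inv_pow, ← inv_pow, ← inv_pow, ← mul_pow, ← mul_pow]; congr 1; field_simp
    have e1 : exp (-(1/(4*r)) * ‖y-x‖^2) * exp (-(1/(4*s)) * ‖y-x'‖^2) ≤
        exp (-(1/(4*(r*s/(r+s)))) * ‖y-w‖^2) := by
      rw [← Real.exp_add, Real.exp_le_exp]
      have h1 : y - w = (s/(r+s)) • (y - x) + (r/(r+s)) • (y - x') := by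
        rw [hw]
        have : (s/(r+s)) + (r/(r+s)) = 1 := by field_simp; ring
        calc y - ((s / (r + s)) • x + (r / (r + s)) • x') = ((s/(r+s)) + (r/(r+s))) • y - ((s / (r + s)) • x + (r / (r + s)) • x') := by rw [this, one_smul]
          _ = _ := by module
      have h2 : ‖y-w‖^2 ≤ (s/(r+s)) * ‖y-x‖^2 + (r/(r+s)) * ‖y-x'‖^2 := by
        have h3 : ‖y - w‖ ≤ (s/(r+s)) * ‖y-x‖ + (r/(r+s)) * ‖y-x'‖ := by
          rw [h1]
          refine (norm_add_le _ _).trans_eq ?_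
          rw [norm_smul, norm_smul, Real.norm_of_nonneg (by positivity), Real.norm_of_nonneg (by positivity)]
        have h4 : (s/(r+s)) = 1 - (r/(r+s)) := by field_simp; ring
        have h5 : 0 ≤ r/(r+s) := by positivity
        have h6 : r/(r+s) ≤ 1 := by rw [div_le_one hrs]; linarith
        rw [h4] at h3 ⊢
        have h7 := pow_le_pow_left₀ (norm_nonneg _) h3 2
        nlinarith [mul_nonneg (mul_nonneg h5 (sub_nonneg.2 h6)) (sq_nonneg (‖y-x‖ - ‖y-x'‖))]
      have h8 : 1/(4*(r*s/(r+s))) * ‖y-w‖^2 ≤ 1/(4*(r*s/(r+s))) * ((s/(r+s)) * ‖y-x‖^2 + (r/(r+s)) * ‖y-x'‖^2) := by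
        gcongr
      have h9 : 1/(4*(r*s/(r+s))) * ((s/(r+s)) * ‖y-x‖^2 + (r/(r+s)) * ‖y-x'‖^2) = 1/(4*r) * ‖y-x‖^2 + 1/(4*s) * ‖y-x'‖^2 := by
        field_simp
      linarith
    calc _ = (((4*π*r)^m)⁻¹ * ((4*π*s)^m)⁻¹) * (exp (-(1/(4*r)) * ‖y-x‖^2) * exp (-(1/(4*s)) * ‖y-x'‖^2)) := by ring
      _ ≤ (((4*π*r)^m)⁻¹ * ((4*π*s)^m)⁻¹) * exp (-(1/(4*(r*s/(r+s)))) * ‖y-w‖^2) := by gcongr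
      _ = _ := by rw [e0]; ring
  calc ∫⁻ y, pk m r (y - x) * pk m s (y - x') ≤ ∫⁻ y, ENNReal.ofReal (((4*π*(r+s))^m)⁻¹) * pk m (r*s/(r+s)) (y - w) := by
        apply lintegral_mono
        intro y
        simp only [pk]
        rw [← ENNReal.ofReal_mul (hk_nonneg m hr.le _), ← ENNReal.ofReal_mul (by positivity)]
        exact ENNReal.ofReal_le_ofReal (key y)
    _ = _ := by
        rw [lintegral_const_mul _ (pk_sub_meas' m _ _), pk_int' m (by positivity), mul_one]

def Pg (m : ℕ) (r : ℝ) (g : Euc (2*m) → ENNReal) (y : Euc (2*m)) : ENNReal := ∫⁻ x, pk m r (y - x) * g x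

lemma Pg_meas (m : ℕ) (g : Euc (2*m) → ENNReal) (hg : Measurable g) :
    Measurable (fun q : ℝ × Euc (2*m) => Pg m q.1 g q.2) := by
  unfold Pg
  apply Measurable.lintegral_prod_right' (f := fun a : (ℝ × Euc (2*m)) × Euc (2*m) => pk m a.1.1 (a.1.2 - a.2) * g a.2)
  apply Measurable.mul
  · exact (pk_meas m).comp (by fun_prop : Measurable fun a : (ℝ × Euc (2*m)) × Euc (2*m) => (a.1.1, a.1.2 - a.2))
  · exact hg.comp measurable_snd

lemma Pg_meas_r (m : ℕ) (r : ℝ) (g : Euc (2*m) → ENNReal) (hg : Measurable g) :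
    Measurable (Pg m r g) := (Pg_meas m g hg).comp (by fun_prop : Measurable fun y : Euc (2*m) => (r, y))

lemma Pg_le (m : ℕ) {r : ℝ} (hr : 0 < r) (g : Euc (2*m) → ENNReal) (M : ENNReal) (hM : ∀ x, g x ≤ M) (y) :
    Pg m r g y ≤ M := by
  unfold Pg
  calc _ ≤ ∫⁻ x, pk m r (x - y) * M := by
        apply lintegral_mono; intro x; simp only []; rw [pk_comm]; gcongr; exact hM x
    _ = M := by rw [lintegral_mul_const _ (pk_sub_meas' m _ _), pk_int' m hr, one_mul]

lemma Pg_int (m : ℕ) {r : ℝ} (hr : 0 < r) (g : Euc (2*m) → ENNReal) (hg : Measurable g) :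
    ∫⁻ y, Pg m r g y = ∫⁻ x, g x := by
  unfold Pg
  rw [lintegral_lintegral_swap]
  · apply lintegral_congr; intro x
    rw [lintegral_mul_const _ (pk_sub_meas' m _ _), pk_int' m hr, one_mul]
  · apply Measurable.aemeasurable
    exact ((pk_meas_r m r).comp (by fun_prop : Measurable fun a : Euc (2*m) × Euc (2*m) => a.1 - a.2)).mul (hg.comp measurable_snd)

lemma B_heat (m : ℕ) {r s : ℝ} (hr : 0 < r) (hs : 0 < s) (g g' : Euc (2*m) → ENNReal) (hg : Measurable g)
    (hg' : Measurable g') :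
    ∫⁻ y, Pg m r g y * Pg m s g' y ≤ ENNReal.ofReal (((4*π*(r+s))^m)⁻¹) * ((∫⁻ x, g x) * ∫⁻ x, g' x) := by
  have hp : ∀ t (y : Euc (2*m)), Measurable (fun x => pk m t (y - x)) := pk_sub_meas m
  have hp' : ∀ t (x : Euc (2*m)), Measurable (fun y => pk m t (y - x)) := pk_sub_meas' m
  have e : ∀ y, Pg m r g y * Pg m s g' y =
      ∫⁻ x, ∫⁻ x', (pk m r (y - x) * pk m s (y - x')) * (g x * g' x') := by
    intro y
    unfold Pg
    have q1 : Measurable (fun x => pk m r (y - x) * g x) := (hp r y).mul hg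
    have q2 : Measurable (fun x => pk m s (y - x) * g' x) := (hp s y).mul hg'
    rw [← lintegral_mul_const _ q1]
    apply lintegral_congr; intro x
    rw [← lintegral_const_mul _ q2]
    apply lintegral_congr; intro x'
    ring
  simp_rw [e]
  rw [lintegral_lintegral_swap]
  swap
  · apply Measurable.aemeasurable
    apply Measurable.lintegral_prod_right' (f := fun a : (Euc (2*m) × Euc (2*m)) × Euc (2*m) =>
      (pk m r (a.1.1 - a.1.2) * pk m s (a.1.1 - a.2)) * (g a.1.2 * g' a.2))
    refine Measurable.mul (Measurable.mul ((pk_meas_r m r).comp (by fun_prop)) ((pk_meas_r m s).comp (by fun_prop)))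
      (Measurable.mul (hg.comp (by fun_prop)) (hg'.comp (by fun_prop)))
  calc _ = ∫⁻ x, ∫⁻ x', (∫⁻ y, pk m r (y - x) * pk m s (y - x')) * (g x * g' x') := by
        apply lintegral_congr; intro x
        rw [lintegral_lintegral_swap]
        · apply lintegral_congr; intro x'
          have q3 : Measurable (fun y => pk m r (y - x) * pk m s (y - x')) := (hp' r x).mul (hp' s x')
          rw [lintegral_mul_const _ q3]
        · apply Measurable.aemeasurable
          refine Measurable.mul (Measurable.mul ((pk_meas_r m r).comp (by fun_prop)) ((pk_meas_r m s).comp (by fun_prop)))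
            (Measurable.mul measurable_const (hg'.comp (by fun_prop)))
    _ ≤ ∫⁻ x, ∫⁻ x', ENNReal.ofReal (((4*π*(r+s))^m)⁻¹) * (g x * g' x') := by
        gcongr with x x'
        exact pk_conv m hr hs x x'
    _ = _ := by
        have : ∀ x, ∫⁻ x', ENNReal.ofReal (((4*π*(r+s))^m)⁻¹) * (g x * g' x') =
          (ENNReal.ofReal (((4*π*(r+s))^m)⁻¹) * (∫⁻ x', g' x')) * g x := by
          intro x
          rw [lintegral_const_mul _ (hg'.const_mul _), lintegral_const_mul _ hg']; ring
        simp_rw [this]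
        rw [lintegral_const_mul _ hg]; ring

lemma B_bdd (m : ℕ) {r s : ℝ} (hr : 0 < r) (hs : 0 < s) (g g' : Euc (2*m) → ENNReal) (hg : Measurable g)
    (M : ENNReal) (hM : ∀ x, g' x ≤ M) :
    ∫⁻ y, Pg m r g y * Pg m s g' y ≤ M * ∫⁻ x, g x := by
  calc _ ≤ ∫⁻ y, Pg m r g y * M := by
        apply lintegral_mono; intro y; exact mul_le_mul' le_rfl (Pg_le m hs g' M hM y)
    _ = _ := by rw [lintegral_mul_const _ (Pg_meas_r m r g hg), Pg_int m hr g hg, mul_comm]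

def wK (K : ℕ) (r : ℝ) : ENNReal := ENNReal.ofReal (r^K / (K.factorial:ℝ))

lemma wK_meas (K : ℕ) : Measurable (wK K) := by unfold wK; fun_prop

def Tg (m K : ℕ) (g : Euc (2*m) → ENNReal) (y : Euc (2*m)) : ENNReal :=
  ∫⁻ r in Set.Ioc (0:ℝ) 1, wK K r * Pg m r g y

lemma wPg_meas (m K : ℕ) (g : Euc (2*m) → ENNReal) (hg : Measurable g) :
    Measurable (fun q : ℝ × Euc (2*m) => wK K q.1 * Pg m q.1 g q.2) :=
  ((wK_meas K).comp measurable_fst).mul (Pg_meas m g hg)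

lemma wPg_meas_y (m K : ℕ) (g : Euc (2*m) → ENNReal) (hg : Measurable g) (y : Euc (2*m)) :
    Measurable (fun r : ℝ => wK K r * Pg m r g y) :=
  (wPg_meas m K g hg).comp (by fun_prop : Measurable fun r : ℝ => (r, y))

lemma Tg_meas (m K : ℕ) (g : Euc (2*m) → ENNReal) (hg : Measurable g) : Measurable (Tg m K g) := by
  unfold Tg
  exact Measurable.lintegral_prod_left' (wPg_meas m K g hg)

lemma Pg_add (m : ℕ) (r : ℝ) (g g' : Euc (2*m) → ENNReal) (hg : Measurable g) (y) :
    Pg m r (fun x => g x + g' x) y = Pg m r g y + Pg m r g' y := by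
  unfold Pg
  have q1 : Measurable (fun x => pk m r (y - x) * g x) := (pk_sub_meas m r y).mul hg
  rw [← lintegral_add_left q1]
  apply lintegral_congr; intro x; ring

lemma Tg_add (m K : ℕ) (g g' : Euc (2*m) → ENNReal) (hg : Measurable g) (y) :
    Tg m K (fun x => g x + g' x) y = Tg m K g y + Tg m K g' y := by
  unfold Tg
  rw [← lintegral_add_left (wPg_meas_y m K g hg y)]
  apply lintegral_congr; intro x; rw [Pg_add m x g g' hg, mul_add]

def Jb (m K : ℕ) (a : ℝ) : ENNReal :=
  ∫⁻ r in Set.Ioc (0:ℝ) 1, ∫⁻ s in Set.Ioc (0:ℝ) 1,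
    (wK K r * wK K s) * ENNReal.ofReal (min (((4*π*(r+s))^m)⁻¹) a⁻¹)

lemma adm_tonelli {Y : Type*} [MeasurableSpace Y] (ν : Measure Y) [SFinite ν] (μ : Measure ℝ) [SFinite μ]
    (A B : ℝ × Y → ENNReal) (hA : Measurable A) (hB : Measurable B) :
    ∫⁻ y, (∫⁻ r, A (r, y) ∂μ) * (∫⁻ s, B (s, y) ∂μ) ∂ν = ∫⁻ r, ∫⁻ s, ∫⁻ y, A (r, y) * B (s, y) ∂ν ∂μ ∂μ := by
  have e : ∀ y, (∫⁻ r, A (r, y) ∂μ) * (∫⁻ s, B (s, y) ∂μ) = ∫⁻ r, ∫⁻ s, A (r, y) * B (s, y) ∂μ ∂μ := by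
    intro y
    have qA : Measurable (fun r => A (r, y)) := hA.comp (by fun_prop : Measurable fun r : ℝ => (r, y))
    have qB : Measurable (fun r => B (r, y)) := hB.comp (by fun_prop : Measurable fun r : ℝ => (r, y))
    rw [← lintegral_mul_const _ qA]
    apply lintegral_congr; intro r
    rw [← lintegral_const_mul _ qB]
  simp_rw [e]
  have M4 : Measurable (fun a : (Y × ℝ) × ℝ => A (a.1.2, a.1.1) * B (a.2, a.1.1)) :=
    (hA.comp (by fun_prop : Measurable fun a : (Y × ℝ) × ℝ => (a.1.2, a.1.1))).mul
       (hB.comp (by fun_prop : Measurable fun a : (Y × ℝ) × ℝ => (a.2, a.1.1)))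
  rw [lintegral_lintegral_swap]
  swap
  · apply Measurable.aemeasurable
    exact Measurable.lintegral_prod_right' M4
  apply lintegral_congr; intro r
  rw [lintegral_lintegral_swap]
  apply Measurable.aemeasurable
  exact M4.comp (by fun_prop : Measurable fun a : Y × ℝ => ((a.1, r), a.2))

lemma Tg_pair (m K : ℕ) (g g' : Euc (2*m) → ENNReal) (hg : Measurable g) (hg' : Measurable g')
    (h1 : ∫⁻ x, g x ≤ 1) (h1' : ∫⁻ x, g' x ≤ 1) (a : ℝ) (hM : ∀ x, g' x ≤ ENNReal.ofReal a⁻¹) :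
    ∫⁻ y, Tg m K g y * Tg m K g' y ≤ Jb m K a := by
  have e := adm_tonelli (volume : Measure (Euc (2*m))) (volume.restrict (Set.Ioc (0:ℝ) 1)) _ _
    (wPg_meas m K g hg) (wPg_meas m K g' hg')
  simp only [Tg]
  rw [e]
  unfold Jb
  apply setLIntegral_mono' measurableSet_Ioc
  intro r hr
  apply setLIntegral_mono' measurableSet_Ioc
  intro s hs
  have q : Measurable (fun y => Pg m r g y * Pg m s g' y) :=
    (Pg_meas_r m r g hg).mul (Pg_meas_r m s g' hg')
  calc _ = ∫⁻ y, (wK K r * wK K s) * (Pg m r g y * Pg m s g' y) := by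
        apply lintegral_congr; intro y; ring
    _ = (wK K r * wK K s) * ∫⁻ y, (Pg m r g y * Pg m s g' y) := lintegral_const_mul _ q
    _ ≤ _ := ?_
  gcongr
  rw [ENNReal.ofReal_min]
  refine le_min ?_ ?_
  · refine (B_heat m hr.1 hs.1 g g' hg hg').trans ?_
    calc _ ≤ ENNReal.ofReal (((4*π*(r+s))^m)⁻¹) * (1 * 1) := by gcongr
      _ = _ := by simp
  · refine (B_bdd m hr.1 hs.1 g g' hg _ hM).trans ?_
    calc _ ≤ ENNReal.ofReal (a⁻¹) * 1 := by gcongr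
      _ = _ := by simp

lemma adm_beta (ρ : ℝ) : ∀ b a : ℕ, ∫ r in (0:ℝ)..ρ, (r^a / (a.factorial:ℝ)) * ((ρ - r)^b / (b.factorial:ℝ)) =
    ρ^(a+b+1) / ((a+b+1).factorial:ℝ) := by
  intro b
  induction b with
  | zero =>
    intro a
    simp only [pow_zero, Nat.factorial_zero, Nat.cast_one, div_one, mul_one, add_zero]
    rw [intervalIntegral.integral_div, integral_pow, Nat.factorial_succ]
    push_cast
    have : (a.factorial : ℝ) ≠ 0 := by positivity
    field_simp
    simp
  | succ b ih =>
    intro a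
    have h := ih (a+1)
    have hd : ∀ r ∈ Set.uIcc 0 ρ, HasDerivAt (fun r : ℝ => (r^(a+1) / ((a+1).factorial:ℝ)) * ((ρ - r)^(b+1) / ((b+1).factorial:ℝ)))
      ((r^a / (a.factorial:ℝ)) * ((ρ - r)^(b+1) / ((b+1).factorial:ℝ)) - (r^(a+1) / ((a+1).factorial:ℝ)) * ((ρ - r)^b / (b.factorial:ℝ))) r := by
      intro r _
      have h1 := ((hasDerivAt_id r).pow (a+1)).div_const ((a+1).factorial:ℝ)
      have h2 := ((((hasDerivAt_id r).const_sub ρ)).pow (b+1)).div_const ((b+1).factorial:ℝ)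
      convert! h1.mul h2 using 1
      simp only [Nat.factorial_succ, id, Pi.pow_apply]
      push_cast
      have : (a.factorial : ℝ) ≠ 0 := by positivity
      have : (b.factorial : ℝ) ≠ 0 := by positivity
      field_simp
      try simp
      try ring
    have hi := intervalIntegral.integral_eq_sub_of_hasDerivAt hd (Continuous.intervalIntegrable (by fun_prop) _ _)
    rw [intervalIntegral.integral_sub (Continuous.intervalIntegrable (by fun_prop) _ _) (Continuous.intervalIntegrable (by fun_prop) _ _), h] at hi
    simp at hi
    rw [show a + (b+1) + 1 = a+1+b+1 by ring]
    linarith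

lemma adm_beta_l (K : ℕ) {ρ : ℝ} (hρ : 0 < ρ) :
    ∫⁻ r in Set.Ioc (0:ℝ) ρ, wK K r * wK K (ρ - r) = wK (2*K+1) ρ := by
  have h := adm_beta ρ K K
  rw [intervalIntegral.integral_of_le hρ.le] at h
  unfold wK
  rw [show 2*K+1 = K+K+1 by ring, ← h, ofReal_integral_eq_lintegral_ofReal]
  · apply setLIntegral_congr_fun measurableSet_Ioc
    intro r hr
    dsimp only
    rw [ENNReal.ofReal_mul]
    have := hr.1; positivity
  · exact (Continuous.integrableOn_Ioc (by fun_prop))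
  · refine (ae_restrict_iff' measurableSet_Ioc).2 (Eventually.of_forall fun r hr => ?_)
    have := hr.1; have := sub_nonneg.2 hr.2
    simp only [Pi.zero_apply]; positivity

lemma Jb_le1 (m K : ℕ) (a : ℝ) :
    Jb m K a ≤ ∫⁻ ρ in Set.Ioc (0:ℝ) 2, wK (2*K+1) ρ * ENNReal.ofReal (min (((4*π*ρ)^m)⁻¹) a⁻¹) := by
  set φ : ℝ → ENNReal := fun ρ => ENNReal.ofReal (min (((4*π*ρ)^m)⁻¹) a⁻¹) with hφ
  have hφm : Measurable φ := by rw [hφ]; fun_prop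
  set I : ℝ → ENNReal := (Set.Ioc (0:ℝ) 1).indicator (fun _ => 1) with hI
  have hIm : Measurable I := measurable_const.indicator measurableSet_Ioc
  have e1 : Jb m K a = ∫⁻ r, ∫⁻ ρ, I r * I (ρ - r) * (wK K r * wK K (ρ - r)) * φ ρ := by
    unfold Jb
    rw [← lintegral_indicator measurableSet_Ioc]
    apply lintegral_congr; intro r
    by_cases hr : r ∈ Set.Ioc (0:ℝ) 1
    · rw [Set.indicator_of_mem hr, ← lintegral_indicator measurableSet_Ioc, ← lintegral_sub_right_eq_self _ r]
      apply lintegral_congr; intro ρ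
      have hIr : I r = 1 := by rw [hI, Set.indicator_of_mem hr]
      by_cases h2 : ρ - r ∈ Set.Ioc (0:ℝ) 1
      · have : I (ρ - r) = 1 := by rw [hI, Set.indicator_of_mem h2]
        rw [hIr, this, Set.indicator_of_mem h2]
        simp [hφ]
      · have : I (ρ - r) = 0 := by rw [hI, Set.indicator_of_notMem h2]
        rw [this, Set.indicator_of_notMem h2]; simp
    · have hIr : I r = 0 := by rw [hI, Set.indicator_of_notMem hr]
      rw [Set.indicator_of_notMem hr]
      simp [hIr]
  have e2 : ∫⁻ r, ∫⁻ ρ, I r * I (ρ - r) * (wK K r * wK K (ρ - r)) * φ ρ =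
      ∫⁻ ρ, ∫⁻ r, I r * I (ρ - r) * (wK K r * wK K (ρ - r)) * φ ρ := by
    rw [lintegral_lintegral_swap]
    apply Measurable.aemeasurable
    have h1 : Measurable (fun q : ℝ × ℝ => q.2 - q.1) := by fun_prop
    exact (((hIm.comp measurable_fst).mul (hIm.comp h1)).mul
      (((wK_meas K).comp measurable_fst).mul ((wK_meas K).comp h1))).mul (hφm.comp measurable_snd)
  rw [e1, e2, ← lintegral_indicator measurableSet_Ioc]
  apply lintegral_mono
  intro ρ
  have hz : ∀ r, ¬ (r ∈ Set.Ioc (0:ℝ) 1 ∧ ρ - r ∈ Set.Ioc (0:ℝ) 1) → I r * I (ρ - r) = 0 := by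
    intro r h
    by_cases hr : r ∈ Set.Ioc (0:ℝ) 1
    · have : I (ρ - r) = 0 := by rw [hI, Set.indicator_of_notMem (fun h2 => h ⟨hr, h2⟩)]
      simp [this]
    · have : I r = 0 := by rw [hI, Set.indicator_of_notMem hr]
      simp [this]
  by_cases hρ : ρ ∈ Set.Ioc (0:ℝ) 2
  · rw [Set.indicator_of_mem hρ]
    have q : Measurable (fun r => wK K r * wK K (ρ - r)) :=
      (wK_meas K).mul ((wK_meas K).comp (by fun_prop : Measurable fun r : ℝ => ρ - r))
    rw [← adm_beta_l K hρ.1, ← lintegral_mul_const _ q, ← lintegral_indicator measurableSet_Ioc]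
    apply lintegral_mono
    intro r
    by_cases h : r ∈ Set.Ioc (0:ℝ) 1 ∧ ρ - r ∈ Set.Ioc (0:ℝ) 1
    · have h3 : r ∈ Set.Ioc 0 ρ := ⟨h.1.1, by linarith [h.2.1]⟩
      have h4 : I r = 1 := by rw [hI, Set.indicator_of_mem h.1]
      have h5 : I (ρ - r) = 1 := by rw [hI, Set.indicator_of_mem h.2]
      dsimp only
      rw [Set.indicator_of_mem h3, h4, h5]
      simp [hφ]
    · dsimp only
      rw [hz r h]; simp
  · rw [Set.indicator_of_notMem hρ]
    have : ∀ r, I r * I (ρ - r) * (wK K r * wK K (ρ - r)) * φ ρ = 0 := by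
      intro r
      rw [hz r, zero_mul, zero_mul]
      rintro ⟨h1, h2⟩
      exact hρ ⟨by linarith [h1.1, h2.1], by linarith [h1.2, h2.2]⟩
    simp [this]

lemma Jb_le (m K : ℕ) (hmK : m = 2*K+2) {a : ℝ} (ha : 0 < a) (ha1 : a ≤ 1) :
    Jb m K a ≤ ENNReal.ofReal ((-Real.log a + ((4*π)^m + m * Real.log 2)) / ((4*π)^m * (m.factorial:ℝ))) := by
  have hm0 : (m:ℝ) ≠ 0 := by rw [hmK]; positivity
  have hmf : (m.factorial:ℝ) = m * ((2*K+1).factorial:ℝ) := by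
    rw [hmK, show 2*K+2 = (2*K+1)+1 by ring, Nat.factorial_succ]; push_cast; ring
  set ρ0 : ℝ := a ^ ((m:ℝ)⁻¹) with hρ0
  have hρpos : 0 < ρ0 := by positivity
  have hρ1 : ρ0 ≤ 1 := Real.rpow_le_one ha.le ha1 (by positivity)
  have hρm : ρ0^m = a := by
    rw [hρ0, ← Real.rpow_natCast, ← Real.rpow_mul ha.le, inv_mul_cancel₀ hm0, Real.rpow_one]
  have hlog : Real.log ρ0 = Real.log a / m := by
    rw [hρ0, Real.log_rpow ha]; field_simp
  refine (Jb_le1 m K a).trans ?_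
  have hsp : Set.Ioc (0:ℝ) 2 = Set.Ioc 0 ρ0 ∪ Set.Ioc ρ0 2 := (Set.Ioc_union_Ioc_eq_Ioc hρpos.le (by linarith)).symm
  rw [hsp]
  refine (lintegral_union_le _ _ _).trans ?_
  have b1 : ∫⁻ ρ in Set.Ioc (0:ℝ) ρ0, wK (2*K+1) ρ * ENNReal.ofReal (min (((4*π*ρ)^m)⁻¹) a⁻¹) ≤
      ENNReal.ofReal (1 / (m.factorial:ℝ)) := by
    calc _ ≤ ∫⁻ ρ in Set.Ioc (0:ℝ) ρ0, ENNReal.ofReal (ρ^(2*K+1) / ((2*K+1).factorial:ℝ) * a⁻¹) := by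
          apply setLIntegral_mono' measurableSet_Ioc
          intro ρ hρ
          have := hρ.1
          rw [ENNReal.ofReal_mul (by positivity)]
          unfold wK
          gcongr
          exact min_le_right _ _
      _ = ENNReal.ofReal (∫ ρ in (0:ℝ)..ρ0, (ρ^(2*K+1) / ((2*K+1).factorial:ℝ) * a⁻¹)) := by
          rw [intervalIntegral.integral_of_le hρpos.le, ofReal_integral_eq_lintegral_ofReal]
          · exact (Continuous.integrableOn_Ioc (by fun_prop))
          · refine (ae_restrict_iff' measurableSet_Ioc).2 (Eventually.of_forall fun r hr => ?_)
            have := hr.1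
            simp only [Pi.zero_apply]; positivity
      _ = _ := by
          congr 1
          rw [intervalIntegral.integral_mul_const, intervalIntegral.integral_div, integral_pow, show 2*K+1+1 = m by omega, hρm, hmf]
          rw [zero_pow (by omega)]
          have : ((2*K+1 : ℕ):ℝ) + 1 = m := by rw [hmK]; push_cast; ring
          rw [this]
          have : ((2*K+1).factorial : ℝ) ≠ 0 := by positivity
          field_simp
          simp
  have b2 : ∫⁻ ρ in Set.Ioc ρ0 2, wK (2*K+1) ρ * ENNReal.ofReal (min (((4*π*ρ)^m)⁻¹) a⁻¹) ≤
      ENNReal.ofReal ((((2*K+1).factorial:ℝ) * (4*π)^m)⁻¹ * (Real.log 2 - Real.log ρ0)) := by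
    calc _ ≤ ∫⁻ ρ in Set.Ioc ρ0 2, ENNReal.ofReal ((((2*K+1).factorial:ℝ) * (4*π)^m)⁻¹ * ρ⁻¹) := by
          apply setLIntegral_mono' measurableSet_Ioc
          intro ρ hρ
          have h0 : 0 < ρ := hρpos.trans hρ.1
          unfold wK
          rw [← ENNReal.ofReal_mul (by positivity)]
          apply ENNReal.ofReal_le_ofReal
          calc _ ≤ ρ ^ (2*K+1) / ((2*K+1).factorial:ℝ) * ((4*π*ρ)^m)⁻¹ := by
                gcongr; exact min_le_left _ _
            _ = _ := by
                have : ((2*K+1).factorial : ℝ) ≠ 0 := by positivity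
                rw [mul_pow (4*π) ρ, hmK]
                field_simp
                try ring
      _ = ENNReal.ofReal (∫ ρ in ρ0..2, ((((2*K+1).factorial:ℝ) * (4*π)^m)⁻¹ * ρ⁻¹)) := by
          rw [intervalIntegral.integral_of_le (by linarith), ofReal_integral_eq_lintegral_ofReal]
          · apply IntegrableOn.mono_set (t := Set.Icc ρ0 2) _ Set.Ioc_subset_Icc_self
            apply ContinuousOn.integrableOn_Icc
            apply continuousOn_const.mul
            exact continuousOn_inv₀.mono (fun x hx => (hρpos.trans_le hx.1).ne')
          · refine (ae_restrict_iff' measurableSet_Ioc).2 (Eventually.of_forall fun r hr => ?_)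
            have := hρpos.trans hr.1
            simp only [Pi.zero_apply]; positivity
      _ = _ := by
          congr 1
          rw [intervalIntegral.integral_const_mul, integral_inv_of_pos hρpos (by norm_num), Real.log_div (by norm_num) hρpos.ne']
  refine (add_le_add b1 b2).trans ?_
  rw [← ENNReal.ofReal_add (by positivity)]
  · apply ENNReal.ofReal_le_ofReal
    apply le_of_eq
    rw [hlog, hmf]
    have : ((2*K+1).factorial : ℝ) ≠ 0 := by positivity
    field_simp
    ring
  · have := Real.log_nonpos hρpos.le hρ1
    have := Real.log_nonneg (by norm_num : (1:ℝ) ≤ 2)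
    apply mul_nonneg (by positivity); linarith

lemma enn_amgm (l : ℝ) (hl : 0 < l) (a b : ENNReal) :
    a * b ≤ ENNReal.ofReal (l/2) * a^2 + ENNReal.ofReal (1/(2*l)) * b^2 := by
  have h1 : ENNReal.ofReal (l/2) ≠ 0 := by simp [hl]
  have h2 : ENNReal.ofReal (1/(2*l)) ≠ 0 := by simp [hl]
  by_cases ha : a = ⊤
  · subst ha; simp [ENNReal.mul_top h1]
  by_cases hb : b = ⊤
  · subst hb; simp only [ENNReal.top_pow (two_ne_zero), ENNReal.mul_top h2]; simp
  lift a to NNReal using ha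
  lift b to NNReal using hb
  rw [← ENNReal.ofReal_coe_nnreal (p := a), ← ENNReal.ofReal_coe_nnreal (p := b), ← ENNReal.ofReal_pow a.coe_nonneg, ← ENNReal.ofReal_pow b.coe_nonneg,
    ← ENNReal.ofReal_mul a.coe_nonneg, ← ENNReal.ofReal_mul (by positivity : 0 ≤ l/2), ← ENNReal.ofReal_mul (by positivity),
    ← ENNReal.ofReal_add (by positivity) (by positivity)]
  apply ENNReal.ofReal_le_ofReal
  have : 0 ≤ (1/(2*l)) * (l * a - b)^2 := by positivity
  have e : (1/(2*l)) * (l * a - b)^2 = l/2 * (a:ℝ)^2 + 1/(2*l) * (b:ℝ)^2 - a * b := by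
    field_simp; ring
  linarith

lemma heatf_le (m : ℕ) (u : Euc (2*m) → ℝ) (x : Euc (2*m)) (j : ℕ) (hL : MemLp (lapIter (2*m) j u) 2)
    (c : ℝ) (hc : 0 < c) :
    |heatf m u x j 1| ≤ c / 4 * (∫ y, (lapIter (2*m) j u y)^2) + (∫ z, (hk m 1 z)^2) / c := by
  have h1 := hk_memLp' m (zero_lt_one' ℝ) x
  have i1 : Integrable (fun y => (hk m 1 (y - x))^2) := h1.integrable_sq
  have i2 : Integrable (fun y => (lapIter (2*m) j u y)^2) := hL.integrable_sq
  have e1 : ∫ y, (hk m 1 (y - x))^2 = ∫ z, (hk m 1 z)^2 := integral_sub_right_eq_self (fun z => (hk m 1 z)^2) x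
  unfold heatf
  rw [← Real.norm_eq_abs, ← e1, ← integral_const_mul, ← integral_div, ← integral_add (i2.const_mul _) (i1.div_const _)]
  apply norm_integral_le_of_norm_le ((i2.const_mul _).add (i1.div_const _))
  refine Eventually.of_forall fun y => ?_
  simp only [Pi.add_apply]
  rw [norm_mul, Real.norm_eq_abs, Real.norm_eq_abs]
  have : 0 ≤ (1/c) * (c/2 * |lapIter (2*m) j u y| - |hk m 1 (y-x)|)^2 := by positivity
  have e : (1/c) * (c/2 * |lapIter (2*m) j u y| - |hk m 1 (y-x)|)^2 =
     c/4 * |lapIter (2*m) j u y|^2 + |hk m 1 (y-x)|^2/c - |hk m 1 (y-x)| * |lapIter (2*m) j u y| := by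
    field_simp; ring
  rw [sq_abs, sq_abs] at e
  linarith

lemma adm_dual (m K : ℕ) (F g : Euc (2*m) → ENNReal) (hF : Measurable F) (hg : Measurable g) :
    ∫⁻ x, (∫⁻ r in Set.Ioc (0:ℝ) 1, wK K r * ∫⁻ y, pk m r (y - x) * F y) * g x = ∫⁻ y, F y * Tg m K g y := by
  set μ := (volume : Measure ℝ).restrict (Set.Ioc (0:ℝ) 1) with hμ
  have qF : ∀ r x, Measurable (fun y => pk m r (y - x) * F y) := fun r x => (pk_sub_meas' m r x).mul hF
  have qg : ∀ r y, Measurable (fun x => pk m r (y - x) * g x) := fun r x => (pk_sub_meas m r x).mul hg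
  have M1 : Measurable (fun a : (Euc (2*m) × ℝ) × Euc (2*m) => pk m a.1.2 (a.2 - a.1.1)) :=
    (pk_meas m).comp (by fun_prop : Measurable fun a : (Euc (2*m) × ℝ) × Euc (2*m) => (a.1.2, a.2 - a.1.1))
  have M2 : Measurable (fun a : (Euc (2*m) × ℝ) × Euc (2*m) => wK K a.1.2 * (pk m a.1.2 (a.2 - a.1.1) * F a.2 * g a.1.1)) :=
    ((wK_meas K).comp (by fun_prop)).mul ((M1.mul (hF.comp (by fun_prop))).mul (hg.comp (by fun_prop)))
  have M3 : Measurable (fun a : Euc (2*m) × ℝ => ∫⁻ y, pk m a.2 (y - a.1) * F y) :=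
    Measurable.lintegral_prod_right' (f := fun a : (Euc (2*m) × ℝ) × Euc (2*m) => pk m a.1.2 (a.2 - a.1.1) * F a.2)
      (M1.mul (hF.comp (by fun_prop)))
  calc _ = ∫⁻ x, ∫⁻ r, ∫⁻ y, wK K r * (pk m r (y - x) * F y * g x) ∂volume ∂μ := by
        apply lintegral_congr; intro x
        have q : Measurable (fun r => wK K r * ∫⁻ y, pk m r (y - x) * F y) :=
          (wK_meas K).mul (M3.comp (by fun_prop : Measurable fun r : ℝ => (x, r)))
        rw [← lintegral_mul_const _ q]
        apply lintegral_congr; intro r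
        rw [lintegral_const_mul _ ((qF r x).mul_const _), lintegral_mul_const _ (qF r x), mul_assoc]
    _ = ∫⁻ r, ∫⁻ x, ∫⁻ y, wK K r * (pk m r (y - x) * F y * g x) ∂volume ∂volume ∂μ := by
        rw [lintegral_lintegral_swap]
        apply Measurable.aemeasurable
        exact Measurable.lintegral_prod_right' M2
    _ = ∫⁻ r, ∫⁻ y, ∫⁻ x, wK K r * (pk m r (y - x) * F y * g x) ∂volume ∂volume ∂μ := by
        apply lintegral_congr; intro r
        rw [lintegral_lintegral_swap]
        apply Measurable.aemeasurable
        exact M2.comp (by fun_prop : Measurable fun a : Euc (2*m) × Euc (2*m) => ((a.1, r), a.2))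
    _ = ∫⁻ r, ∫⁻ y, F y * (wK K r * Pg m r g y) ∂volume ∂μ := by
        apply lintegral_congr; intro r
        apply lintegral_congr; intro y
        unfold Pg
        rw [← mul_assoc, ← lintegral_const_mul _ (qg r y)]
        apply lintegral_congr; intro x
        ring
    _ = ∫⁻ y, ∫⁻ r, F y * (wK K r * Pg m r g y) ∂μ ∂volume := by
        rw [lintegral_lintegral_swap]
        apply Measurable.aemeasurable
        exact (hF.comp measurable_snd).mul (wPg_meas m K g hg)
    _ = _ := by
        apply lintegral_congr; intro y
        unfold Tg
        rw [lintegral_const_mul _ (wPg_meas_y m K g hg y)]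

def cP (m K : ℕ) (σ : ℕ → ℝ) : ℝ := 1 + 4 * ∑ j ∈ Finset.range (K+1), (∫ z, (hk m 1 z)^2) / σ j

lemma cP_pos (m K : ℕ) (σ : ℕ → ℝ) (hσ : ∀ j ≤ K, 0 < σ j) : 0 < cP m K σ := by
  unfold cP
  have : 0 ≤ ∑ j ∈ Finset.range (K+1), (∫ z, (hk m 1 z)^2) / σ j := by
    apply Finset.sum_nonneg
    intro j hj
    have := hσ j (by simp at hj; omega)
    have : 0 ≤ ∫ z, (hk m 1 z)^2 := integral_nonneg fun z => sq_nonneg _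
    positivity
  linarith

lemma adm_mean (m K : ℕ) (σ : ℕ → ℝ) (hσ : ∀ j ≤ K, 0 < σ j) (u : Euc (2*m) → ℝ) (hu : ContDiff ℝ (⊤:ℕ∞) u)
    (hL : ∀ j ≤ K+1, MemLp (lapIter (2*m) j u) 2)
    (hG : ∀ j < K+1, ∀ i, MemLp (fun y => fderiv ℝ (lapIter (2*m) j u) y (EuclideanSpace.single i 1)) 2)
    (hN : (∫ y, (lapIter (2*m) (K+1) u y)^2) + ∑ j ∈ Finset.range (K+1), σ j * (∫ y, (lapIter (2*m) j u y)^2) ≤ 1)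
    (g : Euc (2*m) → ENNReal) (hg : Measurable g) (hg2 : ∫⁻ x, g x ≤ 2)
    (W : ℝ) (hW0 : 0 ≤ W) (hW : ∫⁻ y, (Tg m K g y)^2 ≤ ENNReal.ofReal W)
    (s : ℝ) (hs0 : 0 ≤ s) (hs : ENNReal.ofReal s ≤ ∫⁻ x, ‖u x‖ₑ * g x) :
    s^2 ≤ W + cP m K σ := by
  have hc := cP_pos m K σ hσ
  set l := √(W + cP m K σ) with hl
  have hlp : 0 < l := Real.sqrt_pos.2 (by linarith)
  have hl2 : l^2 = W + cP m K σ := Real.sq_sqrt (by linarith)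
  set F : Euc (2*m) → ENNReal := fun y => ‖lapIter (2*m) (K+1) u y‖ₑ with hF
  have hFc : Continuous (lapIter (2*m) (K+1) u) := (lapIter_contDiff (2*m) u hu (K+1)).continuous
  have hFm : Measurable F := hFc.enorm.measurable
  set H : ℝ := ∑ j ∈ Finset.range (K+1), ((l * σ j) / 4 * (∫ y, (lapIter (2*m) j u y)^2) + (∫ z, (hk m 1 z)^2) / (l * σ j)) with hH
  have hH0 : 0 ≤ H := by
    apply Finset.sum_nonneg
    intro j hj
    have h1 := hσ j (by simp at hj; omega)
    have h2 : 0 ≤ ∫ z, (hk m 1 z)^2 := integral_nonneg fun z => sq_nonneg _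
    have h3 : 0 ≤ ∫ y, (lapIter (2*m) j u y)^2 := integral_nonneg fun z => sq_nonneg _
    positivity
  have hF2 : ∫⁻ y, F y ^2 = ENNReal.ofReal (∫ y, (lapIter (2*m) (K+1) u y)^2) := by
    rw [ofReal_integral_eq_lintegral_ofReal (hL (K+1) le_rfl).integrable_sq (Eventually.of_forall fun y => sq_nonneg _)]
    apply lintegral_congr; intro y
    simp only [hF]
    rw [← sq_abs, ENNReal.ofReal_pow (abs_nonneg _), ← Real.norm_eq_abs, ofReal_norm]
  have hF20 : 0 ≤ ∫ y, (lapIter (2*m) (K+1) u y)^2 := integral_nonneg fun z => sq_nonneg _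
  have key : ENNReal.ofReal s ≤ ENNReal.ofReal (2 * H + (l/2 * (∫ y, (lapIter (2*m) (K+1) u y)^2) + 1/(2*l) * W)) := by
    calc ENNReal.ofReal s ≤ ∫⁻ x, ‖u x‖ₑ * g x := hs
      _ ≤ ∫⁻ x, (ENNReal.ofReal H * g x + (∫⁻ r in Set.Ioc (0:ℝ) 1, wK K r * ∫⁻ y, pk m r (y - x) * F y) * g x) := by
          apply lintegral_mono
          intro x
          dsimp only
          rw [← add_mul]
          gcongr
          refine (adm_repr m K u hu hL hG x).trans ?_
          apply add_le_add _ le_rfl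
          apply ENNReal.ofReal_le_ofReal
          apply Finset.sum_le_sum
          intro j hj
          simp at hj
          exact heatf_le m u x j (hL j (by omega)) _ (mul_pos hlp (hσ j (by omega)))
      _ = ENNReal.ofReal H * (∫⁻ x, g x) + ∫⁻ y, F y * Tg m K g y := by
          rw [lintegral_add_left (hg.const_mul _), lintegral_const_mul _ hg, adm_dual m K F g hFm hg]
      _ ≤ ENNReal.ofReal H * 2 + ∫⁻ y, (ENNReal.ofReal (l/2) * F y ^ 2 + ENNReal.ofReal (1/(2*l)) * (Tg m K g y)^2) := by
          gcongr with y
          exact enn_amgm l hlp _ _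
      _ = ENNReal.ofReal H * 2 + (ENNReal.ofReal (l/2) * ENNReal.ofReal (∫ y, (lapIter (2*m) (K+1) u y)^2) +
            ENNReal.ofReal (1/(2*l)) * ∫⁻ y, (Tg m K g y)^2) := by
          rw [lintegral_add_left ((hFm.pow_const 2).const_mul _), lintegral_const_mul _ (hFm.pow_const 2),
            lintegral_const_mul _ ((Tg_meas m K g hg).pow_const 2), hF2]
      _ ≤ ENNReal.ofReal H * 2 + (ENNReal.ofReal (l/2) * ENNReal.ofReal (∫ y, (lapIter (2*m) (K+1) u y)^2) +
            ENNReal.ofReal (1/(2*l)) * ENNReal.ofReal W) := by gcongr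
      _ = _ := by
          rw [ENNReal.ofReal_add (by positivity) (by positivity), ENNReal.ofReal_add (by positivity) (by positivity),
            ENNReal.ofReal_mul (by positivity), ENNReal.ofReal_mul (by positivity), ENNReal.ofReal_mul (by positivity)]
          simp [mul_comm]
  have key2 := (ENNReal.ofReal_le_ofReal_iff (by positivity)).1 key
  have hHe : 2 * H = l/2 * (∑ j ∈ Finset.range (K+1), σ j * (∫ y, (lapIter (2*m) j u y)^2)) + 1/(2*l) * (cP m K σ - 1) := by
    unfold cP
    rw [hH, add_sub_cancel_left, Finset.mul_sum, Finset.mul_sum, Finset.mul_sum, Finset.mul_sum, ← Finset.sum_add_distrib]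
    apply Finset.sum_congr rfl
    intro j hj
    have h1 := hσ j (by simp at hj; omega)
    field_simp
    ring
  have h3 : s ≤ l/2 * 1 + 1/(2*l) * (W + cP m K σ) := by
    have : l/2 * ((∫ y, (lapIter (2*m) (K+1) u y)^2) + ∑ j ∈ Finset.range (K+1), σ j * (∫ y, (lapIter (2*m) j u y)^2)) ≤ l/2 * 1 := by gcongr
    have h4 : 0 < 1/(2*l) := by positivity
    nlinarith
  rw [← hl2] at h3 ⊢
  have : l/2 * 1 + 1/(2*l) * l^2 = l := by field_simp; norm_num
  rw [this] at h3
  gcongr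

lemma adm_two (m K : ℕ) (hmK : m = 2*K+2) (σ : ℕ → ℝ) (hσ : ∀ j ≤ K, 0 < σ j) (u : Euc (2*m) → ℝ) (hu : ContDiff ℝ (⊤:ℕ∞) u)
    (hL : ∀ j ≤ K+1, MemLp (lapIter (2*m) j u) 2)
    (hG : ∀ j < K+1, ∀ i, MemLp (fun y => fderiv ℝ (lapIter (2*m) j u) y (EuclideanSpace.single i 1)) 2)
    (hN : (∫ y, (lapIter (2*m) (K+1) u y)^2) + ∑ j ∈ Finset.range (K+1), σ j * (∫ y, (lapIter (2*m) j u y)^2) ≤ 1)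
    (E1 E2 : Set (Euc (2*m))) (hE1 : MeasurableSet E1) (hE2 : MeasurableSet E2)
    (a1 a2 : ℝ) (ha1 : 0 < a1) (ha2 : 0 < a2) (h1 : a1 ≤ 1) (h2 : a2 ≤ 1)
    (hv1 : volume E1 = ENNReal.ofReal a1) (hv2 : volume E2 = ENNReal.ofReal a2)
    (s1 s2 : ℝ) (hs1 : 0 ≤ s1) (hs2 : 0 ≤ s2) (hu1 : ∀ x ∈ E1, s1 ≤ |u x|) (hu2 : ∀ x ∈ E2, s2 ≤ |u x|) :
    ((4*π)^m * (m.factorial:ℝ)) * (s1 + s2)^2 ≤ 3 * (-Real.log a1) + (-Real.log a2) +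
      4 * (((4*π)^m + m * Real.log 2) + ((4*π)^m * (m.factorial:ℝ)) * cP m K σ) := by
  set A := ((4*π)^m * (m.factorial:ℝ)) with hA
  have hA0 : 0 < A := by positivity
  have hcP := cP_pos m K σ hσ
  set C1 := ((4*π)^m + m * Real.log 2) with hC1
  have hC10 : 0 ≤ C1 := by
    have := Real.log_nonneg (by norm_num : (1:ℝ) ≤ 2)
    positivity
  set gg : Set (Euc (2*m)) → ℝ → Euc (2*m) → ENNReal := fun E a => E.indicator (fun _ => ENNReal.ofReal a⁻¹) with hgg
  have hm : ∀ E a, MeasurableSet E → Measurable (gg E a) := fun E a hE => measurable_const.indicator hE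
  have hi : ∀ E a, MeasurableSet E → 0 < a → volume E = ENNReal.ofReal a → ∫⁻ x, gg E a x = 1 := by
    intro E a hE ha hv
    simp only [hgg]
    rw [lintegral_indicator_const hE, hv, ← ENNReal.ofReal_mul (by positivity), inv_mul_cancel₀ ha.ne']; simp
  have hb : ∀ E a x, gg E a x ≤ ENNReal.ofReal a⁻¹ := by
    intro E a x
    exact Set.indicator_le_self _ _ x
  have hlow : ∀ E a s, MeasurableSet E → 0 < a → volume E = ENNReal.ofReal a → (∀ x ∈ E, s ≤ |u x|) →
      ENNReal.ofReal s ≤ ∫⁻ x, ‖u x‖ₑ * gg E a x := by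
    intro E a s hE ha hv hs
    calc ENNReal.ofReal s = ∫⁻ x, ENNReal.ofReal s * gg E a x := by
          rw [lintegral_const_mul _ (hm E a hE), hi E a hE ha hv, mul_one]
      _ ≤ _ := by
          apply lintegral_mono; intro x
          dsimp only
          by_cases hx : x ∈ E
          · gcongr
            rw [← ofReal_norm, Real.norm_eq_abs]
            exact ENNReal.ofReal_le_ofReal (hs x hx)
          · simp [hgg, hx]
  set g1 := gg E1 a1
  set g2 := gg E2 a2
  have hg1 : Measurable g1 := hm _ _ hE1
  have hg2 : Measurable g2 := hm _ _ hE2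
  have i1 : ∫⁻ x, g1 x = 1 := hi _ _ hE1 ha1 hv1
  have i2 : ∫⁻ x, g2 x = 1 := hi _ _ hE2 ha2 hv2
  have l1 := Real.log_nonpos ha1.le h1
  have l2 := Real.log_nonpos ha2.le h2
  have T1 := Tg_meas m K g1 hg1
  have T2 := Tg_meas m K g2 hg2
  set W : ℝ := 3 * ((-Real.log a1 + C1)/A) + (-Real.log a2 + C1)/A with hWdef
  have n1 : 0 ≤ (-Real.log a1 + C1)/A := div_nonneg (by linarith) hA0.le
  have n2 : 0 ≤ (-Real.log a2 + C1)/A := div_nonneg (by linarith) hA0.le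
  have hW : ∫⁻ y, (Tg m K (fun x => g1 x + g2 x) y)^2 ≤ ENNReal.ofReal W := by
    have j1 := (Tg_pair m K g1 g1 hg1 hg1 i1.le i1.le a1 (hb _ _)).trans (Jb_le m K hmK ha1 h1)
    have j2 := (Tg_pair m K g2 g1 hg2 hg1 i2.le i1.le a1 (hb _ _)).trans (Jb_le m K hmK ha1 h1)
    have j3 := (Tg_pair m K g2 g2 hg2 hg2 i2.le i2.le a2 (hb _ _)).trans (Jb_le m K hmK ha2 h2)
    calc _ = ∫⁻ y, (Tg m K g1 y * Tg m K g1 y + (2 * (Tg m K g2 y * Tg m K g1 y) + Tg m K g2 y * Tg m K g2 y)) := by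
          apply lintegral_congr; intro y
          rw [Tg_add m K g1 g2 hg1]; ring
      _ = (∫⁻ y, Tg m K g1 y * Tg m K g1 y) + (2 * (∫⁻ y, Tg m K g2 y * Tg m K g1 y) + ∫⁻ y, Tg m K g2 y * Tg m K g2 y) := by
          have q1 : Measurable (fun y => Tg m K g1 y * Tg m K g1 y) := T1.mul T1
          have q2 : Measurable (fun y => Tg m K g2 y * Tg m K g1 y) := T2.mul T1
          rw [lintegral_add_left q1, lintegral_add_left (q2.const_mul 2), lintegral_const_mul _ q2]
      _ ≤ ENNReal.ofReal ((-Real.log a1 + C1)/A) + (2 * ENNReal.ofReal ((-Real.log a1 + C1)/A) + ENNReal.ofReal ((-Real.log a2 + C1)/A)) := by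
          gcongr
      _ = _ := by
          rw [show (2:ENNReal) = ENNReal.ofReal 2 by simp, ← ENNReal.ofReal_mul (by norm_num), ← ENNReal.ofReal_add (by positivity) n2, ← ENNReal.ofReal_add n1 (by positivity)]
          congr 1
          rw [hWdef]; ring
  have hfin := adm_mean m K σ hσ u hu hL hG hN (fun x => g1 x + g2 x) (hg1.add hg2)
    (by rw [lintegral_add_left hg1, i1, i2]; norm_num) W (by positivity) hW (s1 + s2) (by positivity) (by
      rw [ENNReal.ofReal_add hs1 hs2]
      refine (add_le_add (hlow E1 a1 s1 hE1 ha1 hv1 hu1) (hlow E2 a2 s2 hE2 ha2 hv2 hu2)).trans_eq ?_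
      have q : Measurable (fun x => ‖u x‖ₑ * g1 x) := hu.continuous.enorm.measurable.mul hg1
      rw [← lintegral_add_left q]
      apply lintegral_congr; intro x; rw [mul_add])
  have h5 : A * (s1+s2)^2 ≤ A * (W + cP m K σ) := by gcongr
  have h6 : A * W = 3 * (-Real.log a1) + (-Real.log a2) + 4 * C1 := by
    rw [hWdef]; field_simp; ring
  have : 0 ≤ A * cP m K σ := by positivity
  nlinarith

lemma one_dim_aux {s1 s2 l : ℝ} (hl : 0 < l) (h1 : l ≤ s1) (h12 : s1 ≤ s2)
    (h : (√s1 + √s2)^2 ≤ 3 * s1 + s2 + 4 * l) : s2 - s1 ≤ 8 * l := by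
  have q1 : √s1^2 = s1 := Real.sq_sqrt (by linarith)
  have q2 : √s2^2 = s2 := Real.sq_sqrt (by linarith)
  have p : √s1 * √s2 ≤ s1 + 2 * l := by nlinarith
  have p2 : s1 * s2 ≤ (s1 + 2*l)^2 := by
    calc s1 * s2 = (√s1 * √s2)^2 := by rw [mul_pow, q1, q2]
      _ ≤ _ := by gcongr
  have : s1 * (s2 - s1) ≤ s1 * (8 * l) := by nlinarith
  exact le_of_mul_le_mul_left this (by linarith)

def cS (θ C0 : ℝ) : ENNReal := ∑' j : ℕ, ENNReal.ofReal (Real.exp (θ * (C0 - j))) * ENNReal.ofReal (9 * (j+1))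

lemma cS_ne_top (θ C0 : ℝ) (hθ : 0 < θ) : cS θ C0 ≠ ⊤ := by
  unfold cS
  have : ∀ j : ℕ, ENNReal.ofReal (Real.exp (θ * (C0 - j))) * ENNReal.ofReal (9 * (j+1)) =
     ENNReal.ofReal (Real.exp (θ * (C0 - j)) * (9 * (j+1))) := fun j =>
      (ENNReal.ofReal_mul (Real.exp_pos _).le).symm
  simp_rw [this]
  apply Summable.tsum_ofReal_ne_top
  have hr : ‖Real.exp (-θ)‖ < 1 := by
    rw [Real.norm_of_nonneg (by positivity)]; rw [Real.exp_lt_one_iff]; linarith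
  have s1 := summable_pow_mul_geometric_of_norm_lt_one 1 hr
  have s0 := summable_pow_mul_geometric_of_norm_lt_one 0 hr
  have := ((s1.add s0).mul_left (9 * Real.exp (θ * C0)))
  refine this.congr fun j => ?_
  have : Real.exp (θ * (C0 - j)) = Real.exp (θ * C0) * Real.exp (-θ)^j := by
    rw [← Real.exp_nat_mul, ← Real.exp_add]; congr 1; ring
  rw [this]; ring

lemma one_dim (M : ℝ → ℝ) (hM : Measurable M) (s0 C0 θ : ℝ) (hs0 : 0 ≤ s0) (hθ : 0 < θ) (hM0 : ∀ s, 0 ≤ M s)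
    (H : ∀ s1 > s0, ∀ s2 > s0, 0 < M s1 → 0 < M s2 →
      (√s1 + √s2)^2 ≤ 3 * (-Real.log (M s1)) + (-Real.log (M s2)) + 4 * C0) :
    ∫⁻ s in Set.Ioi s0, ENNReal.ofReal ((Real.exp s * M s)^θ) ≤ cS θ C0 := by
  set S : ℝ → Set ℝ := fun l => {s | s0 < s ∧ 0 < M s ∧ C0 - s - Real.log (M s) ≤ l} with hS
  have hSm : ∀ l, MeasurableSet (S l) := by
    intro l
    refine (measurableSet_lt measurable_const measurable_id).inter ((measurableSet_lt measurable_const hM).inter ?_)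
    have q : Measurable (fun s => C0 - s - Real.log (M s)) :=
      (measurable_const.sub measurable_id).sub (Real.measurable_log.comp hM)
    exact measurableSet_le q measurable_const
  have hSv : ∀ l > 0, volume (S l) ≤ ENNReal.ofReal (9 * l) := by
    intro l hl
    have hsub : S l ⊆ Set.Icc 0 l ∪ (S l ∩ Set.Ioi l) := by
      intro s hs
      by_cases h : s ≤ l
      · left; exact ⟨hs0.trans hs.1.le, h⟩
      · right; exact ⟨hs, not_le.1 h⟩
    have hp : ∀ x ∈ S l, ∀ y ∈ S l, l < x → x ≤ y → y - x ≤ 8 * l := by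
      intro x hx y hy hlx hxy
      refine one_dim_aux hl hlx.le hxy ?_
      have := H x hx.1 y hy.1 hx.2.1 hy.2.1
      have h1 := hx.2.2
      have h2 := hy.2.2
      linarith
    have hd : volume (S l ∩ Set.Ioi l) ≤ ENNReal.ofReal (8 * l) := by
      refine (Real.volume_le_diam _).trans ?_
      apply Metric.ediam_le
      intro x hx y hy
      rw [edist_dist]
      apply ENNReal.ofReal_le_ofReal
      rw [Real.dist_eq, abs_le]
      rcases le_total x y with h | h
      · have := hp x hx.1 y hy.1 hx.2 h
        constructor <;> linarith
      · have := hp y hy.1 x hx.1 hy.2 h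
        constructor <;> linarith
    calc volume (S l) ≤ volume (Set.Icc 0 l) + volume (S l ∩ Set.Ioi l) := (measure_mono hsub).trans (measure_union_le _ _)
      _ ≤ ENNReal.ofReal l + ENNReal.ofReal (8 * l) := by
          gcongr
          simp
      _ = _ := by rw [← ENNReal.ofReal_add hl.le (by positivity)]; congr 1; ring
  calc _ ≤ ∫⁻ s, ∑' j : ℕ, (S (j+1)).indicator (fun _ => ENNReal.ofReal (Real.exp (θ * (C0 - j)))) s := by
        rw [← lintegral_indicator measurableSet_Ioi]
        apply lintegral_mono
        intro s
        by_cases hs : s ∈ Set.Ioi s0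
        swap
        · dsimp only; rw [Set.indicator_of_notMem hs]; simp
        dsimp only
        rw [Set.indicator_of_mem hs]
        rcases (hM0 s).eq_or_lt with h0 | h0
        · rw [← h0, mul_zero, Real.zero_rpow hθ.ne']; simp
        set l := C0 - s - Real.log (M s) with hl
        have hl0 : 0 ≤ l := by
          have := H s hs s hs h0 h0
          have q1 : √s^2 = s := Real.sq_sqrt (hs0.trans (le_of_lt hs))
          nlinarith
        have hmem : s ∈ S (⌊l⌋₊ + 1) := ⟨hs, h0, (Nat.lt_floor_add_one l).le⟩
        refine le_trans ?_ (ENNReal.le_tsum ⌊l⌋₊)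
        rw [Set.indicator_of_mem hmem]
        apply ENNReal.ofReal_le_ofReal
        have e : Real.exp s * M s = Real.exp (C0 - l) := by
          rw [hl, show C0 - (C0 - s - Real.log (M s)) = s + Real.log (M s) by ring, Real.exp_add, Real.exp_log h0]
        rw [e, ← Real.exp_mul, Real.exp_le_exp, mul_comm]
        have := Nat.floor_le hl0
        gcongr
    _ = ∑' j : ℕ, ∫⁻ s, (S (j+1)).indicator (fun _ => ENNReal.ofReal (Real.exp (θ * (C0 - j)))) s := by
        rw [lintegral_tsum]
        intro j
        exact (measurable_const.indicator (hSm _)).aemeasurable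
    _ ≤ _ := by
        unfold cS
        gcongr with j
        rw [lintegral_indicator_const (hSm _)]
        gcongr
        exact hSv _ (by positivity)

def ww (n : ℕ) (β : ℝ) (x : Euc n) : ENNReal := ENNReal.ofReal (‖x‖ ^ (-β))

lemma ww_meas (n : ℕ) (β : ℝ) : Measurable (ww n β) := by
  unfold ww
  have : Measurable fun x : Euc n => ‖x‖ ^ (-β) := (measurable_norm).pow_const _
  exact this.ennreal_ofReal

def cV (n : ℕ) (β : ℝ) : ENNReal := ∫⁻ x in Metric.ball (0 : Euc n) 1, ww n β x

lemma cV_ne_top (n : ℕ) (hn : 1 ≤ n) (β : ℝ) (hβ : β < n) : cV n β ≠ ⊤ := by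
  have hi : IntegrableOn (fun x : Euc n => ‖x‖ ^ (-β)) (Metric.ball 0 1) := by
    refine integrableOn_ball_of_norm_le_rpow (C := 1) (α := β) ?_ ?_ ?_ ?_
    · simpa using hn
    · simpa using hβ
    · refine Eventually.of_forall fun x => ?_
      rw [Real.norm_of_nonneg (by positivity), one_mul]
    · exact ((measurable_norm).pow_const _).aestronglyMeasurable
  exact hi.lintegral_lt_top.ne

lemma ww_ball (n : ℕ) (β R : ℝ) (hR : 0 < R) :
    ∫⁻ x in Metric.ball (0 : Euc n) R, ww n β x = ENNReal.ofReal (R ^ ((n:ℝ) - β)) * cV n β := by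
  have h := lintegral_map (μ := (volume : Measure (Euc n)))
    ((ww_meas n β).indicator (Metric.isOpen_ball (x := (0 : Euc n)) (ε := R)).measurableSet)
    (measurable_const_smul R)
  have h2 := Measure.map_addHaar_smul (volume : Measure (Euc n)) hR.ne'
  rw [h2, lintegral_smul_measure, lintegral_indicator Metric.isOpen_ball.measurableSet] at h
  have h3 : ∫⁻ y, (Metric.ball (0 : Euc n) R).indicator (ww n β) (R • y) = ENNReal.ofReal (R^(-β)) * cV n β := by
    unfold cV
    rw [← lintegral_const_mul _ (ww_meas n β), ← lintegral_indicator Metric.isOpen_ball.measurableSet]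
    apply lintegral_congr; intro y
    by_cases hy : y ∈ Metric.ball (0 : Euc n) 1
    · have hy' : R • y ∈ Metric.ball (0 : Euc n) R := by
        simp only [mem_ball_zero_iff] at hy ⊢
        rw [norm_smul, Real.norm_of_nonneg hR.le]; nlinarith
      rw [Set.indicator_of_mem hy, Set.indicator_of_mem hy']
      unfold ww
      rw [norm_smul, Real.norm_of_nonneg hR.le, Real.mul_rpow hR.le (norm_nonneg _), ENNReal.ofReal_mul (by positivity)]
    · have hy' : R • y ∉ Metric.ball (0 : Euc n) R := by
        simp only [mem_ball_zero_iff, not_lt] at hy ⊢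
        rw [norm_smul, Real.norm_of_nonneg hR.le]; nlinarith
      rw [Set.indicator_of_notMem hy, Set.indicator_of_notMem hy']
  rw [h3] at h
  simp only [finrank_euclideanSpace, Fintype.card_fin, smul_eq_mul] at h
  rw [abs_of_nonneg (by positivity)] at h
  calc _ = ENNReal.ofReal (R^n) * (ENNReal.ofReal ((R ^ n)⁻¹) * ∫⁻ x in Metric.ball (0 : Euc n) R, ww n β x) := by
        rw [← mul_assoc, ← ENNReal.ofReal_mul (by positivity), mul_inv_cancel₀ (by positivity)]; simp
    _ = _ := by
        rw [h, ← mul_assoc, ← ENNReal.ofReal_mul (by positivity), ← Real.rpow_natCast, ← Real.rpow_add hR, sub_eq_add_neg]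

lemma ww_set (n : ℕ) (β R : ℝ) (hβ : 0 ≤ β) (hR : 0 < R) (E : Set (Euc n)) (hE : MeasurableSet E) :
    ∫⁻ x in E, ww n β x ≤ ENNReal.ofReal (R ^ ((n:ℝ) - β)) * cV n β + ENNReal.ofReal (R^(-β)) * volume E := by
  have hB : MeasurableSet (Metric.ball (0 : Euc n) R) := Metric.isOpen_ball.measurableSet
  rw [← ww_ball n β R hR]
  have hsub : E ⊆ Metric.ball (0 : Euc n) R ∪ (E \ Metric.ball (0 : Euc n) R) := by
    intro x hx
    by_cases h : x ∈ Metric.ball (0 : Euc n) R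
    · exact Or.inl h
    · exact Or.inr ⟨hx, h⟩
  refine (lintegral_mono_set hsub).trans ((lintegral_union_le _ _ _).trans ?_)
  gcongr
  calc ∫⁻ x in E \ Metric.ball (0 : Euc n) R, ww n β x ≤ ∫⁻ x in E \ Metric.ball (0 : Euc n) R, ENNReal.ofReal (R^(-β)) := by
        apply setLIntegral_mono' (hE.diff hB)
        intro x hx
        apply ENNReal.ofReal_le_ofReal
        have h2 : R ≤ ‖x‖ := by simpa using hx.2
        exact Real.rpow_le_rpow_of_nonpos hR h2 (by linarith)
    _ ≤ _ := by
        rw [setLIntegral_const]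
        gcongr
        exact Set.sdiff_subset

lemma ww_set1 (n : ℕ) (β : ℝ) (hβ : 0 ≤ β) (E : Set (Euc n)) (hE : MeasurableSet E) :
    ∫⁻ x in E, ww n β x ≤ cV n β + volume E := by
  simpa using ww_set n β 1 hβ one_pos E hE

lemma ww_setθ (n : ℕ) (hn : 1 ≤ n) (β : ℝ) (hβ : 0 ≤ β) (hβn : β < n) (E : Set (Euc n)) (hE : MeasurableSet E)
    (hv : volume E ≠ ⊤) :
    ∫⁻ x in E, ww n β x ≤ (cV n β + 1) * ENNReal.ofReal ((volume E).toReal ^ (1 - β/n)) := by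
  have hn0 : (0:ℝ) < n := by exact_mod_cast hn
  by_cases h0 : volume E = 0
  · rw [Measure.restrict_eq_zero.2 h0]; simp
  set a := (volume E).toReal with ha
  have ha0 : 0 < a := ENNReal.toReal_pos h0 hv
  have hva : volume E = ENNReal.ofReal a := (ENNReal.ofReal_toReal hv).symm
  refine (ww_set n β (a ^ ((n:ℝ)⁻¹)) hβ (by positivity) E hE).trans ?_
  rw [hva, ← ENNReal.ofReal_mul (by positivity), ← Real.rpow_mul ha0.le, ← Real.rpow_mul ha0.le]
  have e1 : (n:ℝ)⁻¹ * ((n:ℝ) - β) = 1 - β/n := by field_simp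
  have e2 : a ^ ((n:ℝ)⁻¹ * -β) * a = a ^ (1 - β/n) := by
    nth_rewrite 2 [← Real.rpow_one a]
    rw [← Real.rpow_add ha0]; congr 1; field_simp; ring
  rw [e1, e2, add_mul, one_mul, mul_comm]

lemma adm_facts (m K : ℕ) (hmK : m = 2*K+2) (τ : ℕ → ℝ) (hτ : ∀ γ < m, 0 < τ γ) (hτm : τ m = 1)
    (u : Euc (2*m) → ℝ) (hu : ContDiff ℝ (⊤ : ℕ∞) u)
    (hi : ∀ γ ≤ m, Integrable (gradNormSq (2*m) γ u))
    (h1 : (∫ x, ∑ γ ∈ Finset.range (m+1), τ γ * gradNormSq (2*m) γ u x) ≤ 1) :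
    (∀ j ≤ K+1, MemLp (lapIter (2*m) j u) 2) ∧
    (∀ j < K+1, ∀ i, MemLp (fun y => fderiv ℝ (lapIter (2*m) j u) y (EuclideanSpace.single i 1)) 2) ∧
    ((∫ y, (lapIter (2*m) (K+1) u y)^2) + ∑ j ∈ Finset.range (K+1), τ (2*j) * (∫ y, (lapIter (2*m) j u y)^2) ≤ 1) := by
  have he : ∀ j, gradNormSq (2*m) (2*j) u = fun x => (lapIter (2*m) j u x)^2 := by
    intro j; funext x; simp [gradNormSq]
  have ho : ∀ j, gradNormSq (2*m) (2*j+1) u = fun x => ∑ i, (fderiv ℝ (lapIter (2*m) j u) x (EuclideanSpace.single i 1))^2 := by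
    intro j; funext x
    have e1 : (2*j+1) % 2 = 1 := by omega
    have e2 : (2*j+1) / 2 = j := by omega
    simp [gradNormSq, e1, e2]
  have hpos : ∀ γ x, 0 ≤ gradNormSq (2*m) γ u x := by
    intro γ x
    unfold gradNormSq
    split_ifs
    · positivity
    · positivity
  refine ⟨?_, ?_, ?_⟩
  · intro j hj
    have := hi (2*j) (by omega)
    rw [he] at this
    exact (memLp_two_iff_integrable_sq (lapIter_contDiff (2*m) u hu j).continuous.aestronglyMeasurable).2 this
  · intro j hj i
    have := hi (2*j+1) (by omega)
    rw [ho] at this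
    have hc : Continuous (fun y => fderiv ℝ (lapIter (2*m) j u) y (EuclideanSpace.single i 1)) :=
      ((lapIter_contDiff (2*m) u hu j).continuous_fderiv (by simp)).clm_apply continuous_const
    refine (memLp_two_iff_integrable_sq hc.aestronglyMeasurable).2 ?_
    refine this.mono' (hc.pow 2).aestronglyMeasurable (Eventually.of_forall fun y => ?_)
    rw [Real.norm_of_nonneg (sq_nonneg _)]
    exact Finset.single_le_sum (f := fun i => (fderiv ℝ (lapIter (2*m) j u) y (EuclideanSpace.single i 1))^2) (fun i _ => sq_nonneg _) (Finset.mem_univ i)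
  · rw [integral_finsetSum] at h1
    swap
    · intro γ hγ
      simp at hγ
      exact (hi γ (by omega)).const_mul _
    refine le_trans ?_ h1
    have e1 : (∫ y, (lapIter (2*m) (K+1) u y)^2) + ∑ j ∈ Finset.range (K+1), τ (2*j) * (∫ y, (lapIter (2*m) j u y)^2) =
        ∑ j ∈ Finset.range (K+2), ∫ x, τ (2*j) * gradNormSq (2*m) (2*j) u x := by
      rw [Finset.sum_range_succ _ (K+1), add_comm]
      congr 1
      · apply Finset.sum_congr rfl
        intro j hj
        rw [integral_const_mul, he]
      · rw [integral_const_mul, he, show 2*(K+1) = m by omega, hτm, one_mul]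
    rw [e1]
    have e2 := Finset.sum_image (s := Finset.range (K+2)) (g := fun j => 2*j) (f := fun γ => ∫ x, τ γ * gradNormSq (2*m) γ u x)
      (fun x _ y _ h => by simpa using h)
    rw [← e2]
    apply Finset.sum_le_sum_of_subset_of_nonneg
    · intro γ hγ
      simp at hγ ⊢
      obtain ⟨j, hj, rfl⟩ := hγ
      omega
    · intro γ hγ _
      simp at hγ
      apply integral_nonneg
      intro x
      have : 0 ≤ τ γ := by
        rcases Nat.lt_or_ge γ m with h | h
        · exact (hτ γ h).le
        · rw [show γ = m by omega, hτm]; norm_num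
      exact mul_nonneg this (hpos γ x)

lemma adm_layer (m : ℕ) (hm : 1 ≤ m) (β : ℝ) (hβ0 : 0 ≤ β) (hβ : β < 2*m) (θ : ℝ) (hθ : θ = 1 - β/(2*m))
    (f : Euc (2*m) → ℝ) (hf : Continuous f) (hf0 : ∀ x, 0 ≤ f x) (s0 C0 : ℝ) (hs0 : 0 < s0)
    (hfi : ∫⁻ x, ENNReal.ofReal (f x) ≤ ENNReal.ofReal s0)
    (H : ∀ E1 E2 : Set (Euc (2*m)), MeasurableSet E1 → MeasurableSet E2 → ∀ t1 t2 a1 a2 : ℝ, 0 < a1 → 0 < a2 → a1 ≤ 1 → a2 ≤ 1 →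
      volume E1 = ENNReal.ofReal a1 → volume E2 = ENNReal.ofReal a2 → 0 ≤ t1 → 0 ≤ t2 → (∀ x ∈ E1, t1 < f x) →
      (∀ x ∈ E2, t2 < f x) → (√t1 + √t2)^2 ≤ 3 * (-Real.log a1) + (-Real.log a2) + 4 * C0) :
    ∫⁻ x, ww (2*m) β x * ENNReal.ofReal (Real.exp (θ * f x) - 1) ≤
      ENNReal.ofReal (θ * Real.exp (θ * s0)) * (cV (2*m) β * ENNReal.ofReal s0 + ENNReal.ofReal s0) +
      (cV (2*m) β + 1) * (ENNReal.ofReal θ * cS θ C0) := by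
  have hm0 : (0:ℝ) < m := by exact_mod_cast hm
  have hθ0 : 0 < θ := by
    rw [hθ, sub_pos, div_lt_one (by positivity)]; exact hβ
  set ν := (volume : Measure (Euc (2*m))).withDensity (ww (2*m) β) with hν
  have hE : ∀ t, MeasurableSet {x | t < f x} := fun t => measurableSet_lt measurable_const hf.measurable
  have hνE : ∀ t, ν {x | t < f x} = ∫⁻ x in {x | t < f x}, ww (2*m) β x := fun t => withDensity_apply _ (hE t)
  have hint : ∀ y, ∫ t in (0:ℝ)..y, θ * Real.exp (θ * t) = Real.exp (θ * y) - 1 := by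
    intro y
    rw [intervalIntegral.integral_eq_sub_of_hasDerivAt (f := fun t => Real.exp (θ * t))]
    · simp
    · intro t _
      have := ((hasDerivAt_id t).const_mul θ).exp
      simpa [mul_comm] using this
    · exact Continuous.intervalIntegrable (by fun_prop) _ _
  have lc := lintegral_comp_eq_lintegral_meas_lt_mul (f := f) (g := fun t => θ * Real.exp (θ * t)) ν (Eventually.of_forall hf0)
    hf.measurable.aemeasurable (fun t _ => Continuous.intervalIntegrable (by fun_prop) _ _)
    (Eventually.of_forall fun t => by positivity)
  simp_rw [hint] at lc
  have hmm : Measurable (fun x => ENNReal.ofReal (Real.exp (θ * f x) - 1)) := by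
    have : Continuous fun x => Real.exp (θ * f x) - 1 := by fun_prop
    exact this.measurable.ennreal_ofReal
  rw [hν, lintegral_withDensity_eq_lintegral_mul _ (ww_meas _ _) hmm, ← hν] at lc
  simp only [Pi.mul_apply] at lc
  rw [lc, ← Set.Ioc_union_Ioi_eq_Ioi hs0.le]
  refine (lintegral_union_le _ _ _).trans (add_le_add ?_ ?_)
  · have l2 := lintegral_eq_lintegral_meas_lt (f := f) volume (Eventually.of_forall hf0) hf.measurable.aemeasurable
    calc _ ≤ ∫⁻ t in Set.Ioc 0 s0, ENNReal.ofReal (θ * Real.exp (θ * s0)) * (cV (2*m) β + volume {x | t < f x}) := by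
          apply setLIntegral_mono' measurableSet_Ioc
          intro t ht
          rw [mul_comm, hνE]
          gcongr
          · exact ht.2
          · exact ww_set1 _ _ hβ0 _ (hE t)
      _ = ENNReal.ofReal (θ * Real.exp (θ * s0)) * (cV (2*m) β * ENNReal.ofReal s0 + ∫⁻ t in Set.Ioc 0 s0, volume {x | t < f x}) := by
          rw [lintegral_const_mul', lintegral_add_left measurable_const, setLIntegral_const, Real.volume_Ioc, sub_zero]
          simp
      _ ≤ _ := by
          gcongr
          refine le_trans ?_ hfi
          rw [l2]
          exact lintegral_mono_set Set.Ioc_subset_Ioi_self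
  · have hfin : ∀ t > s0, volume {x | t < f x} ≤ 1 := by
      intro t ht
      have h0 : 0 < t := hs0.trans ht
      have := meas_ge_le_lintegral_div (μ := (volume : Measure (Euc (2*m)))) (f := fun x => ENNReal.ofReal (f x)) hf.measurable.ennreal_ofReal.aemeasurable
        (ε := ENNReal.ofReal t) (by simpa using h0) (by simp)
      calc volume {x | t < f x} ≤ volume {x | ENNReal.ofReal t ≤ ENNReal.ofReal (f x)} := by
            apply measure_mono
            intro x hx
            exact ENNReal.ofReal_le_ofReal (le_of_lt hx)
        _ ≤ _ := this
        _ ≤ ENNReal.ofReal t / ENNReal.ofReal t := by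
            gcongr
            exact hfi.trans (ENNReal.ofReal_le_ofReal ht.le)
        _ ≤ 1 := ENNReal.div_self_le_one
    set M : ℝ → ℝ := fun t => (volume {x | t < f x}).toReal with hM
    have hMm : Measurable M := by
      have : Antitone (fun t => volume {x | t < f x}) := by
        intro a b hab
        apply measure_mono
        intro x hx
        exact lt_of_le_of_lt hab hx
      exact this.measurable.ennreal_toReal
    have od := one_dim M hMm s0 C0 θ hs0.le hθ0 (fun t => ENNReal.toReal_nonneg) (by
      intro t1 ht1 t2 ht2 h1 h2
      have v1 := hfin t1 ht1
      have v2 := hfin t2 ht2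
      refine H _ _ (hE t1) (hE t2) t1 t2 (M t1) (M t2) h1 h2 ?_ ?_ ?_ ?_ (hs0.trans ht1).le (hs0.trans ht2).le (fun x hx => hx) (fun x hx => hx)
      · exact ENNReal.toReal_le_of_le_ofReal zero_le_one (by simpa using v1)
      · exact ENNReal.toReal_le_of_le_ofReal zero_le_one (by simpa using v2)
      · exact (ENNReal.ofReal_toReal (ne_top_of_le_ne_top ENNReal.one_ne_top v1)).symm
      · exact (ENNReal.ofReal_toReal (ne_top_of_le_ne_top ENNReal.one_ne_top v2)).symm)
    have hmeas : Measurable (fun t => ENNReal.ofReal ((Real.exp t * M t)^θ)) :=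
      ((Real.measurable_exp.mul hMm).pow_const _).ennreal_ofReal
    calc _ ≤ ∫⁻ t in Set.Ioi s0, (cV (2*m) β + 1) * (ENNReal.ofReal θ * ENNReal.ofReal ((Real.exp t * M t)^θ)) := by
          apply setLIntegral_mono' measurableSet_Ioi
          intro t ht
          rw [hνE]
          have := ww_setθ (2*m) (by omega) β hβ0 (by push_cast; exact hβ) _ (hE t) (ne_top_of_le_ne_top ENNReal.one_ne_top (hfin t ht))
          refine (mul_le_mul_left this _).trans_eq ?_
          rw [mul_assoc]
          congr 1
          rw [← ENNReal.ofReal_mul (by positivity), ← ENNReal.ofReal_mul hθ0.le]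
          congr 1
          rw [Real.mul_rpow (by positivity) ENNReal.toReal_nonneg, ← Real.exp_mul, hθ]
          push_cast
          ring_nf
      _ = (cV (2*m) β + 1) * (ENNReal.ofReal θ * ∫⁻ t in Set.Ioi s0, ENNReal.ofReal ((Real.exp t * M t)^θ)) := by
          rw [lintegral_const_mul _ (hmeas.const_mul _), lintegral_const_mul _ hmeas]
      _ ≤ _ := by gcongr

/-- Singular Adams-type inequality on `ℝ^{2m}` (Theorem 1.1). -/
theorem singular_adams_inequality (m : ℕ) (hm : 2 ≤ m) (hme : Even m)
    (τ : ℕ → ℝ) (hτ : ∀ γ < m, 0 < τ γ) (hτm : τ m = 1)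
    (β : ℝ) (hβ0 : 0 ≤ β) (hβ : β < 2*m)
    (α : ℝ) (hα0 : 0 ≤ α) (hα : α ≤ (1 - β/(2*m)) * ((4*π)^m * (m.factorial : ℝ))) :
    ∃ C : ℝ, ∀ u : Euc (2*m) → ℝ, ContDiff ℝ (⊤ : ℕ∞) u →
      (∀ γ ≤ m, Integrable (gradNormSq (2*m) γ u)) →
      (∫ x, ∑ γ ∈ Finset.range (m+1), τ γ * gradNormSq (2*m) γ u x) ≤ 1 →
      (∫ x, (Real.exp (α * (u x)^2) - 1) / ‖x‖ ^ β) ≤ C := by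
  obtain ⟨K, hmK⟩ : ∃ K, m = 2*K+2 := by
    obtain ⟨k, hk⟩ := hme
    exact ⟨k-1, by omega⟩
  set θ := 1 - β / (2 * m) with hθ
  set A := (4 * π) ^ m * (m.factorial : ℝ) with hA
  have hA0 : 0 < A := by positivity
  have hm0 : (0:ℝ) < m := by exact_mod_cast (by omega : 0 < m)
  have hθ0 : 0 < θ := by
    rw [hθ, sub_pos, div_lt_one (by positivity)]; exact hβ
  set σ : ℕ → ℝ := fun j => τ (2*j) with hσd
  have hσ : ∀ j ≤ K, 0 < σ j := fun j hj => hτ _ (by omega)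
  have hτ0 : 0 < τ 0 := hτ 0 (by omega)
  set C0 := ((4*π)^m + m * Real.log 2) + A * cP m K σ with hC0
  set s0 := A / τ 0 with hs0
  set D := ENNReal.ofReal (θ * Real.exp (θ * s0)) * (cV (2*m) β * ENNReal.ofReal s0 + ENNReal.ofReal s0) +
      (cV (2*m) β + 1) * (ENNReal.ofReal θ * cS θ C0) with hD
  have hV : cV (2*m) β ≠ ⊤ := cV_ne_top (2*m) (by omega) β (by push_cast; exact hβ)
  have hDt : D ≠ ⊤ := by
    have h1 := cS_ne_top θ C0 hθ0
    rw [hD]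
    refine ENNReal.add_ne_top.2 ⟨ENNReal.mul_ne_top ENNReal.ofReal_ne_top (ENNReal.add_ne_top.2 ⟨ENNReal.mul_ne_top hV ENNReal.ofReal_ne_top, ENNReal.ofReal_ne_top⟩), ENNReal.mul_ne_top (ENNReal.add_ne_top.2 ⟨hV, ENNReal.one_ne_top⟩) (ENNReal.mul_ne_top ENNReal.ofReal_ne_top h1)⟩
  refine ⟨D.toReal, ?_⟩
  intro u hu hi h1
  obtain ⟨hL, hG, hN⟩ := adm_facts m K hmK τ hτ hτm u hu hi h1
  set f : Euc (2*m) → ℝ := fun x => A * (u x)^2 with hf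
  have hfc : Continuous f := continuous_const.mul (hu.continuous.pow 2)
  have hf0 : ∀ x, 0 ≤ f x := fun x => by positivity
  have hint : Integrable (fun x => (u x)^2) := (hL 0 (by omega)).integrable_sq
  have hu2 : τ 0 * ∫ x, (u x)^2 ≤ 1 := by
    have h2 := Finset.single_le_sum (s := Finset.range (K+1)) (f := fun j => τ (2*j) * (∫ y, (lapIter (2*m) j u y)^2))
      (fun j hj => by
        simp at hj
        exact mul_nonneg (hσ j (by omega)).le (integral_nonneg fun x => sq_nonneg _)) (Finset.mem_range.2 (by omega : 0 < K+1))
    have h3 : 0 ≤ ∫ y, (lapIter (2*m) (K+1) u y)^2 := integral_nonneg fun x => sq_nonneg _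
    have h4 : τ (2*0) * (∫ y, (lapIter (2*m) 0 u y)^2) ≤ 1 := by
      refine h2.trans ?_
      linarith
    exact h4
  have hfi : ∫⁻ x, ENNReal.ofReal (f x) ≤ ENNReal.ofReal s0 := by
    rw [← ofReal_integral_eq_lintegral_ofReal (hint.const_mul A) (Eventually.of_forall hf0)]
    apply ENNReal.ofReal_le_ofReal
    rw [integral_const_mul, hs0, le_div_iff₀ hτ0]
    nlinarith
  have key := adm_layer m (by omega) β hβ0 hβ θ hθ f hfc hf0 s0 C0 (by positivity) hfi (by
    intro E1 E2 hE1 hE2 t1 t2 a1 a2 p1 p2 q1 q2 v1 v2 n1 n2 w1 w2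
    have hlow : ∀ t x, 0 ≤ t → t < f x → √(t/A) ≤ |u x| := by
      intro t x ht hx
      apply Real.sqrt_le_iff.2 ⟨abs_nonneg _, ?_⟩
      rw [sq_abs, div_le_iff₀ hA0, mul_comm]
      exact hx.le
    have := adm_two m K hmK σ hσ u hu hL hG hN E1 E2 hE1 hE2 a1 a2 p1 p2 q1 q2 v1 v2 (√(t1/A)) (√(t2/A))
      (Real.sqrt_nonneg _) (Real.sqrt_nonneg _) (fun x hx => hlow _ _ n1 (w1 x hx)) (fun x hx => hlow _ _ n2 (w2 x hx))
    refine le_trans (le_of_eq ?_) this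
    rw [Real.sqrt_div n1, Real.sqrt_div n2, ← add_div, div_pow, Real.sq_sqrt hA0.le, ← hA]
    field_simp)
  have hnn : ∀ x, 0 ≤ (Real.exp (α * (u x) ^ 2) - 1) / ‖x‖ ^ β := by
    intro x
    apply div_nonneg _ (by positivity)
    rw [sub_nonneg]
    exact Real.one_le_exp (by positivity)
  rw [integral_eq_lintegral_of_nonneg_ae (Eventually.of_forall hnn)]
  · apply ENNReal.toReal_mono hDt
    refine le_trans ?_ key
    apply lintegral_mono
    intro x
    unfold ww
    dsimp only
    rw [← ENNReal.ofReal_mul (by positivity)]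
    apply ENNReal.ofReal_le_ofReal
    rw [Real.rpow_neg (norm_nonneg _), div_eq_inv_mul]
    have : α * (u x)^2 ≤ θ * f x := by
      rw [hf]
      nlinarith [sq_nonneg (u x)]
    gcongr
  · apply Measurable.aestronglyMeasurable
    have q : Continuous fun x => Real.exp (α * (u x) ^ 2) - 1 := by
      have := hu.continuous
      fun_prop
    exact q.measurable.div (measurable_norm.pow_const _)
end
end

section
/- Let m ≥ 2 be an even integer, let 0 ≤ β < 2m, let p > 2, and suppose the continuous coefficients a_γ satisfy (A1). Then there exists a constant C > 0 such that for every smooth compactly supported u : ℝ^{2m} → ℝ, ∫_{ℝ^{2m}} |u|^p/|x|^β dx ≤ C · ‖u‖_E^p. Equivalently, the constant S_p := inf{ ‖u‖_E / (∫_{ℝ^{2m}} |u|^p/|x|^β dx)^{1/p} } over nonzero u is strictly positive. -/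
open MeasureTheory Real Filter Topology

noncomputable section

open scoped FourierTransform SchwartzMap Laplacian LineDeriv
open SchwartzMap

lemma fourier_lap_norm {n : ℕ} (f : 𝓢(Euc n, ℂ)) (ξ : Euc n) :
    ‖𝓕 (Δ f) ξ‖ = (2 * π * ‖ξ‖) ^ 2 * ‖𝓕 f ξ‖ := by
  rw [SchwartzMap.laplacian_eq_fourierMultiplierCLM, SchwartzMap.fourierMultiplierCLM_apply,
    ← FourierTransform.fourierInv_smul, FourierTransform.fourier_fourierInv_eq]
  rw [smul_apply, SchwartzMap.smulLeftCLM_apply_apply (by fun_prop)]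
  simp [abs_of_pos Real.pi_pos]
  ring

def lapS {n : ℕ} (f : 𝓢(Euc n, ℂ)) (k : ℕ) : 𝓢(Euc n, ℂ) := (fun g : 𝓢(Euc n, ℂ) => Δ g)^[k] f

lemma fourier_lapS_norm {n : ℕ} (f : 𝓢(Euc n, ℂ)) (k : ℕ) (ξ : Euc n) :
    ‖𝓕 (lapS f k) ξ‖ = (2 * π * ‖ξ‖) ^ (2 * k) * ‖𝓕 f ξ‖ := by
  induction k with
  | zero => simp [lapS]
  | succ k ih =>
    have : lapS f (k+1) = Δ (lapS f k) := by
      simp only [lapS, Function.iterate_succ_apply']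
    rw [this, fourier_lap_norm, ih]; ring

lemma schw_sq_int {n : ℕ} (f : 𝓢(Euc n, ℂ)) : Integrable (fun x => ‖f x‖ ^ 2) := by
  have h := (f.memLp 2 (volume : Measure (Euc n)))
  exact (memLp_two_iff_integrable_sq_norm h.1).1 h

def AA {n : ℕ} (f : 𝓢(Euc n, ℂ)) : ℝ := ∫ ξ, ‖𝓕 f ξ‖ ^ 2 * (1 + ‖ξ‖) ^ n

lemma AA_int {n : ℕ} (f : 𝓢(Euc n, ℂ)) : Integrable (fun ξ => ‖f ξ‖ ^ 2 * (1 + ‖ξ‖) ^ n) := by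
  have h1 : Integrable (fun ξ => 2 ^ n * (‖f ξ‖ + ‖ξ‖ ^ n * ‖f ξ‖)) :=
    ((f.integrable.norm).add (f.integrable_pow_mul volume n)).const_mul _
  obtain ⟨C, hC⟩ := f.decay 0 0
  have hb : ∀ x, ‖f x‖ ≤ C := by simpa using hC.2
  refine (h1.const_mul C).mono' (by
    apply Continuous.aestronglyMeasurable
    have := f.continuous
    fun_prop) (Eventually.of_forall fun ξ => ?_)
  rw [Real.norm_of_nonneg (by positivity)]
  have h2 : (1 + ‖ξ‖) ^ n ≤ 2 ^ n * (1 + ‖ξ‖ ^ n) := by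
    have := add_pow_le (zero_le_one) (norm_nonneg ξ) n
    simp only [one_pow] at this
    refine this.trans ?_
    gcongr
    · norm_num
    · omega
  calc ‖f ξ‖ ^ 2 * (1 + ‖ξ‖) ^ n ≤ (C * ‖f ξ‖) * (2 ^ n * (1 + ‖ξ‖ ^ n)) := by
        rw [sq]
        exact mul_le_mul (mul_le_mul_of_nonneg_right (hb ξ) (norm_nonneg _)) h2 (by positivity)
          (mul_nonneg ((norm_nonneg _).trans (hb ξ)) (norm_nonneg _))
    _ = _ := by ring

lemma AA_le {n k : ℕ} (hn : n = 4 * k) (f : 𝓢(Euc n, ℂ)) :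
    AA f ≤ 2 ^ n * ((∫ x, ‖f x‖ ^ 2) + ∫ x, ‖lapS f k x‖ ^ 2) := by
  rw [← SchwartzMap.integral_norm_sq_fourier f, ← SchwartzMap.integral_norm_sq_fourier (lapS f k),
    ← integral_add (schw_sq_int _) (schw_sq_int _), ← integral_const_mul]
  refine integral_mono (AA_int _) (((schw_sq_int _).add (schw_sq_int _)).const_mul _) fun ξ => ?_
  simp only [fourier_lapS_norm, mul_pow _ ‖𝓕 f ξ‖]
  have h2 : (1 + ‖ξ‖) ^ n ≤ 2 ^ n * (1 + ‖ξ‖ ^ n) := by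
    have := add_pow_le (zero_le_one) (norm_nonneg ξ) n
    simp only [one_pow] at this
    refine this.trans ?_
    gcongr
    · norm_num
    · omega
  have h3 : ‖ξ‖ ^ n ≤ ((2 * π * ‖ξ‖) ^ (2 * k)) ^ 2 := by
    rw [← pow_mul, show 2 * k * 2 = n by omega]
    gcongr
    have := Real.pi_gt_three
    nlinarith [norm_nonneg ξ]
  calc ‖𝓕 f ξ‖ ^ 2 * (1 + ‖ξ‖) ^ n ≤ ‖𝓕 f ξ‖ ^ 2 * (2 ^ n * (1 + ((2 * π * ‖ξ‖) ^ (2 * k)) ^ 2)) := by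
        gcongr; exact h2.trans (by gcongr)
    _ = _ := by ring

lemma AA_smul {n : ℕ} (f : 𝓢(Euc n, ℂ)) (c : ℝ) : AA (c • f) = c ^ 2 * AA f := by
  unfold AA
  rw [← integral_const_mul]
  congr 1; ext ξ
  rw [FourierTransform.fourier_smul, smul_apply, norm_smul, Real.norm_eq_abs, mul_pow, sq_abs]
  ring

lemma chebyshev {n : ℕ} (f : 𝓢(Euc n, ℂ)) {t M : ℝ} (ht : 0 < t) (hM : ∫ x, ‖f x‖ ^ 2 ≤ M) :
    volume {x | t < ‖f x‖} ≤ ENNReal.ofReal (M / t ^ 2) := by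
  have h := mul_meas_ge_le_integral_of_nonneg (μ := volume) (f := fun x => ‖f x‖ ^ 2)
    (Eventually.of_forall fun x => by positivity) (schw_sq_int f) (t ^ 2)
  have hfin : volume {x | t ^ 2 ≤ ‖f x‖ ^ 2} ≠ ⊤ := by
    have := (schw_sq_int f).measure_ge_lt_top (ε := t ^ 2) (by positivity)
    exact this.ne
  calc volume {x | t < ‖f x‖} ≤ volume {x | t ^ 2 ≤ ‖f x‖ ^ 2} := by
        apply measure_mono; intro x (hx : t < _)
        show t ^ 2 ≤ _
        gcongr
    _ = ENNReal.ofReal (volume.real {x | t ^ 2 ≤ ‖f x‖ ^ 2}) := by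
        rw [measureReal_def, ENNReal.ofReal_toReal hfin]
    _ ≤ _ := by
        apply ENNReal.ofReal_le_ofReal
        rw [le_div_iff₀ (by positivity)]; linarith

lemma sq_le_AA {n : ℕ} (f : 𝓢(Euc n, ℂ)) : ∫ x, ‖f x‖ ^ 2 ≤ AA f := by
  rw [← SchwartzMap.integral_norm_sq_fourier f]
  refine integral_mono (schw_sq_int _) (AA_int _) fun ξ => ?_
  have : 1 ≤ (1 + ‖ξ‖) ^ n := one_le_pow₀ (by linarith [norm_nonneg ξ])
  simp only
  nlinarith [sq_nonneg ‖𝓕 f ξ‖]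

lemma fsup_le {n : ℕ} (g : 𝓢(Euc n, ℂ)) (x : Euc n) : ‖𝓕⁻ g x‖ ≤ ∫ ξ, ‖g ξ‖ := by
  rw [SchwartzMap.fourierInv_coe, Real.fourierInv_eq]
  refine (norm_integral_le_integral_norm _).trans_eq ?_
  congr 1; ext ξ; simp

lemma weak_large {n : ℕ} (hn : 0 < n) {K : ℝ} (hK : 0 < K) :
    ∃ C L : ℝ, 0 < C ∧ 1 ≤ L ∧ ∀ f : 𝓢(Euc n, ℂ), AA f ≤ 1 → ∀ t : ℝ, L ≤ t →
      volume {x | t < ‖f x‖} ≤ ENNReal.ofReal (C * t ^ (-K)) := by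
  have hn' : (0:ℝ) < n := by exact_mod_cast hn
  set ε : ℝ := 2 * n / K with hε
  have hε0 : 0 < ε := by positivity
  have hint : Integrable (fun ξ : Euc n => (1 + ‖ξ‖) ^ (-(n + ε))) :=
    integrable_one_add_norm (by simp; exact hε0)
  set C0 : ℝ := ∫ ξ : Euc n, (1 + ‖ξ‖) ^ (-(n + ε)) with hC0
  have hC00 : 0 ≤ C0 := integral_nonneg fun ξ => by positivity
  set C1 : ℝ := C0 + 1 with hC1
  have hC10 : 0 < C1 := by positivity
  refine ⟨4 * 2 ^ n * (4 * C1) ^ (n / ε), 4 * C1 + 1, by positivity, by linarith, ?_⟩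
  intro f hf t ht
  have ht1 : 1 ≤ t := by linarith
  have ht0 : 0 < t := by linarith
  set Q : ℝ := (t ^ 2 / (4 * C1)) ^ (1 / ε) with hQ
  have hbase : 1 < t ^ 2 / (4 * C1) := by
    rw [lt_div_iff₀ (by positivity)]; nlinarith
  have hQ1 : 1 < Q := Real.one_lt_rpow hbase (by positivity)
  have hQε : Q ^ ε = t ^ 2 / (4 * C1) := by
    rw [hQ, ← Real.rpow_mul (by positivity), one_div_mul_cancel hε0.ne', Real.rpow_one]
  set R : ℝ := (Q - 1) / 2 with hR
  have hR0 : 0 < R := by linarith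
  let χ : ContDiffBump (0 : Euc n) := ⟨R, 2 * R, hR0, by linarith⟩
  have hχ : Function.HasTemperateGrowth (χ : Euc n → ℝ) :=
    χ.hasCompactSupport.hasTemperateGrowth χ.contDiff
  set gl : 𝓢(Euc n, ℂ) := smulLeftCLM ℂ (χ : Euc n → ℝ) (𝓕 f) with hgl
  have hgl_apply : ∀ ξ, gl ξ = χ ξ • 𝓕 f ξ := fun ξ => smulLeftCLM_apply_apply hχ _ _
  -- low part
  have hlow : ∀ x, ‖𝓕⁻ gl x‖ ≤ t / 2 := by
    intro x
    refine (fsup_le gl x).trans ?_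
    have hpt : ∀ ξ, ‖gl ξ‖ ≤ (t / 4) * (‖𝓕 f ξ‖ ^ 2 * (1 + ‖ξ‖) ^ n)
        + (Q ^ ε / t) * (1 + ‖ξ‖) ^ (-(n + ε)) := by
      intro ξ
      rw [hgl_apply, norm_smul, Real.norm_of_nonneg χ.nonneg]
      have hpos : 0 < 1 + ‖ξ‖ := by positivity
      by_cases hξ : ‖ξ‖ < 2 * R
      · have h1 : χ ξ ≤ 1 := χ.le_one
        have h2 : ((1 + ‖ξ‖) ^ n)⁻¹ ≤ Q ^ ε * (1 + ‖ξ‖) ^ (-(n + ε)) := by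
          rw [neg_add, Real.rpow_add hpos, Real.rpow_neg hpos.le, Real.rpow_natCast,
            Real.rpow_neg hpos.le]
          have : (1 + ‖ξ‖) ^ ε ≤ Q ^ ε := by
            apply Real.rpow_le_rpow hpos.le _ hε0.le
            linarith
          have h3 : 1 ≤ Q ^ ε * ((1 + ‖ξ‖) ^ ε)⁻¹ := by
            rw [← div_eq_mul_inv, one_le_div (by positivity)]; exact this
          calc ((1 + ‖ξ‖) ^ n)⁻¹ = ((1 + ‖ξ‖) ^ n)⁻¹ * 1 := by ring
            _ ≤ ((1 + ‖ξ‖) ^ n)⁻¹ * (Q ^ ε * ((1 + ‖ξ‖) ^ ε)⁻¹) := by gcongr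
            _ = _ := by ring
        have h4 : χ ξ * ‖𝓕 f ξ‖ ≤ ‖𝓕 f ξ‖ := mul_le_of_le_one_left (norm_nonneg _) h1
        refine h4.trans ?_
        have h5 : ‖𝓕 f ξ‖ ≤ (t / 4) * (‖𝓕 f ξ‖ ^ 2 * (1 + ‖ξ‖) ^ n) + (1 / t) * ((1 + ‖ξ‖) ^ n)⁻¹ := by
          set y := ‖𝓕 f ξ‖
          set w := (1 + ‖ξ‖) ^ n
          have hw : 0 < w := by positivity
          have : (t / 4) * (y ^ 2 * w) + (1 / t) * w⁻¹ - y = (t * w * y - 2) ^ 2 / (4 * t * w) := by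
            field_simp; ring
          have h6 : 0 ≤ (t * w * y - 2) ^ 2 / (4 * t * w) := by positivity
          linarith
        refine h5.trans ?_
        have : (1 / t) * ((1 + ‖ξ‖) ^ n)⁻¹ ≤ (1 / t) * (Q ^ ε * (1 + ‖ξ‖) ^ (-(n + ε))) := by gcongr
        calc _ ≤ (t / 4) * (‖𝓕 f ξ‖ ^ 2 * (1 + ‖ξ‖) ^ n) + (1 / t) * (Q ^ ε * (1 + ‖ξ‖) ^ (-(n + ε))) := by
              gcongr
          _ = _ := by ring
      · have : χ ξ = 0 := χ.zero_of_le_dist (by simpa [χ] using not_lt.1 hξ)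
        rw [this, zero_mul]; positivity
    calc ∫ ξ, ‖gl ξ‖ ≤ ∫ ξ, ((t / 4) * (‖𝓕 f ξ‖ ^ 2 * (1 + ‖ξ‖) ^ n)
        + (Q ^ ε / t) * (1 + ‖ξ‖) ^ (-(n + ε))) :=
          integral_mono gl.integrable.norm (((AA_int _).const_mul _).add (hint.const_mul _)) hpt
      _ = (t / 4) * AA f + (Q ^ ε / t) * C0 := by
          rw [integral_add ((AA_int _).const_mul _) (hint.const_mul _), integral_const_mul,
            integral_const_mul]; rfl
      _ ≤ (t / 4) * 1 + (Q ^ ε / t) * C1 := by gcongr; linarith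
      _ = t / 2 := by rw [hQε]; field_simp; ring
  -- high part
  set h : 𝓢(Euc n, ℂ) := f - 𝓕⁻ gl with hh
  have hFh : ∀ ξ, 𝓕 h ξ = (1 - χ ξ) • 𝓕 f ξ := by
    intro ξ
    rw [hh, sub_eq_add_neg, FourierTransform.fourier_add, FourierTransform.fourier_neg,
      FourierTransform.fourier_fourierInv_eq, ← sub_eq_add_neg, sub_apply, hgl_apply,
      sub_smul, one_smul]
  have hhi : ∫ x, ‖h x‖ ^ 2 ≤ 2 ^ n * (Q ^ n)⁻¹ := by
    rw [← SchwartzMap.integral_norm_sq_fourier h]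
    calc ∫ ξ, ‖𝓕 h ξ‖ ^ 2 ≤ ∫ ξ, (2 ^ n * (Q ^ n)⁻¹) * (‖𝓕 f ξ‖ ^ 2 * (1 + ‖ξ‖) ^ n) := by
          refine integral_mono (schw_sq_int _) ((AA_int _).const_mul _) fun ξ => ?_
          simp only [hFh, norm_smul, mul_pow]
          have h1 : χ ξ ≤ 1 := χ.le_one
          rw [Real.norm_of_nonneg (by linarith)]
          by_cases hξ : ‖ξ‖ ≤ R
          · have : χ ξ = 1 := χ.one_of_mem_closedBall (by simpa [χ] using hξ)
            rw [this]; simp; positivity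
          · have h2 : Q ^ n ≤ 2 ^ n * (1 + ‖ξ‖) ^ n := by
              rw [← mul_pow]; gcongr; linarith
            have h3 : (1 - χ ξ) ^ 2 ≤ 1 := pow_le_one₀ (by linarith) (by linarith [χ.nonneg (x := ξ)])
            have h4 : 1 ≤ (2 ^ n * (1 + ‖ξ‖) ^ n) / Q ^ n := by
              rw [one_le_div (by positivity)]; exact h2
            calc (1 - χ ξ) ^ 2 * ‖𝓕 f ξ‖ ^ 2 ≤ ((2 ^ n * (1 + ‖ξ‖) ^ n) / Q ^ n) * ‖𝓕 f ξ‖ ^ 2 := by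
                  gcongr; exact h3.trans h4
              _ = _ := by ring
      _ = (2 ^ n * (Q ^ n)⁻¹) * AA f := integral_const_mul _ _
      _ ≤ _ := mul_le_of_le_one_right (by positivity) hf
  have hQn : (Q ^ n)⁻¹ = (4 * C1) ^ (n / ε) * t ^ (-K) := by
    rw [← Real.rpow_natCast, hQ, ← Real.rpow_mul (by positivity), Real.div_rpow (by positivity) (by positivity),
      inv_div, show (1 / ε * n) = n / ε by ring, ← Real.rpow_natCast t 2, ← Real.rpow_mul ht0.le,
      Real.rpow_neg ht0.le, div_eq_mul_inv]
    congr 3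
    rw [hε]; push_cast; field_simp
  calc volume {x | t < ‖f x‖} ≤ volume {x | t / 2 < ‖h x‖} := by
        apply measure_mono
        intro x (hx : t < _)
        show t / 2 < _
        have : ‖f x‖ ≤ ‖h x‖ + ‖𝓕⁻ gl x‖ := by
          have : f x = h x + 𝓕⁻ gl x := by rw [hh, sub_apply]; ring
          rw [this]; exact norm_add_le _ _
        linarith [hlow x]
    _ ≤ ENNReal.ofReal (2 ^ n * (Q ^ n)⁻¹ / (t / 2) ^ 2) := chebyshev h (by positivity) hhi
    _ ≤ _ := by
        apply ENNReal.ofReal_le_ofReal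
        rw [hQn, div_le_iff₀ (by positivity)]
        have hX : 0 ≤ 2 ^ n * (4 * C1) ^ (n / ε) * t ^ (-K) := by positivity
        have : 1 ≤ t ^ 2 := one_le_pow₀ ht1
        nlinarith

def wgt (n : ℕ) (β : ℝ) : Euc n → ENNReal := fun x => ENNReal.ofReal (‖x‖ ^ (-β))

lemma wgt_meas (n : ℕ) (β : ℝ) : Measurable (wgt n β) := by
  unfold wgt; fun_prop

lemma wgt_bound {n : ℕ} (hn : 0 < n) {β : ℝ} (hβ0 : 0 ≤ β) (hβ : β < n) :
    ∃ s D : ℝ, 1 < s ∧ 0 ≤ D ∧ ∀ T : ℝ, 1 ≤ T → ∀ A : Set (Euc n), MeasurableSet A →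
      (volume.withDensity (wgt n β)) A ≤ ENNReal.ofReal (2 * T) * volume A
        + ENNReal.ofReal (T ^ (1 - s) * D) := by
  have hn' : (0:ℝ) < n := by exact_mod_cast hn
  set s : ℝ := 1 + (n - β) / (2 * n) with hs
  have hs1 : 1 < s := by
    have : 0 < (n - β) / (2 * n) := div_pos (by linarith) (by positivity)
    linarith
  have hβs : β * s < n := by
    have h1 : β * ((n - β) / (2 * n)) ≤ (n - β) / 2 := by
      rw [← mul_div_assoc, div_le_div_iff₀ (by positivity) (by positivity)]
      nlinarith [mul_nonneg (sub_nonneg.2 hβ.le) (sub_nonneg.2 hβ.le)]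
    rw [hs]; linarith
  have hint : IntegrableOn (fun x : Euc n => ‖x‖ ^ (-(β * s))) (Metric.ball 0 1) volume := by
    refine integrableOn_ball_of_norm_le_rpow (C := 1) (α := β * s) (by simp; omega) (by simpa using hβs) ?_ ?_
    · refine Eventually.of_forall fun x => ?_
      rw [Real.norm_of_nonneg (by positivity), one_mul]
    · apply Measurable.aestronglyMeasurable; fun_prop
  set D : ℝ := ∫ x in Metric.ball (0 : Euc n) 1, ‖x‖ ^ (-(β * s)) with hD
  have hD0 : 0 ≤ D := integral_nonneg fun x => by positivity
  have hDl : ∫⁻ x in Metric.ball (0 : Euc n) 1, ENNReal.ofReal (‖x‖ ^ (-(β * s))) = ENNReal.ofReal D := by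
    rw [hD, ofReal_integral_eq_lintegral_ofReal hint (Eventually.of_forall fun x => by positivity)]
  refine ⟨s, D, hs1, hD0, fun T hT A hA => ?_⟩
  have hT0 : 0 < T := by linarith
  rw [withDensity_apply _ hA]
  have hpt : ∀ x : Euc n, wgt n β x ≤ ENNReal.ofReal (2 * T) + (Metric.ball (0 : Euc n) 1).indicator
      (fun x => ENNReal.ofReal (T ^ (1 - s)) * ENNReal.ofReal (‖x‖ ^ (-(β * s)))) x := by
    intro x
    by_cases hx : x ∈ Metric.ball (0 : Euc n) 1
    · rw [Set.indicator_of_mem hx, ← ENNReal.ofReal_mul (by positivity),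
        ← ENNReal.ofReal_add (by positivity) (by positivity)]
      apply ENNReal.ofReal_le_ofReal
      set w := ‖x‖ ^ (-β) with hw
      have hw0 : 0 ≤ w := by positivity
      have hws : ‖x‖ ^ (-(β * s)) = w ^ s := by
        rw [hw, ← Real.rpow_mul (norm_nonneg _)]; ring_nf
      rw [hws]
      by_cases hwT : w ≤ T
      · have : 0 ≤ T ^ (1 - s) * w ^ s := by positivity
        linarith
      · push Not at hwT
        have hwp : 0 < w := by linarith
        have : w ≤ T ^ (1 - s) * w ^ s := by
          have h1 : w ^ (1 - s) ≤ T ^ (1 - s) := Real.rpow_le_rpow_of_nonpos hT0 hwT.le (by linarith)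
          calc w = w ^ (1 - s) * w ^ s := by rw [← Real.rpow_add hwp]; simp
            _ ≤ _ := by gcongr
        linarith
    · rw [Set.indicator_of_notMem hx, add_zero]
      apply ENNReal.ofReal_le_ofReal
      have h1 : 1 ≤ ‖x‖ := by simpa using hx
      have := Real.rpow_le_one_of_one_le_of_nonpos h1 (by linarith : -β ≤ 0)
      linarith
  calc ∫⁻ x in A, wgt n β x ≤ ∫⁻ x in A, (ENNReal.ofReal (2 * T) + (Metric.ball (0 : Euc n) 1).indicator
      (fun x => ENNReal.ofReal (T ^ (1 - s)) * ENNReal.ofReal (‖x‖ ^ (-(β * s)))) x) := lintegral_mono hpt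
    _ = ENNReal.ofReal (2 * T) * volume A + ∫⁻ x in A, (Metric.ball (0 : Euc n) 1).indicator
      (fun x => ENNReal.ofReal (T ^ (1 - s)) * ENNReal.ofReal (‖x‖ ^ (-(β * s)))) x := by
        rw [lintegral_add_left measurable_const, setLIntegral_const]
    _ ≤ ENNReal.ofReal (2 * T) * volume A + ∫⁻ x, (Metric.ball (0 : Euc n) 1).indicator
      (fun x => ENNReal.ofReal (T ^ (1 - s)) * ENNReal.ofReal (‖x‖ ^ (-(β * s)))) x := by
        gcongr; exact Measure.restrict_le_self
    _ = _ := by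
        rw [lintegral_indicator measurableSet_ball, lintegral_const_mul _ (by fun_prop), hDl,
          ← ENNReal.ofReal_mul (by positivity)]

lemma layer {n : ℕ} (hn : 0 < n) {β : ℝ} (hβ0 : 0 ≤ β) (hβ : β < n) {p : ℝ} (hp : 2 < p) :
    ∃ C : ℝ, 0 < C ∧ ∀ f : 𝓢(Euc n, ℂ), AA f ≤ 1 →
      ∫⁻ x, ENNReal.ofReal (‖f x‖ ^ p) ∂(volume.withDensity (wgt n β)) ≤ ENNReal.ofReal C := by
  obtain ⟨s, D, hs, hD, hν⟩ := wgt_bound hn hβ0 hβ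
  set b : ℝ := (p + 1) / (s - 1) with hb
  have hb0 : 0 < b := div_pos (by linarith) (by linarith)
  obtain ⟨C, L, hC, hL, hw⟩ := weak_large hn (K := b + p + 1) (by linarith)
  have hL0 : 0 < L := by linarith
  have i1 : IntegrableOn (fun t : ℝ => 2 * t ^ (p - 3) + D * t ^ (p - 1)) (Set.Ioc 0 L) := by
    have h1 := (intervalIntegral.intervalIntegrable_rpow' (a := 0) (b := L) (r := p - 3) (by linarith)).1
    have h2 := (intervalIntegral.intervalIntegrable_rpow' (a := 0) (b := L) (r := p - 1) (by linarith)).1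
    exact (h1.const_mul 2).add (h2.const_mul D)
  have i2 : IntegrableOn (fun t : ℝ => (2 * C + D) * t ^ (-2 : ℝ)) (Set.Ioi L) :=
    (integrableOn_Ioi_rpow_of_lt (by norm_num) hL0).const_mul _
  set I1 := ∫ t in Set.Ioc 0 L, (2 * t ^ (p - 3) + D * t ^ (p - 1)) with hI1
  set I2 := ∫ t in Set.Ioi L, (2 * C + D) * t ^ (-2 : ℝ) with hI2
  have hI1n : 0 ≤ I1 := setIntegral_nonneg measurableSet_Ioc fun t ht => by
    have : 0 < t := ht.1
    positivity
  have hI2n : 0 ≤ I2 := setIntegral_nonneg measurableSet_Ioi fun t ht => by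
    have : 0 < t := hL0.trans ht
    positivity
  refine ⟨p * (I1 + I2) + 1, by positivity, fun f hf => ?_⟩
  rw [lintegral_rpow_eq_lintegral_meas_lt_mul _ (Eventually.of_forall fun x => norm_nonneg _)
    f.continuous.norm.measurable.aemeasurable (by linarith)]
  have hms : ∀ t : ℝ, MeasurableSet {x | t < ‖f x‖} := fun t =>
    measurableSet_lt measurable_const f.continuous.norm.measurable
  have e1 : ∫⁻ t in Set.Ioc 0 L, (volume.withDensity (wgt n β)) {a | t < ‖f a‖} * ENNReal.ofReal (t ^ (p - 1))
      ≤ ENNReal.ofReal I1 := by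
    rw [hI1, ofReal_integral_eq_lintegral_ofReal i1 ((ae_restrict_iff' measurableSet_Ioc).2 (Eventually.of_forall fun t ht => by
      have : 0 < t := ht.1
      simp only [Pi.zero_apply]
      positivity))]
    refine setLIntegral_mono' measurableSet_Ioc fun t ht => ?_
    have ht0 : 0 < t := ht.1
    have h1 := hν 1 le_rfl _ (hms t)
    have h2 := chebyshev f ht0 ((sq_le_AA f).trans hf)
    calc _ ≤ (ENNReal.ofReal (2 * 1) * ENNReal.ofReal (1 / t ^ 2) + ENNReal.ofReal (1 ^ (1 - s) * D)) *
          ENNReal.ofReal (t ^ (p - 1)) := by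
            gcongr; refine h1.trans ?_; gcongr
      _ = ENNReal.ofReal ((2 * 1 * (1 / t ^ 2) + 1 ^ (1 - s) * D) * t ^ (p - 1)) := by
          rw [← ENNReal.ofReal_mul (by positivity), ← ENNReal.ofReal_add (by positivity) (by positivity),
            ← ENNReal.ofReal_mul (by positivity)]
      _ = _ := by
          congr 1
          have : t ^ (p - 1) = t ^ 2 * t ^ (p - 3) := by
            rw [← Real.rpow_natCast t 2, ← Real.rpow_add ht0]; congr 1; push_cast; ring
          rw [Real.one_rpow, add_mul, this]; field_simp
  have e2 : ∫⁻ t in Set.Ioi L, (volume.withDensity (wgt n β)) {a | t < ‖f a‖} * ENNReal.ofReal (t ^ (p - 1))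
      ≤ ENNReal.ofReal I2 := by
    rw [hI2, ofReal_integral_eq_lintegral_ofReal i2 ((ae_restrict_iff' measurableSet_Ioi).2 (Eventually.of_forall fun t ht => by
      have : 0 < t := hL0.trans ht
      simp only [Pi.zero_apply]
      positivity))]
    refine setLIntegral_mono' measurableSet_Ioi fun t ht => ?_
    have htL : L < t := ht
    have ht0 : 0 < t := hL0.trans ht
    have h1 := hν (t ^ b) (Real.one_le_rpow (by linarith) hb0.le) _ (hms t)
    have h2 := hw f hf t htL.le
    calc _ ≤ (ENNReal.ofReal (2 * t ^ b) * ENNReal.ofReal (C * t ^ (-(b + p + 1))) + ENNReal.ofReal ((t ^ b) ^ (1 - s) * D)) *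
          ENNReal.ofReal (t ^ (p - 1)) := by
            gcongr; refine h1.trans ?_; gcongr
      _ = ENNReal.ofReal ((2 * t ^ b * (C * t ^ (-(b + p + 1))) + (t ^ b) ^ (1 - s) * D) * t ^ (p - 1)) := by
          rw [← ENNReal.ofReal_mul (by positivity), ← ENNReal.ofReal_add (by positivity) (by positivity),
            ← ENNReal.ofReal_mul (by positivity)]
      _ = _ := by
          congr 1
          have h3 : (t ^ b) ^ (1 - s) = t ^ (-(p + 1)) := by
            rw [← Real.rpow_mul ht0.le, hb]; congr 1
            have : s - 1 ≠ 0 := by linarith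
            field_simp; ring
          have h4 : t ^ b * t ^ (-(b + p + 1)) = t ^ (-(p + 1)) := by
            rw [← Real.rpow_add ht0]; congr 1; ring
          have h5 : t ^ (-(p + 1)) * t ^ (p - 1) = t ^ (-2 : ℝ) := by
            rw [← Real.rpow_add ht0]; congr 1; ring
          rw [h3, ← h5, ← h4]; ring
  rw [← Set.Ioc_union_Ioi_eq_Ioi hL0.le]
  calc _ ≤ ENNReal.ofReal p * (ENNReal.ofReal I1 + ENNReal.ofReal I2) := by
        gcongr
        exact (lintegral_union_le _ _ _).trans (add_le_add e1 e2)
    _ = ENNReal.ofReal (p * (I1 + I2)) := by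
        rw [← ENNReal.ofReal_add hI1n hI2n, ← ENNReal.ofReal_mul (by linarith)]
    _ ≤ _ := ENNReal.ofReal_le_ofReal (by linarith)

lemma layer_scaled {n : ℕ} (hn : 0 < n) {β : ℝ} (hβ0 : 0 ≤ β) (hβ : β < n) {p : ℝ} (hp : 2 < p) :
    ∃ C : ℝ, 0 < C ∧ ∀ f : 𝓢(Euc n, ℂ), ∀ J : ℝ, AA f ≤ J →
      (∫ x, ‖f x‖ ^ p / ‖x‖ ^ β) ≤ C * √J ^ p := by
  obtain ⟨C, hC, h⟩ := layer hn hβ0 hβ hp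
  refine ⟨C, hC, fun f J hJ => ?_⟩
  have key : ∀ r : ℝ, √J < r → (∫ x, ‖f x‖ ^ p / ‖x‖ ^ β) ≤ C * r ^ p := by
    intro r hr
    have hr0 : 0 < r := (Real.sqrt_nonneg _).trans_lt hr
    have h1 : AA (r⁻¹ • f) ≤ 1 := by
      rw [AA_smul, inv_pow, inv_mul_le_iff₀ (by positivity), mul_one]
      exact hJ.trans ((Real.sqrt_le_left hr0.le).1 hr.le)
    have h2 := h _ h1
    rw [lintegral_withDensity_eq_lintegral_mul _ (wgt_meas n β) (by
      have := (r⁻¹ • f).continuous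
      fun_prop)] at h2
    have h3 : ∀ x, (wgt n β * fun x => ENNReal.ofReal (‖(r⁻¹ • f) x‖ ^ p)) x
        = ENNReal.ofReal ((r ^ p)⁻¹) * ENNReal.ofReal (‖f x‖ ^ p / ‖x‖ ^ β) := by
      intro x
      rw [Pi.mul_apply, wgt, ← ENNReal.ofReal_mul (by positivity), ← ENNReal.ofReal_mul (by positivity)]
      congr 1
      rw [smul_apply, norm_smul, Real.mul_rpow (by positivity) (by positivity), Real.rpow_neg (by positivity),
        Real.norm_of_nonneg (by positivity), Real.inv_rpow hr0.le]
      ring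
    simp_rw [h3] at h2
    rw [lintegral_const_mul _ (by have := f.continuous; fun_prop)] at h2
    rw [integral_eq_lintegral_of_nonneg_ae (Eventually.of_forall fun x => by simp only [Pi.zero_apply]; positivity)
      (by apply Measurable.aestronglyMeasurable; have := f.continuous; fun_prop)]
    have h4 : ENNReal.ofReal (r ^ p) * (ENNReal.ofReal ((r ^ p)⁻¹) * ∫⁻ x, ENNReal.ofReal (‖f x‖ ^ p / ‖x‖ ^ β))
        ≤ ENNReal.ofReal (r ^ p) * ENNReal.ofReal C := by gcongr
    rw [← mul_assoc, ← ENNReal.ofReal_mul (by positivity), mul_inv_cancel₀ (by positivity), ENNReal.ofReal_one,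
      one_mul, ← ENNReal.ofReal_mul (by positivity)] at h4
    rw [mul_comm C]
    exact ENNReal.toReal_le_of_le_ofReal (by positivity) h4
  have hcont : Tendsto (fun r : ℝ => C * r ^ p) (𝓝[>] √J) (𝓝 (C * √J ^ p)) := by
    apply Tendsto.mono_left _ nhdsWithin_le_nhds
    apply Tendsto.const_mul
    exact (Real.continuousAt_rpow_const _ _ (Or.inr (by linarith))).tendsto
  exact ge_of_tendsto hcont (eventually_mem_nhdsWithin.mono fun r hr => key r hr)

lemma lap_smooth {n : ℕ} {v : Euc n → ℝ} (hv : ContDiff ℝ (⊤ : ℕ∞) v) : ContDiff ℝ (⊤ : ℕ∞) (lap n v) := by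
  unfold lap
  refine ContDiff.sum fun i _ => ?_
  have h1 : ContDiff ℝ (⊤ : ℕ∞) (fun y => fderiv ℝ v y (EuclideanSpace.single i 1)) :=
    (hv.fderiv_right (m := (⊤ : ℕ∞)) (by simp)).clm_apply contDiff_const
  exact (h1.fderiv_right (m := (⊤ : ℕ∞)) (by simp)).clm_apply contDiff_const

lemma lap_supp {n : ℕ} {v : Euc n → ℝ} (hv : HasCompactSupport v) : HasCompactSupport (lap n v) := by
  have h1 : ∀ i : Fin n, HasCompactSupport (fun y => fderiv ℝ v y (EuclideanSpace.single i 1)) :=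
    fun i => hv.fderiv_apply ℝ _
  have h2 : ∀ i : Fin n, HasCompactSupport (fun x => fderiv ℝ (fun y => fderiv ℝ v y (EuclideanSpace.single i 1)) x
    (EuclideanSpace.single i 1)) := fun i => (h1 i).fderiv_apply ℝ _
  refine hv.mono' ?_
  intro x hx
  by_contra hx'
  apply hx
  unfold lap
  refine Finset.sum_eq_zero fun i _ => ?_
  have e1 : tsupport (fun y => fderiv ℝ v y (EuclideanSpace.single i 1)) ⊆ tsupport v :=
    tsupport_fderiv_apply_subset ℝ _
  have e2 := (tsupport_fderiv_apply_subset ℝ (f := (fun y => fderiv ℝ v y (EuclideanSpace.single i 1))) (EuclideanSpace.single i 1)).trans e1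
  by_contra h0
  exact hx' (e2 (subset_tsupport _ h0))

lemma lapIter_smooth {n : ℕ} {v : Euc n → ℝ} (hv : ContDiff ℝ (⊤ : ℕ∞) v) (k : ℕ) :
    ContDiff ℝ (⊤ : ℕ∞) (lapIter n k v) := by
  induction k with
  | zero => exact hv
  | succ k ih => exact lap_smooth ih

lemma lapIter_supp {n : ℕ} {v : Euc n → ℝ} (hv : HasCompactSupport v) (k : ℕ) :
    HasCompactSupport (lapIter n k v) := by
  induction k with
  | zero => exact hv
  | succ k ih => exact lap_supp ih

lemma fderiv_ofReal {n : ℕ} {v : Euc n → ℝ} (hv : Differentiable ℝ v) (y e : Euc n) :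
    fderiv ℝ (fun x => (v x : ℂ)) y e = (fderiv ℝ v y e : ℂ) := by
  have := (Complex.ofRealCLM.hasFDerivAt.comp y (hv y).hasFDerivAt).fderiv
  have h2 : (fun x => (v x : ℂ)) = Complex.ofRealCLM ∘ v := rfl
  rw [h2, this]; simp

lemma lapS_eq {n : ℕ} {u : Euc n → ℝ} (hu : ContDiff ℝ (⊤ : ℕ∞) u) (f : 𝓢(Euc n, ℂ)) (hf : ∀ x, f x = (u x : ℂ))
    (k : ℕ) (x : Euc n) : lapS f k x = (lapIter n k u x : ℂ) := by
  induction k generalizing x with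
  | zero => exact hf x
  | succ k ih =>
    have : lapS f (k+1) = Δ (lapS f k) := by
      simp only [lapS, Function.iterate_succ_apply']
    have hv := lapIter_smooth hu k
    rw [this, SchwartzMap.laplacian_eq_sum (EuclideanSpace.basisFun (Fin n) ℝ), SchwartzMap.sum_apply]
    show _ = ((lap n (lapIter n k u) x : ℝ) : ℂ)
    unfold lap
    push_cast
    refine Finset.sum_congr rfl fun i _ => ?_
    have h1 : ContDiff ℝ (⊤ : ℕ∞) (fun y => fderiv ℝ (lapIter n k u) y (EuclideanSpace.single i 1)) :=
      (hv.fderiv_right (m := (⊤ : ℕ∞)) (by simp)).clm_apply contDiff_const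
    rw [EuclideanSpace.basisFun_apply, SchwartzMap.lineDerivOp_apply_eq_fderiv, 
      ← fderiv_ofReal (h1.differentiable (by simp))]
    congr 2
    ext y
    rw [SchwartzMap.lineDerivOp_apply_eq_fderiv, ← fderiv_ofReal (hv.differentiable (by simp))]
    congr 2
    ext z
    exact ih z

lemma grad_cont {n : ℕ} {v : Euc n → ℝ} (hv : ContDiff ℝ (⊤ : ℕ∞) v) (γ : ℕ) : Continuous (gradNormSq n γ v) := by
  unfold gradNormSq
  have h := lapIter_smooth hv (γ / 2)
  split_ifs
  · exact h.continuous.pow 2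
  · refine continuous_finset_sum _ fun i _ => ?_
    exact ((h.continuous_fderiv (by simp)).clm_apply continuous_const).pow 2

lemma grad_supp {n : ℕ} {v : Euc n → ℝ} (hv : HasCompactSupport v) (γ : ℕ) : HasCompactSupport (gradNormSq n γ v) := by
  have h := lapIter_supp hv (γ / 2)
  refine h.mono' ?_
  intro x hx
  by_contra hx'
  apply hx
  unfold gradNormSq
  have e0 : lapIter n (γ / 2) v x = 0 := image_eq_zero_of_notMem_tsupport hx'
  split_ifs
  · simp [e0]
  · refine Finset.sum_eq_zero fun i _ => ?_
    have : fderiv ℝ (lapIter n (γ / 2) v) x = 0 := by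
      by_contra h0
      exact hx' (tsupport_fderiv_subset ℝ (subset_tsupport _ h0))
    simp [this]

lemma grad_nonneg {n : ℕ} (v : Euc n → ℝ) (γ : ℕ) (x : Euc n) : 0 ≤ gradNormSq n γ v x := by
  unfold gradNormSq
  split_ifs
  · positivity
  · positivity

/-- Positivity of the best constant `S_p` of the singular Sobolev embedding:
`∫ |u|^p/|x|^β ≤ C ‖u‖_E^p`. -/
theorem singular_sobolev_constant_positive (m : ℕ) (hm : 2 ≤ m) (hme : Even m)
    (β : ℝ) (hβ0 : 0 ≤ β) (hβ : β < 2*m) (p : ℝ) (hp : 2 < p)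
    (a : ℕ → Euc (2*m) → ℝ) (hcont : ∀ γ < m, Continuous (a γ))
    (lb : ℕ → ℝ) (hA1 : ∀ γ < m, 0 < lb γ ∧ ∀ x, lb γ ≤ a γ x) :
    ∃ C : ℝ, 0 < C ∧ ∀ u : Euc (2*m) → ℝ, ContDiff ℝ (⊤ : ℕ∞) u → HasCompactSupport u →
      (∫ x, |u x| ^ p / ‖x‖ ^ β) ≤ C *
        Real.sqrt (∫ x, (gradNormSq (2*m) m u x +
          ∑ γ ∈ Finset.range m, a γ x * gradNormSq (2*m) γ u x)) ^ p := by
  obtain ⟨k, hk⟩ := hme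
  obtain ⟨C, hC, h⟩ := layer_scaled (n := 2 * m) (by omega) hβ0 (by push_cast; exact hβ) hp
  have hl0 := (hA1 0 (by omega)).1
  set B : ℝ := 2 ^ (2 * m) * (1 + (lb 0)⁻¹) with hB
  have hB0 : 0 < B := by positivity
  refine ⟨C * √B ^ p, by positivity, fun u hu hus => ?_⟩
  set I : ℝ := ∫ x, (gradNormSq (2*m) m u x +
          ∑ γ ∈ Finset.range m, a γ x * gradNormSq (2*m) γ u x) with hI
  let f : 𝓢(Euc (2 * m), ℂ) := HasCompactSupport.toSchwartzMap (f := fun x => (u x : ℂ))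
    (hus.comp_left (g := fun r : ℝ => (r : ℂ)) (by simp)) (Complex.ofRealCLM.contDiff.comp hu)
  have hf : ∀ x, f x = (u x : ℂ) := fun x => rfl
  have g0 : ∀ x, gradNormSq (2 * m) 0 u x = ‖f x‖ ^ 2 := by
    intro x; simp [gradNormSq, lapIter, hf]
  have gm : ∀ x, gradNormSq (2 * m) m u x = ‖lapS f k x‖ ^ 2 := by
    intro x
    have h1 : m % 2 = 0 := by omega
    have h2 : m / 2 = k := by omega
    rw [lapS_eq hu f hf]; simp [gradNormSq, h1, h2]
  have hint : ∀ γ, γ < m → Integrable (fun x => a γ x * gradNormSq (2*m) γ u x) := fun γ hγ =>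
    ((hcont γ hγ).mul (grad_cont hu γ)).integrable_of_hasCompactSupport ((grad_supp hus γ).mul_left)
  have hintm : Integrable (gradNormSq (2*m) m u) :=
    (grad_cont hu m).integrable_of_hasCompactSupport (grad_supp hus m)
  have hIge : (∫ x, ‖lapS f k x‖ ^ 2) + lb 0 * (∫ x, ‖f x‖ ^ 2) ≤ I := by
    rw [← integral_const_mul, ← integral_add (schw_sq_int _) ((schw_sq_int _).const_mul _)]
    refine integral_mono ((schw_sq_int _).add ((schw_sq_int _).const_mul _))
      (hintm.add (integrable_finset_sum _ fun γ hγ => hint γ (Finset.mem_range.1 hγ))) fun x => ?_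
    simp only [← g0, ← gm]
    gcongr
    calc lb 0 * gradNormSq (2 * m) 0 u x ≤ a 0 x * gradNormSq (2 * m) 0 u x := 
          mul_le_mul_of_nonneg_right ((hA1 0 (by omega)).2 x) (grad_nonneg _ _ _)
      _ ≤ _ := Finset.single_le_sum (f := fun γ => a γ x * gradNormSq (2*m) γ u x) (fun γ hγ => by
          have := hA1 γ (Finset.mem_range.1 hγ)
          exact mul_nonneg (this.1.le.trans (this.2 x)) (grad_nonneg _ _ _)) (Finset.mem_range.2 (by omega))
  have hAA : AA f ≤ B * I := by
    refine (AA_le (k := k) (by omega) f).trans ?_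
    rw [hB, mul_assoc]
    gcongr
    have h1 : 0 ≤ ∫ x, ‖lapS f k x‖ ^ 2 := integral_nonneg fun x => by positivity
    have h2 : 0 ≤ ∫ x, ‖f x‖ ^ 2 := integral_nonneg fun x => by positivity
    have h3 : (∫ x, ‖f x‖ ^ 2) ≤ (lb 0)⁻¹ * I := by
      rw [le_inv_mul_iff₀ hl0]; linarith
    have h4 : (∫ x, ‖lapS f k x‖ ^ 2) ≤ I := by nlinarith
    linarith
  have := h f _ hAA
  rw [Real.sqrt_mul hB0.le, Real.mul_rpow (Real.sqrt_nonneg _) (Real.sqrt_nonneg _), ← mul_assoc] at this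
  simpa [hf] using this
end
end

section
/- Let m ≥ 2 be an even integer, 0 ≤ β < 2m and α > 0. Let u : ℝ^{2m} → ℝ be a smooth function such that ∫_{ℝ^{2m}} Σ_{γ=0}^{m} |∇^γ u|² dx < ∞. Then ∫_{ℝ^{2m}} (e^{α u²} − 1)/|x|^β dx < ∞. (The key claim in the proof of Lemma 4.4: the exponential integral is finite for every individual function of finite W^{m,2}-norm, for every α > 0.) -/
open MeasureTheory Real Filter Topology

noncomputable section

theorem div_zero_aux {n : ℕ} (X : Fin n → Euc n → ℂ) (hX : ∀ i, ContDiff ℝ 1 (X i))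
    (hXi : ∀ i, Integrable (X i))
    (hd : Integrable (fun x => ∑ i, fderiv ℝ (X i) x (EuclideanSpace.single i 1))) :
    ∫ x, ∑ i, fderiv ℝ (X i) x (EuclideanSpace.single i 1) = 0 := by
  let χ : ContDiffBump (0 : Euc n) := ⟨1, 2, by norm_num, by norm_num⟩
  have hχs : ContDiff ℝ 1 (χ : Euc n → ℝ) := χ.contDiff
  have hχc : HasCompactSupport (χ : Euc n → ℝ) := χ.hasCompactSupport
  obtain ⟨C, hC⟩ : ∃ C, ∀ x, ‖fderiv ℝ (χ : Euc n → ℝ) x‖ ≤ C :=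
    (hχc.fderiv (𝕜 := ℝ)).exists_bound_of_continuous (hχs.continuous_fderiv (by norm_num))
  let c : ℕ → ℝ := fun N => ((N : ℝ) + 1)⁻¹
  have hc : ∀ N, 0 < c N := fun N => by positivity
  let ψ : ℕ → Euc n → ℝ := fun N x => χ (c N • x)
  have hψs : ∀ N, ContDiff ℝ 1 (ψ N) := fun N => hχs.comp (contDiff_const_smul (c N))
  have hψc : ∀ N, HasCompactSupport (ψ N) := fun N =>
    hχc.comp_homeomorph (Homeomorph.smulOfNeZero (c N) (hc N).ne')
  have hψd : ∀ N x, ‖fderiv ℝ (ψ N) x‖ ≤ c N * C := by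
    intro N x
    have h1 : HasFDerivAt (ψ N) ((fderiv ℝ χ (c N • x)).comp (c N • ContinuousLinearMap.id ℝ (Euc n))) x := by
      have h2 : HasFDerivAt (fun x : Euc n => c N • x) (c N • ContinuousLinearMap.id ℝ (Euc n)) x :=
        (hasFDerivAt_id x).const_smul (c N)
      exact ((hχs.differentiable (by norm_num)) _).hasFDerivAt.comp x h2
    rw [h1.fderiv]
    simp only [ContinuousLinearMap.comp_smul, ContinuousLinearMap.comp_id, norm_smul]
    rw [Real.norm_of_nonneg (hc N).le]
    exact mul_le_mul_of_nonneg_left (hC _) (hc N).le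
  have hψ1 : ∀ N x, ‖ψ N x‖ ≤ 1 := fun N x => by
    rw [Real.norm_of_nonneg χ.nonneg]; exact χ.le_one
  have key : ∀ N, ∫ x, ψ N x • ∑ i, fderiv ℝ (X i) x (EuclideanSpace.single i 1)
      = - ∑ i, ∫ x, fderiv ℝ (ψ N) x (EuclideanSpace.single i 1) • X i x := by
    intro N
    have cX : ∀ i, Continuous (fun x => fderiv ℝ (X i) x (EuclideanSpace.single i 1)) := fun i =>
      ((hX i).continuous_fderiv (by norm_num)).clm_apply continuous_const
    have cψ : ∀ i : Fin n, Continuous (fun x => fderiv ℝ (ψ N) x (EuclideanSpace.single i 1)) := fun i =>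
      ((hψs N).continuous_fderiv (by norm_num)).clm_apply continuous_const
    have i1 : ∀ i, Integrable (fun x => ψ N x • fderiv ℝ (X i) x (EuclideanSpace.single i 1)) := fun i =>
      (((hψs N).continuous).smul (cX i)).integrable_of_hasCompactSupport ((hψc N).smul_right)
    simp only [Finset.smul_sum]
    rw [integral_finsetSum _ (fun i _ => i1 i), ← Finset.sum_neg_distrib]
    refine Finset.sum_congr rfl fun i _ => ?_
    apply integral_smul_fderiv_eq_neg_fderiv_smul_of_integrable
    · exact ((cψ i).smul (hX i).continuous).integrable_of_hasCompactSupport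
        (((hψc N).fderiv_apply ℝ _).smul_right)
    · exact i1 i
    · exact (((hψs N).continuous).smul (hX i).continuous).integrable_of_hasCompactSupport ((hψc N).smul_right)
    · exact fun x _ => (hψs N).differentiable (by norm_num) x
    · exact fun x _ => (hX i).differentiable (by norm_num) x
  have clim : Tendsto c atTop (𝓝 0) := tendsto_inv_atTop_zero.comp
    (tendsto_atTop_add_const_right _ _ tendsto_natCast_atTop_atTop)
  have L1 : Tendsto (fun N => ∫ x, ψ N x • ∑ i, fderiv ℝ (X i) x (EuclideanSpace.single i 1)) atTop
      (𝓝 (∫ x, ∑ i, fderiv ℝ (X i) x (EuclideanSpace.single i 1))) := by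
    refine tendsto_integral_of_dominated_convergence
      (fun x => ‖∑ i, fderiv ℝ (X i) x (EuclideanSpace.single i 1)‖) ?_ hd.norm ?_ ?_
    · exact fun N => ((hψs N).continuous.aestronglyMeasurable).smul hd.1
    · intro N
      refine Eventually.of_forall fun x => ?_
      rw [norm_smul]
      exact mul_le_of_le_one_left (norm_nonneg _) (hψ1 N x)
    · refine Eventually.of_forall fun x => ?_
      have h0 : Tendsto (fun N => c N • x) atTop (𝓝 0) := by
        simpa using clim.smul_const x
      have : ∀ᶠ N in atTop, ψ N x = 1 := by
        filter_upwards [h0 (Metric.closedBall_mem_nhds (0 : Euc n) one_pos)] with N hN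
        exact χ.one_of_mem_closedBall hN
      refine tendsto_const_nhds.congr' ?_
      filter_upwards [this] with N hN
      rw [hN, one_smul]
  have L2 : Tendsto (fun N => ∫ x, ψ N x • ∑ i, fderiv ℝ (X i) x (EuclideanSpace.single i 1)) atTop
      (𝓝 0) := by
    have hb : Tendsto (fun N => c N * (C * ∑ i, ∫ x, ‖X i x‖)) atTop (𝓝 0) := by
      simpa using clim.mul_const (C * ∑ i, ∫ x, ‖X i x‖)
    refine squeeze_zero_norm (fun N => ?_) hb
    rw [key, norm_neg]
    refine (norm_sum_le _ _).trans ?_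
    rw [Finset.mul_sum, Finset.mul_sum]
    refine Finset.sum_le_sum fun i _ => ?_
    rw [← mul_assoc, ← integral_const_mul]
    refine norm_integral_le_of_norm_le ((hXi i).norm.const_mul _) (Eventually.of_forall fun x => ?_)
    rw [norm_smul]
    refine mul_le_mul_of_nonneg_right ?_ (norm_nonneg _)
    refine (ContinuousLinearMap.le_opNorm _ _).trans ?_
    simpa using hψd N x
  exact tendsto_nhds_unique L1 L2

open scoped SchwartzMap FourierTransform LineDeriv Laplacian ContDiff

theorem lap_parts_aux {n : ℕ} (v : Euc n → ℝ) (hv : ContDiff ℝ ∞ v) (h0 : MemLp v 2)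
    (h1 : ∀ i : Fin n, MemLp (fun x => fderiv ℝ v x (EuclideanSpace.single i 1)) 2)
    (h2 : MemLp (lap n v) 2) (φ : 𝓢(Euc n, ℂ)) :
    ∫ x, φ x • ((lap n v x : ℝ) : ℂ) = ∫ x, (Δ φ) x • ((v x : ℝ) : ℂ) := by
  let e : Fin n → Euc n := fun i => EuclideanSpace.single i 1
  let D : Fin n → Euc n → ℝ := fun i x => fderiv ℝ v x (e i)
  have hD : ∀ i, ContDiff ℝ ∞ (D i) := fun i =>
    (hv.fderiv_right (m := ∞) (by simp)).clm_apply contDiff_const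
  have hφ : ContDiff ℝ ∞ φ := φ.smooth ⊤
  have hφi : ∀ i, ContDiff ℝ ∞ (∂_{e i} φ : 𝓢(Euc n, ℂ)) := fun i => (∂_{e i} φ).smooth ⊤
  have hof : ContDiff ℝ ∞ (fun r : ℝ => (r : ℂ)) := Complex.ofRealCLM.contDiff
  have ofd : ∀ (w : Euc n → ℝ) (x y : Euc n), ContDiff ℝ ∞ w →
      HasFDerivAt (fun z => (w z : ℂ)) (Complex.ofRealCLM.comp (fderiv ℝ w x)) x := by
    intro w x y hw
    exact Complex.ofRealCLM.hasFDerivAt.comp x ((hw.differentiable (by simp)) x).hasFDerivAt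
  have ml : ∀ (w : Euc n → ℝ), MemLp w 2 → MemLp (fun x => (w x : ℂ)) 2 := fun w hw => hw.ofReal
  let X : Fin n → Euc n → ℂ := fun i x => φ x * (D i x : ℂ) - (∂_{e i} φ) x * (v x : ℂ)
  have hdiv : ∀ i x, fderiv ℝ (X i) x (e i) =
      φ x * ((fderiv ℝ (D i) x (e i) : ℝ) : ℂ) - (∂_{e i} (∂_{e i} φ)) x * (v x : ℂ) := by
    intro i x
    have a1 : HasFDerivAt φ (fderiv ℝ φ x) x := (φ.differentiableAt).hasFDerivAt
    have a2 : HasFDerivAt (∂_{e i} φ : 𝓢(Euc n, ℂ)) (fderiv ℝ (∂_{e i} φ : 𝓢(Euc n, ℂ)) x) x := ((∂_{e i} φ).differentiableAt).hasFDerivAt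
    have := ((a1.mul (ofd (D i) x x (hD i))).sub (a2.mul (ofd v x x hv)))
    have h3 : fderiv ℝ (X i) x = _ := this.fderiv
    rw [h3]
    simp [SchwartzMap.lineDerivOp_apply_eq_fderiv, D]
    ring
  have hsum : ∀ x, ∑ i, fderiv ℝ (X i) x (e i) = φ x * ((lap n v x : ℝ) : ℂ) - (Δ φ) x * (v x : ℂ) := by
    intro x
    have h4 : (Δ φ) x = ∑ i, (∂_{e i} (∂_{e i} φ)) x := by
      rw [SchwartzMap.laplacian_eq_sum (EuclideanSpace.basisFun (Fin n) ℝ)]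
      simp [e]
    rw [h4, Finset.sum_mul]
    simp only [hdiv, Finset.sum_sub_distrib]
    rw [← Finset.mul_sum]
    simp [lap, D, e]
  have I1 : Integrable (fun x => φ x * ((lap n v x : ℝ) : ℂ)) := (φ.memLp 2).integrable_mul (ml _ h2)
  have I2 : Integrable (fun x => (Δ φ) x * ((v x : ℝ) : ℂ)) := ((Δ φ).memLp 2).integrable_mul (ml _ h0)
  have := div_zero_aux X (fun i => ?_) (fun i => ?_) ?_
  · change ∫ x, ∑ i, fderiv ℝ (X i) x (e i) = 0 at this
    simp only [hsum] at this
    rw [integral_sub I1 I2, sub_eq_zero] at this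
    simpa using this
  · exact (((hφ.mul (hof.comp (hD i))).sub ((hφi i).mul (hof.comp hv)))).of_le (by simp)
  · exact ((φ.memLp 2).integrable_mul (ml _ (h1 i))).sub (((∂_{e i} φ).memLp 2).integrable_mul (ml _ h0))
  · change Integrable (fun x => ∑ i, fderiv ℝ (X i) x (e i))
    simp only [hsum]
    exact I1.sub I2

theorem fourier_lap_aux {n : ℕ} (a b : Lp (α := Euc n) ℂ 2 volume)
    (h : ∀ φ : 𝓢(Euc n, ℂ), ∫ x, φ x • b x = ∫ x, (Δ φ) x • a x) :
    ∀ᵐ ξ, (𝓕 b : Lp (α := Euc n) ℂ 2 volume) ξ =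
      ((-(2 * π) ^ 2 * ‖ξ‖ ^ 2 : ℝ) : ℂ) * (𝓕 a : Lp (α := Euc n) ℂ 2 volume) ξ := by
  have h1 : Δ (a : 𝓢'(Euc n, ℂ)) = (b : 𝓢'(Euc n, ℂ)) := by
    ext φ
    rw [TemperedDistribution.laplacian_apply_apply, Lp.toTemperedDistribution_apply,
      Lp.toTemperedDistribution_apply, h]
  rw [TemperedDistribution.laplacian_eq_fourierMultiplierCLM] at h1
  have h2 := congrArg (fun T : 𝓢'(Euc n, ℂ) => 𝓕 T) h1
  have tg : (fun x : Euc n ↦ Complex.ofReal (‖x‖ ^ 2)).HasTemperateGrowth := by fun_prop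
  simp only [Lp.fourier_toTemperedDistribution_eq] at h2
  generalize hA : (𝓕 a : Lp (α := Euc n) ℂ 2 volume) = A
  generalize hB : (𝓕 b : Lp (α := Euc n) ℂ 2 volume) = B at h2
  have hla : LocallyIntegrable A volume := (Lp.memLp A).locallyIntegrable (by norm_num)
  have cont : Continuous (fun ξ : Euc n => ((-(2 * π) ^ 2 * ‖ξ‖ ^ 2 : ℝ) : ℂ)) := by fun_prop
  refine ae_eq_of_integral_contDiff_smul_eq ((Lp.memLp B).locallyIntegrable (by norm_num)) ?_ ?_
  · have := (hla.locallyIntegrableOn Set.univ).continuousOn_smul isOpen_univ.isLocallyClosed cont.continuousOn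
    simpa [smul_eq_mul] using locallyIntegrableOn_univ.1 this
  · intro g gs gc
    have hg₁ : HasCompactSupport (Complex.ofRealCLM ∘ g) := gc.comp_left rfl
    have hg₂ : ContDiff ℝ ∞ (Complex.ofRealCLM ∘ g) := by fun_prop
    have h3 := congrArg (fun T : 𝓢'(Euc n, ℂ) => T (hg₁.toSchwartzMap hg₂)) h2
    have h4 : 𝓕 ((-(2 * π) ^ 2) • TemperedDistribution.fourierMultiplierCLM ℂ
        (fun x : Euc n ↦ Complex.ofReal (‖x‖ ^ 2)) (a : 𝓢'(Euc n, ℂ)))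
      = ((-(2 * π) ^ 2 : ℝ) : ℂ) • TemperedDistribution.smulLeftCLM ℂ
        (fun x : Euc n ↦ Complex.ofReal (‖x‖ ^ 2)) (A : 𝓢'(Euc n, ℂ)) := by
      rw [← hA, ← Lp.fourier_toTemperedDistribution_eq]
      rw [TemperedDistribution.fourierMultiplierCLM_apply, ← Complex.coe_smul,
        FourierTransform.fourier_smul, FourierTransform.fourier_fourierInv_eq]
    simp only [h4] at h3
    rw [smul_apply, TemperedDistribution.smulLeftCLM_apply_apply,
      Lp.toTemperedDistribution_apply, Lp.toTemperedDistribution_apply, ← integral_smul] at h3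
    simp only [SchwartzMap.smulLeftCLM_apply_apply tg] at h3
    convert! h3.symm using 2
    ext x
    simp
    ring

theorem lapIter_smooth_aux {n : ℕ} (u : Euc n → ℝ) (hu : ContDiff ℝ ∞ u) (j : ℕ) :
    ContDiff ℝ ∞ (lapIter n j u) := by
  induction j with
  | zero => exact hu
  | succ j ih =>
    have hD : ∀ i : Fin n, ContDiff ℝ ∞ (fun y => fderiv ℝ (lapIter n j u) y (EuclideanSpace.single i 1)) :=
      fun i => (ih.fderiv_right (m := ∞) (by simp)).clm_apply contDiff_const
    change ContDiff ℝ ∞ (fun x => ∑ i : Fin n, _)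
    exact ContDiff.sum fun i _ => ((hD i).fderiv_right (m := ∞) (by simp)).clm_apply contDiff_const

theorem gradNormSq_nonneg_aux {n : ℕ} (γ : ℕ) (u : Euc n → ℝ) (x : Euc n) : 0 ≤ gradNormSq n γ u x := by
  unfold gradNormSq
  split_ifs
  · positivity
  · exact Finset.sum_nonneg fun i _ => sq_nonneg _

theorem fourier_decay_aux (n k : ℕ) (u : Euc n → ℝ) (hu : ContDiff ℝ ∞ u)
    (hint : Integrable (fun x => ∑ γ ∈ Finset.range (2 * k + 1), gradNormSq n γ u x)) :
    ∃ G : Lp (α := Euc n) ℂ 2 volume,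
      (∀ᵐ x, (𝓕⁻ G : Lp (α := Euc n) ℂ 2 volume) x = (u x : ℂ)) ∧
      Integrable (fun ξ => ‖ξ‖ ^ (4 * k) * ‖G ξ‖ ^ 2) := by
  have hs := lapIter_smooth_aux u hu
  have hDs : ∀ j (i : Fin n), ContDiff ℝ ∞ (fun y => fderiv ℝ (lapIter n j u) y (EuclideanSpace.single i 1)) :=
      fun j i => ((hs j).fderiv_right (m := ∞) (by simp)).clm_apply contDiff_const
  have sq1 : ∀ j ≤ k, MemLp (lapIter n j u) 2 := by
    intro j hj
    rw [memLp_two_iff_integrable_sq (hs j).continuous.aestronglyMeasurable]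
    refine hint.mono' ((hs j).continuous.pow 2).aestronglyMeasurable (Eventually.of_forall fun x => ?_)
    rw [Real.norm_of_nonneg (sq_nonneg _)]
    have := Finset.single_le_sum (f := fun γ => gradNormSq n γ u x)
      (fun γ _ => gradNormSq_nonneg_aux γ u x) (Finset.mem_range.2 (show 2 * j < 2 * k + 1 by lia))
    refine le_trans (le_of_eq ?_) this
    simp [gradNormSq]
  have sq2 : ∀ j < k, ∀ i : Fin n, MemLp (fun y => fderiv ℝ (lapIter n j u) y (EuclideanSpace.single i 1)) 2 := by
    intro j hj i
    rw [memLp_two_iff_integrable_sq (hDs j i).continuous.aestronglyMeasurable]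
    refine hint.mono' ((hDs j i).continuous.pow 2).aestronglyMeasurable (Eventually.of_forall fun x => ?_)
    rw [Real.norm_of_nonneg (sq_nonneg _)]
    have := Finset.single_le_sum (f := fun γ => gradNormSq n γ u x)
      (fun γ _ => gradNormSq_nonneg_aux γ u x) (Finset.mem_range.2 (show 2 * j + 1 < 2 * k + 1 by lia))
    refine le_trans ?_ this
    have e1 : (2 * j + 1) % 2 = 1 := by lia
    have e2 : (2 * j + 1) / 2 = j := by lia
    simp only [gradNormSq, e1, e2]
    simp only [one_ne_zero, if_false]
    exact Finset.single_le_sum (f := fun i => (fderiv ℝ (lapIter n j u) x (EuclideanSpace.single i 1))^2)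
      (fun i _ => sq_nonneg _) (Finset.mem_univ i)
  have mC : ∀ j ≤ k, MemLp (fun x => (lapIter n j u x : ℂ)) 2 := fun j hj => (sq1 j hj).ofReal
  let b0 : Lp (α := Euc n) ℂ 2 volume := (mC 0 (Nat.zero_le _)).toLp _
  have ind : ∀ j (hj : j ≤ k), ∀ᵐ ξ, (𝓕 ((mC j hj).toLp _) : Lp (α := Euc n) ℂ 2 volume) ξ
      = ((-(2 * π) ^ 2 * ‖ξ‖ ^ 2 : ℝ) : ℂ) ^ j * (𝓕 b0 : Lp (α := Euc n) ℂ 2 volume) ξ := by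
    intro j
    induction j with
    | zero => intro hj; exact Eventually.of_forall fun ξ => by simp [b0]
    | succ j ih =>
      intro hj
      have hj' : j ≤ k := by lia
      have := fourier_lap_aux ((mC j hj').toLp _) ((mC (j+1) hj).toLp _) (fun φ => by
        have h1 := lap_parts_aux (lapIter n j u) (hs j) (sq1 j hj') (sq2 j (by lia)) (sq1 (j+1) hj) φ
        refine Eq.trans (integral_congr_ae ?_) (h1.trans (integral_congr_ae ?_))
        · filter_upwards [(mC (j+1) hj).coeFn_toLp] with x hx
          rw [hx]; rfl
        · filter_upwards [(mC j hj').coeFn_toLp] with x hx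
          rw [hx])
      filter_upwards [this, ih hj'] with ξ h1 h2
      rw [h1, h2, pow_succ]
      ring
  refine ⟨𝓕 b0, ?_, ?_⟩
  · rw [FourierTransform.fourierInv_fourier_eq]
    exact (mC 0 (Nat.zero_le _)).coeFn_toLp
  · have h1 := ind k le_rfl
    have h2 : Integrable (fun ξ => ‖(𝓕 ((mC k le_rfl).toLp _) : Lp (α := Euc n) ℂ 2 volume) ξ‖ ^ 2) :=
      (memLp_two_iff_integrable_sq_norm (Lp.aestronglyMeasurable _)).1 (Lp.memLp _)
    have h3 : Integrable (fun ξ => (((2 * π) ^ (4 * k))⁻¹) *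
        ‖(𝓕 ((mC k le_rfl).toLp _) : Lp (α := Euc n) ℂ 2 volume) ξ‖ ^ 2) := h2.const_mul _
    refine h3.congr ?_
    filter_upwards [h1] with ξ h
    rw [h, norm_mul, norm_pow, Complex.norm_real, norm_mul, norm_neg, norm_pow, norm_pow, norm_norm,
      Real.norm_of_nonneg (by positivity : (0:ℝ) ≤ 2 * π)]
    rw [mul_pow, mul_pow _ _ k, ← pow_mul, ← pow_mul]
    have : (2 * π) ^ (4 * k) ≠ 0 := by positivity
    field_simp
    ring

theorem fourierInv_bound_aux {n : ℕ} (h : Lp (α := Euc n) ℂ 2 volume) (hi : Integrable h) :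
    ∀ᵐ x, ‖(𝓕⁻ h : Lp (α := Euc n) ℂ 2 volume) x‖ ≤ ∫ ξ, ‖h ξ‖ := by
  have key : ∀ᵐ x, (𝓕⁻ h : Lp (α := Euc n) ℂ 2 volume) x = 𝓕⁻ (h : Euc n → ℂ) x := by
    have hc : Continuous (𝓕⁻ (h : Euc n → ℂ)) :=
      VectorFourier.fourierIntegral_continuous continuous_fourierChar
        (by simp only [LinearMap.neg_apply, innerₗ_apply_apply]; fun_prop) hi
    refine ae_eq_of_integral_contDiff_smul_eq
      ((Lp.memLp (𝓕⁻ h : Lp (α := Euc n) ℂ 2 volume)).locallyIntegrable (by norm_num)) 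
      hc.locallyIntegrable ?_
    intro g gs gc
    have hg₁ : HasCompactSupport (Complex.ofRealCLM ∘ g) := gc.comp_left rfl
    have hg₂ : ContDiff ℝ ∞ (Complex.ofRealCLM ∘ g) := by fun_prop
    have h1 := congrArg (fun T : 𝓢'(Euc n, ℂ) => T (hg₁.toSchwartzMap hg₂))
      (Lp.fourierInv_toTemperedDistribution_eq h)
    simp only [TemperedDistribution.fourierInv_apply, Lp.toTemperedDistribution_apply] at h1
    have h2 := VectorFourier.integral_fourierIntegral_smul_eq_flip (L := -innerₗ (Euc n)) (μ := volume)
      (ν := volume) (f := (hg₁.toSchwartzMap hg₂)) (g := (h : Euc n → ℂ)) continuous_fourierChar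
      (by simp only [LinearMap.neg_apply, innerₗ_apply_apply]; fun_prop) (SchwartzMap.integrable _) hi
    have h3 : (-innerₗ (Euc n)).flip = -innerₗ (Euc n) := by
      ext x y; simp [real_inner_comm]
    rw [h3] at h2
    have h4 : ∀ ξ, (𝓕⁻ (hg₁.toSchwartzMap hg₂) : 𝓢(Euc n, ℂ)) ξ =
      VectorFourier.fourierIntegral 𝐞 volume (-innerₗ (Euc n)) (hg₁.toSchwartzMap hg₂) ξ := fun ξ => by
      rw [SchwartzMap.fourierInv_coe]; rfl
    simp only [h4] at h1
    rw [h2] at h1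
    convert! h1.symm using 2
  filter_upwards [key] with x hx
  rw [hx]
  exact VectorFourier.norm_fourierIntegral_le_integral_norm _ _ _ _ _

theorem annulus_aux {n : ℕ} (hn : 0 < n) (J : ℕ) :
    IntegrableOn (fun ξ : Euc n => (‖ξ‖ ^ n)⁻¹) (Metric.ball 0 (2 ^ J) \ Metric.ball 0 1) ∧
    ∫ ξ in Metric.ball (0 : Euc n) (2 ^ J) \ Metric.ball 0 1, (‖ξ‖ ^ n)⁻¹
      ≤ (2 ^ n * volume.real (Metric.ball (0 : Euc n) 1)) * J := by
  have meas : Measurable (fun ξ : Euc n => (‖ξ‖ ^ n)⁻¹) := by fun_prop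
  have io : ∀ J : ℕ, IntegrableOn (fun ξ : Euc n => (‖ξ‖ ^ n)⁻¹)
      (Metric.ball 0 (2 ^ J) \ Metric.ball 0 1) := by
    intro J
    refine Measure.integrableOn_of_bounded (M := 1) ?_ meas.aestronglyMeasurable ?_
    · exact ((measure_mono Set.sdiff_subset).trans_lt measure_ball_lt_top).ne
    · rw [ae_restrict_iff' (measurableSet_ball.diff measurableSet_ball)]
      refine Eventually.of_forall fun ξ hξ => ?_
      have : 1 ≤ ‖ξ‖ := by simpa using hξ.2
      rw [Real.norm_of_nonneg (by positivity)]
      exact inv_le_one_of_one_le₀ (one_le_pow₀ this)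
  refine ⟨io J, ?_⟩
  induction J with
  | zero => simp
  | succ J ih =>
    have h1 : (1:ℝ) ≤ 2 ^ J := one_le_pow₀ (by norm_num)
    have h2 : (2:ℝ) ^ J ≤ 2 ^ (J+1) := pow_le_pow_right₀ (by norm_num) (by lia)
    have hun : Metric.ball (0 : Euc n) (2 ^ (J+1)) \ Metric.ball 0 1 =
      (Metric.ball (0 : Euc n) (2 ^ J) \ Metric.ball 0 1) ∪
        (Metric.ball (0 : Euc n) (2 ^ (J+1)) \ Metric.ball 0 (2 ^ J)) := by
      ext ξ
      simp only [Set.mem_sdiff, Set.mem_union, mem_ball_zero_iff, not_lt]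
      constructor
      · rintro ⟨a, b⟩
        by_cases c : ‖ξ‖ < 2 ^ J
        · exact Or.inl ⟨c, b⟩
        · exact Or.inr ⟨a, not_lt.1 c⟩
      · rintro (⟨a, b⟩ | ⟨a, b⟩)
        · exact ⟨a.trans_le h2, b⟩
        · exact ⟨a, h1.trans b⟩
    have hsub : Metric.ball (0 : Euc n) (2 ^ (J+1)) \ Metric.ball 0 (2 ^ J) ⊆ 
        Metric.ball (0 : Euc n) (2 ^ (J+1)) \ Metric.ball 0 1 :=
      Set.sdiff_subset_sdiff_right (Metric.ball_subset_ball h1)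
    rw [hun, setIntegral_union ?_ (measurableSet_ball.diff measurableSet_ball) (io J) ((io (J+1)).mono_set hsub)]
    · push_cast
      rw [mul_add, mul_one]
      refine add_le_add ih ?_
      have hb : ∀ ξ ∈ Metric.ball (0 : Euc n) (2 ^ (J+1)) \ Metric.ball 0 (2 ^ J),
          ‖(‖ξ‖ ^ n)⁻¹‖ ≤ ((2 ^ J) ^ n)⁻¹ := by
        intro ξ hξ
        have : (2:ℝ) ^ J ≤ ‖ξ‖ := by simpa using hξ.2
        rw [Real.norm_of_nonneg (by positivity)]
        exact inv_anti₀ (by positivity) (pow_le_pow_left₀ (by positivity) this n)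
      refine (le_abs_self _).trans ((norm_setIntegral_le_of_norm_le_const
        ((measure_mono Set.sdiff_subset).trans_lt measure_ball_lt_top) hb).trans ?_)
      have hv : volume.real (Metric.ball (0 : Euc n) (2 ^ (J+1)) \ Metric.ball 0 (2 ^ J)) ≤
          (2 ^ (J+1)) ^ n * volume.real (Metric.ball (0 : Euc n) 1) := by
        refine (measureReal_mono Set.sdiff_subset measure_ball_lt_top.ne).trans (le_of_eq ?_)
        rw [Measure.real, Measure.addHaar_ball_of_pos _ _ (by positivity)]
        simp [Measure.real]
      refine (mul_le_mul_of_nonneg_left hv (by positivity)).trans (le_of_eq ?_)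
      rw [pow_succ, mul_pow]
      field_simp
    · rw [Set.disjoint_left]
      intro ξ a b
      exact b.2 a.1

theorem low_aux {n : ℕ} (hn : 0 < n) (G : Euc n → ℂ) (hGl : LocallyIntegrable G)
    (hG : Integrable (fun ξ => ‖ξ‖ ^ n * ‖G ξ‖ ^ 2)) (ε : ℝ) (hε : 0 < ε) :
    ∃ A : ℝ, 0 ≤ A ∧ ∀ J : ℕ, ∫ ξ in Metric.ball (0 : Euc n) (2 ^ J), ‖G ξ‖ ≤ A + ε * √J := by
  set C0 : ℝ := 2 ^ n * volume.real (Metric.ball (0 : Euc n) 1) with hC0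
  have hC0p : 0 < C0 := by
    have : 0 < volume.real (Metric.ball (0 : Euc n) 1) :=
      ENNReal.toReal_pos (Metric.measure_ball_pos _ _ one_pos).ne' measure_ball_lt_top.ne
    positivity
  have iB : ∀ r, IntegrableOn (fun ξ => ‖G ξ‖) (Metric.ball 0 r) := fun r =>
    ((hGl.integrableOn_isCompact (isCompact_closedBall (0 : Euc n) r)).mono_set
      Metric.ball_subset_closedBall).norm
  have htail : ∃ J0 : ℕ, ∫ ξ in (Metric.ball (0 : Euc n) (2 ^ J0))ᶜ, ‖ξ‖ ^ n * ‖G ξ‖ ^ 2 ≤ ε ^ 2 / C0 := by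
    have hmono : Antitone (fun J : ℕ => (Metric.ball (0 : Euc n) (2 ^ J))ᶜ) := fun i j hij =>
      Set.compl_subset_compl.2 (Metric.ball_subset_ball (pow_le_pow_right₀ (by norm_num) hij))
    have ht := hmono.tendsto_setIntegral (μ := volume) (f := fun ξ => ‖ξ‖ ^ n * ‖G ξ‖ ^ 2)
      (fun i => measurableSet_ball.compl) hG.integrableOn
    have hemp : (⋂ J : ℕ, (Metric.ball (0 : Euc n) (2 ^ J))ᶜ) = ∅ := by
      ext ξ
      simp only [Set.mem_iInter, Set.mem_compl_iff, mem_ball_zero_iff, not_lt, Set.mem_empty_iff_false,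
        iff_false, not_forall, not_le]
      exact pow_unbounded_of_one_lt _ (by norm_num)
    rw [hemp, setIntegral_empty] at ht
    obtain ⟨J0, h⟩ := (ht.eventually (gt_mem_nhds (show (0:ℝ) < ε ^ 2 / C0 by positivity))).exists
    exact ⟨J0, h.le⟩
  obtain ⟨J0, hJ0⟩ := htail
  refine ⟨∫ ξ in Metric.ball (0 : Euc n) (2 ^ J0), ‖G ξ‖, by positivity, fun J => ?_⟩
  rcases le_or_gt J J0 with hle | hlt
  · have : ∫ ξ in Metric.ball (0 : Euc n) (2 ^ J), ‖G ξ‖ ≤ ∫ ξ in Metric.ball (0 : Euc n) (2 ^ J0), ‖G ξ‖ :=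
      setIntegral_mono_set (iB _) (Eventually.of_forall fun _ => norm_nonneg _)
        (LE.le.eventuallyLE (Metric.ball_subset_ball (pow_le_pow_right₀ (by norm_num) hle)))
    have : 0 ≤ ε * √J := by positivity
    linarith
  · have hJ : 0 < √(J : ℝ) := Real.sqrt_pos.2 (by exact_mod_cast (by lia : 0 < J))
    have h2 : (2:ℝ) ^ J0 ≤ 2 ^ J := pow_le_pow_right₀ (by norm_num) hlt.le
    have h1 : (1:ℝ) ≤ 2 ^ J0 := one_le_pow₀ (by norm_num)
    set T := Metric.ball (0 : Euc n) (2 ^ J) \ Metric.ball 0 (2 ^ J0) with hT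
    have hTm : MeasurableSet T := measurableSet_ball.diff measurableSet_ball
    have hun : Metric.ball (0 : Euc n) (2 ^ J) = Metric.ball (0 : Euc n) (2 ^ J0) ∪ T :=
      (Set.union_sdiff_cancel (Metric.ball_subset_ball h2)).symm
    rw [hun, setIntegral_union Set.disjoint_sdiff_right hTm (iB _) ((iB _).mono_set Set.sdiff_subset)]
    gcongr
    obtain ⟨a1, a2⟩ := annulus_aux hn J
    have hTs : T ⊆ Metric.ball 0 (2 ^ J) \ Metric.ball 0 1 :=
      Set.sdiff_subset_sdiff_right (Metric.ball_subset_ball h1)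
    have b2 : ∫ ξ in T, (‖ξ‖ ^ n)⁻¹ ≤ C0 * J :=
      (setIntegral_mono_set a1 (Eventually.of_forall fun _ => by positivity) hTs.eventuallyLE).trans a2
    have b1 : ∫ ξ in T, ‖ξ‖ ^ n * ‖G ξ‖ ^ 2 ≤ ε ^ 2 / C0 :=
      (setIntegral_mono_set hG.integrableOn (Eventually.of_forall fun _ => by positivity)
        (LE.le.eventuallyLE (fun ξ hξ => hξ.2))).trans hJ0
    set t : ℝ := √(J:ℝ) * (C0 / ε) with ht
    have htp : 0 < t := by positivity
    have c1 : ∫ ξ in T, ‖G ξ‖ ≤ ∫ ξ in T, (t / 2 * (‖ξ‖ ^ n * ‖G ξ‖ ^ 2) + t⁻¹ / 2 * (‖ξ‖ ^ n)⁻¹) := by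
      refine setIntegral_mono_on ((iB _).mono_set Set.sdiff_subset)
        ((hG.integrableOn.const_mul _).add ((a1.mono_set hTs).const_mul _)) hTm ?_
      intro ξ hξ
      have hξ1 : (2:ℝ) ^ J0 ≤ ‖ξ‖ := by simpa using hξ.2
      have hξ0 : 0 < ‖ξ‖ := by linarith
      have hy : 0 < t * ‖ξ‖ ^ n := by positivity
      have e : t / 2 * (‖ξ‖ ^ n * ‖G ξ‖ ^ 2) + t⁻¹ / 2 * (‖ξ‖ ^ n)⁻¹ - ‖G ξ‖
         = (t * ‖ξ‖ ^ n * ‖G ξ‖ - 1) ^ 2 / (2 * (t * ‖ξ‖ ^ n)) := by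
        field_simp
        ring
      have : 0 ≤ (t * ‖ξ‖ ^ n * ‖G ξ‖ - 1) ^ 2 / (2 * (t * ‖ξ‖ ^ n)) := by positivity
      linarith
    rw [integral_add (hG.integrableOn.const_mul _) ((a1.mono_set hTs).const_mul _),
      integral_const_mul, integral_const_mul] at c1
    refine c1.trans ?_
    have d1 : t / 2 * ∫ ξ in T, ‖ξ‖ ^ n * ‖G ξ‖ ^ 2 ≤ t / 2 * (ε ^ 2 / C0) := by gcongr
    have d2 : t⁻¹ / 2 * ∫ ξ in T, (‖ξ‖ ^ n)⁻¹ ≤ t⁻¹ / 2 * (C0 * J) := by gcongr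
    have e1 : t / 2 * (ε ^ 2 / C0) = ε * √J / 2 := by
      rw [ht]; field_simp
    have e2 : t⁻¹ / 2 * (C0 * J) = ε * √J / 2 := by
      rw [ht]
      have : (J:ℝ) = √J * √J := (Real.mul_self_sqrt (by positivity)).symm
      rw [this, Real.sqrt_mul_self hJ.le]
      field_simp
    linarith

theorem L2_norm_sq_aux {n : ℕ} (f : Lp (α := Euc n) ℂ 2 volume) : ∫ x, ‖f x‖ ^ 2 = ‖f‖ ^ 2 := by
  have h := L2.inner_def (𝕜 := ℂ) f f
  rw [inner_self_eq_norm_sq_to_K] at h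
  simp only [inner_self_eq_norm_sq_to_K] at h
  have h2 : (((∫ x, ‖f x‖ ^ 2 : ℝ)) : ℂ) = ((‖f‖ ^ 2 : ℝ) : ℂ) := by
    rw [← integral_complex_ofReal]
    push_cast
    exact h.symm
  exact_mod_cast h2

theorem level_aux {n : ℕ} (hn : 2 ≤ n) (u : Euc n → ℝ) (G : Lp (α := Euc n) ℂ 2 volume)
    (hu : ∀ᵐ x, (𝓕⁻ G : Lp (α := Euc n) ℂ 2 volume) x = (u x : ℂ))
    (hG : Integrable (fun ξ => ‖ξ‖ ^ n * ‖G ξ‖ ^ 2)) (ε : ℝ) (hε : 0 < ε) :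
    ∃ A M : ℝ, 0 ≤ A ∧ 0 ≤ M ∧ ∀ J : ℕ,
      volume {x | A + 1 + ε * √J < |u x|} ≤ ENNReal.ofReal (M * (1/4) ^ J) := by
  have hGl : LocallyIntegrable G volume := (Lp.memLp G).locallyIntegrable (by norm_num)
  obtain ⟨A, hA0, hA⟩ := low_aux (by lia) G hGl hG ε hε
  refine ⟨A, ∫ ξ, ‖ξ‖ ^ n * ‖G ξ‖ ^ 2, hA0, by positivity, fun J => ?_⟩
  set B := Metric.ball (0 : Euc n) (2 ^ J) with hB
  have hBm : MeasurableSet B := measurableSet_ball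
  have m1 : MemLp (B.indicator G) 2 volume := (Lp.memLp G).indicator hBm
  have m2 : MemLp (Bᶜ.indicator G) 2 volume := (Lp.memLp G).indicator hBm.compl
  set H1 := m1.toLp _ with hH1
  set H2 := m2.toLp _ with hH2
  have hsum : G = H1 + H2 := by
    apply Lp.ext
    filter_upwards [Lp.coeFn_add H1 H2, m1.coeFn_toLp, m2.coeFn_toLp] with x a b c
    rw [a, Pi.add_apply, b, c]
    by_cases hx : x ∈ B <;> simp [hx]
  have hF : (𝓕⁻ G : Lp (α := Euc n) ℂ 2 volume) = 𝓕⁻ H1 + 𝓕⁻ H2 := by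
    rw [← FourierTransform.fourierInv_add, ← hsum]
  have b1 : ∀ᵐ x, ‖(𝓕⁻ H1 : Lp (α := Euc n) ℂ 2 volume) x‖ ≤ A + ε * √J := by
    have i1 : Integrable H1 volume := by
      have : IntegrableOn G B volume := 
        (hGl.integrableOn_isCompact (isCompact_closedBall (0 : Euc n) (2 ^ J))).mono_set
          Metric.ball_subset_closedBall
      exact (this.integrable_indicator hBm).congr m1.coeFn_toLp.symm
    have e1 : ∫ ξ, ‖H1 ξ‖ = ∫ ξ in B, ‖G ξ‖ := by
      rw [← integral_indicator hBm]
      refine integral_congr_ae ?_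
      filter_upwards [m1.coeFn_toLp] with x hx
      rw [hx, norm_indicator_eq_indicator_norm]
    filter_upwards [fourierInv_bound_aux H1 i1] with x hx
    exact hx.trans (e1.le.trans (hA J))
  have n2 : ‖(𝓕⁻ H2 : Lp (α := Euc n) ℂ 2 volume)‖ = ‖H2‖ := by
    rw [← Lp.norm_fourier_eq, FourierTransform.fourier_fourierInv_eq]
  have b2 : ∫ x, ‖(𝓕⁻ H2 : Lp (α := Euc n) ℂ 2 volume) x‖ ^ 2 ≤ (∫ ξ, ‖ξ‖ ^ n * ‖G ξ‖ ^ 2) * (1/4) ^ J := by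
    rw [L2_norm_sq_aux, n2, ← L2_norm_sq_aux, ← integral_mul_const]
    have i2 : Integrable (fun x => ‖H2 x‖ ^ 2) volume :=
      (memLp_two_iff_integrable_sq_norm (Lp.aestronglyMeasurable _)).1 (Lp.memLp _)
    refine integral_mono_ae i2 (hG.mul_const _) ?_
    filter_upwards [m2.coeFn_toLp] with ξ hξ
    rw [hξ]
    by_cases hx : ξ ∈ B
    · simp [hx]
      positivity
    · rw [Set.indicator_of_mem (show ξ ∈ Bᶜ from hx)]
      have h1 : (2:ℝ) ^ J ≤ ‖ξ‖ := by simpa [hB] using hx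
      have h2 : (4:ℝ) ^ J ≤ ‖ξ‖ ^ n := by
        have h0 : (1:ℝ) ≤ 2 ^ J := one_le_pow₀ (by norm_num)
        calc (4:ℝ) ^ J = (2 ^ J) ^ 2 := by rw [← pow_mul, mul_comm, pow_mul]; norm_num
          _ ≤ (2 ^ J) ^ n := pow_le_pow_right₀ h0 hn
          _ ≤ ‖ξ‖ ^ n := pow_le_pow_left₀ (by positivity) h1 n
      have h3 : 1 ≤ ‖ξ‖ ^ n * (1/4) ^ J := by
        rw [one_div, inv_pow, ← div_eq_mul_inv, one_le_div (by positivity)]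
        exact h2
      calc ‖G ξ‖ ^ 2 = 1 * ‖G ξ‖ ^ 2 := (one_mul _).symm
        _ ≤ (‖ξ‖ ^ n * (1/4) ^ J) * ‖G ξ‖ ^ 2 := by gcongr
        _ = _ := by ring
  have i2 : Integrable (fun x => ‖(𝓕⁻ H2 : Lp (α := Euc n) ℂ 2 volume) x‖ ^ 2) volume :=
      (memLp_two_iff_integrable_sq_norm (Lp.aestronglyMeasurable _)).1 (Lp.memLp _)
  have mk := mul_meas_ge_le_lintegral₀ (μ := volume)
    (i2.1.aemeasurable.ennreal_ofReal) 1
  rw [one_mul, ← ofReal_integral_eq_lintegral_ofReal i2 (Eventually.of_forall fun _ => by positivity)] at mk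
  refine le_trans (measure_mono_ae ?_) (mk.trans (ENNReal.ofReal_le_ofReal b2))
  rw [hF] at hu
  filter_upwards [hu, b1, Lp.coeFn_add (𝓕⁻ H1 : Lp (α := Euc n) ℂ 2 volume) (𝓕⁻ H2)] with x h1 h2 h3 h4
  have h4 : A + 1 + ε * √J < |u x| := h4
  change 1 ≤ ENNReal.ofReal _
  rw [ENNReal.one_le_ofReal]
  rw [h1, Pi.add_apply] at h3
  have h5 : |u x| ≤ ‖(𝓕⁻ H1 : Lp (α := Euc n) ℂ 2 volume) x‖ + ‖(𝓕⁻ H2 : Lp (α := Euc n) ℂ 2 volume) x‖ := by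
    rw [← Real.norm_eq_abs, ← Complex.norm_real, h3]
    exact norm_add_le _ _
  have h6 : 1 ≤ ‖(𝓕⁻ H2 : Lp (α := Euc n) ℂ 2 volume) x‖ := by linarith
  exact one_le_pow₀ h6

theorem exp_int_aux {n : ℕ} (u : Euc n → ℝ) (hc : Continuous u) (h2 : Integrable (fun x => u x ^ 2))
    (hl : ∀ ε : ℝ, 0 < ε → ∃ A M : ℝ, 0 ≤ A ∧ 0 ≤ M ∧ ∀ J : ℕ,
      volume {x | A + 1 + ε * √J < |u x|} ≤ ENNReal.ofReal (M * (1/4) ^ J))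
    (α : ℝ) (hα : 0 < α) : Integrable (fun x => Real.exp (α * u x ^ 2) - 1) := by
  have hε : 0 < √(1 / (2 * α)) := Real.sqrt_pos.2 (by positivity)
  have hε2 : 2 * α * √(1 / (2 * α)) ^ 2 = 1 := by
    rw [Real.sq_sqrt (by positivity)]; field_simp
  obtain ⟨A, M, hA, hM, hv⟩ := hl _ hε
  generalize √(1 / (2 * α)) = ε at *
  set L : ℕ → ℝ := fun J => A + 1 + ε * √J with hL
  set K : ℝ := 2 * α * (A + 1) ^ 2 with hK
  have hLsq : ∀ J, α * L J ^ 2 ≤ K + J := by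
    intro J
    have h1 : √(J:ℝ) ^ 2 = J := Real.sq_sqrt (by positivity)
    have h3 : α * L J ^ 2 ≤ α * (2 * (A + 1) ^ 2 + 2 * (ε * √J) ^ 2) := by
      refine mul_le_mul_of_nonneg_left ?_ hα.le
      simp only [hL]
      nlinarith [sq_nonneg (A + 1 - ε * √J)]
    refine h3.trans (le_of_eq ?_)
    rw [mul_pow, h1, hK]
    linear_combination (J:ℝ) * hε2
  have hLtop : Tendsto L atTop atTop := by
    refine tendsto_atTop_add_const_left _ _ (Tendsto.const_mul_atTop hε ?_)
    exact Real.tendsto_sqrt_atTop.comp tendsto_natCast_atTop_atTop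
  have hexp : ∀ y : ℝ, Real.exp y - 1 ≤ y * Real.exp y := by
    intro y
    have h1 := Real.add_one_le_exp (-y)
    have h3 : Real.exp (-y) * Real.exp y = 1 := by rw [← Real.exp_add]; simp
    nlinarith [Real.exp_pos y]
  have hmeasE : ∀ J, MeasurableSet {x | L J < |u x|} := fun J =>
    measurableSet_lt measurable_const hc.abs.measurable
  set f1 : Euc n → ENNReal := fun x => ENNReal.ofReal (α * Real.exp K * u x ^ 2) with hf1
  set f2 : ℕ → Euc n → ENNReal := fun J =>
    {x | L J < |u x|}.indicator (fun _ => ENNReal.ofReal (Real.exp (K + (J + 1)))) with hf2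
  have hpt : ∀ x, ENNReal.ofReal (Real.exp (α * u x ^ 2) - 1) ≤ f1 x + ∑' J, f2 J x := by
    intro x
    by_cases h : |u x| ≤ L 0
    · refine le_trans (ENNReal.ofReal_le_ofReal ?_) le_self_add
      have h3 : α * u x ^ 2 ≤ K := by
        have : u x ^ 2 ≤ L 0 ^ 2 := by
          rw [← sq_abs (u x)]
          exact pow_le_pow_left₀ (abs_nonneg _) h 2
        have h4 := hLsq 0
        have h5 := mul_le_mul_of_nonneg_left this hα.le
        simp only [Nat.cast_zero, add_zero] at h4
        linarith
      refine (hexp _).trans ?_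
      have : Real.exp (α * u x ^ 2) ≤ Real.exp K := Real.exp_le_exp.2 h3
      have h6 : 0 ≤ α * u x ^ 2 := by positivity
      nlinarith [mul_le_mul_of_nonneg_left this h6]
    · have hex : ∃ J, |u x| ≤ L J := (hLtop.eventually_ge_atTop _).exists
      classical
      obtain ⟨J, hJ1, hJ2⟩ : ∃ J, L J < |u x| ∧ |u x| ≤ L (J + 1) := by
        have h0 : Nat.find hex ≠ 0 := fun h0 => h (h0 ▸ Nat.find_spec hex)
        obtain ⟨J, hJ⟩ := Nat.exists_eq_succ_of_ne_zero h0
        refine ⟨J, not_le.1 (Nat.find_min hex (by lia)), ?_⟩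
        have := Nat.find_spec hex
        rwa [hJ] at this
      refine le_trans ?_ (le_trans (ENNReal.le_tsum J) le_add_self)
      rw [hf2]
      simp only
      rw [Set.indicator_of_mem (show x ∈ {x | L J < |u x|} from hJ1)]
      refine ENNReal.ofReal_le_ofReal ?_
      have h3 : u x ^ 2 ≤ L (J+1) ^ 2 := by
        rw [← sq_abs (u x)]
        exact pow_le_pow_left₀ (abs_nonneg _) hJ2 2
      have h4 := hLsq (J+1)
      have h5 := mul_le_mul_of_nonneg_left h3 hα.le
      push_cast at h4
      have : Real.exp (α * u x ^ 2) ≤ Real.exp (K + (J + 1)) := Real.exp_le_exp.2 (by linarith)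
      linarith
  have hnn : ∀ x, 0 ≤ Real.exp (α * u x ^ 2) - 1 := fun x => by
    have : 1 ≤ Real.exp (α * u x ^ 2) := Real.one_le_exp (by positivity)
    linarith
  have hcont : Continuous (fun x => Real.exp (α * u x ^ 2) - 1) := by fun_prop
  refine ⟨hcont.aestronglyMeasurable, ?_⟩
  rw [hasFiniteIntegral_iff_ofReal (Eventually.of_forall hnn)]
  refine (lintegral_mono hpt).trans_lt ?_
  have hf1m : Measurable f1 := by
    have : Measurable u := hc.measurable
    fun_prop
  rw [lintegral_add_left hf1m, lintegral_tsum (fun J => (measurable_const.indicator (hmeasE J)).aemeasurable)]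
  refine ENNReal.add_lt_top.2 ⟨?_, ?_⟩
  · have := (h2.const_mul (α * Real.exp K))
    exact (hasFiniteIntegral_iff_ofReal (Eventually.of_forall fun x => by positivity)).1 this.2
  · have hb : ∀ J, ∫⁻ x, f2 J x ≤ ENNReal.ofReal ((Real.exp (K + 1) * M) * (Real.exp 1 / 4) ^ J) := by
      intro J
      simp only [hf2]
      rw [lintegral_indicator_const (hmeasE J)]
      refine (mul_le_mul_right (hv J) _).trans (le_of_eq ?_)
      rw [← ENNReal.ofReal_mul (Real.exp_pos _).le]
      congr 1
      rw [show K + ((J:ℝ) + 1) = (K + 1) + J * 1 by ring, Real.exp_add, Real.exp_nat_mul, div_pow, div_pow]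
      ring
    refine (ENNReal.tsum_le_tsum hb).trans_lt ?_
    refine Ne.lt_top (Summable.tsum_ofReal_ne_top ?_)
    refine (summable_geometric_of_lt_one (by positivity) ?_).mul_left _
    have := Real.exp_one_lt_d9
    linarith

/-- The key claim in the proof of Lemma 4.4: for every smooth `u` of finite `W^{m,2}`-norm
and every `α > 0`, the singular exponential integral `∫ (e^{αu²} - 1)/|x|^β dx` is finite. -/
theorem exp_integral_finite (m : ℕ) (hm : 2 ≤ m) (hme : Even m)
    (β α : ℝ) (hβ0 : 0 ≤ β) (hβ : β < 2*m) (hα : 0 < α)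
    (u : Euc (2*m) → ℝ) (hu : ContDiff ℝ (⊤ : ℕ∞) u)
    (hint : Integrable (fun x => ∑ γ ∈ Finset.range (m+1), gradNormSq (2*m) γ u x)) :
    Integrable (fun x : Euc (2*m) => (Real.exp (α * (u x)^2) - 1) / ‖x‖ ^ β) := by
  obtain ⟨k, hk⟩ := hme
  have hmk : m = 2 * k := by lia
  have hint' : Integrable (fun x => ∑ γ ∈ Finset.range (2 * k + 1), gradNormSq (2*m) γ u x) := by
    rw [← hmk]; exact hint
  obtain ⟨G, hG1, hG2⟩ := fourier_decay_aux (2*m) k u hu hint'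
  have h4 : 4 * k = 2 * m := by lia
  rw [h4] at hG2
  have hc : Continuous u := hu.continuous
  have hsq : Integrable (fun x => u x ^ 2) := by
    refine hint.mono' (hc.pow 2).aestronglyMeasurable (Eventually.of_forall fun x => ?_)
    rw [Real.norm_of_nonneg (sq_nonneg _)]
    have := Finset.single_le_sum (f := fun γ => gradNormSq (2*m) γ u x)
      (fun γ _ => gradNormSq_nonneg_aux γ u x) (Finset.mem_range.2 (show 0 < m + 1 by lia))
    refine le_trans (le_of_eq ?_) this
    simp [gradNormSq, lapIter]
  have hE := exp_int_aux u hc hsq (fun ε hε => level_aux (by lia) u G hG1 hG2 ε hε) α hα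
  have hnn : ∀ x, 0 ≤ Real.exp (α * u x ^ 2) - 1 := fun x => by
    have : 1 ≤ Real.exp (α * u x ^ 2) := Real.one_le_exp (by positivity)
    linarith
  have hcont : Continuous (fun x => Real.exp (α * u x ^ 2) - 1) := by fun_prop
  have hmeas : Measurable (fun x : Euc (2*m) => (Real.exp (α * (u x)^2) - 1) / ‖x‖ ^ β) :=
    hcont.measurable.div (by fun_prop)
  rw [← integrableOn_univ, ← Set.union_compl_self (Metric.ball (0 : Euc (2*m)) 1)]
  refine IntegrableOn.union ?_ ?_
  · obtain ⟨C, hC⟩ := (isCompact_closedBall (0 : Euc (2*m)) 1).exists_bound_of_continuousOn hcont.continuousOn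
    refine integrableOn_ball_of_norm_le_rpow (C := C) (α := β) ?_ ?_ ?_ ?_
    · rw [finrank_euclideanSpace, Fintype.card_fin]; lia
    · rw [finrank_euclideanSpace, Fintype.card_fin]; push_cast; exact hβ
    · rw [ae_restrict_iff' measurableSet_ball]
      refine Eventually.of_forall fun x hx => ?_
      have h1 := hC x (Metric.ball_subset_closedBall hx)
      have h2 : 0 ≤ ‖x‖ ^ β := by positivity
      rw [Real.rpow_neg (norm_nonneg x), norm_div, Real.norm_of_nonneg h2, div_eq_mul_inv]
      exact mul_le_mul_of_nonneg_right h1 (inv_nonneg.2 h2)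
    · exact hmeas.aestronglyMeasurable
  · refine (hE.integrableOn (s := (Metric.ball (0 : Euc (2*m)) 1)ᶜ)).mono' hmeas.aestronglyMeasurable ?_
    rw [ae_restrict_iff' measurableSet_ball.compl]
    refine Eventually.of_forall fun x hx => ?_
    have h1 : 1 ≤ ‖x‖ := by simpa using hx
    rw [Real.norm_of_nonneg (div_nonneg (hnn x) (by positivity))]
    exact div_le_self (hnn x) (Real.one_le_rpow h1 hβ0)
end
end
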